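/- Let k be a field, let n be a positive integer not divisible by the characteristic of k, and let D be a central division algebra of degree n over k. Let K = k(x) be the field of rational functions in one variable over k. If Δ is a central division algebra of degree n over K that has the same maximal subfields as D ⊗_k K, then there exists a central division algebra D' of degree n over k that has the same maximal subfields as D and such that Δ is isomorphic to D' ⊗_k K as a K-algebra. -/

import Mathlib

open scoped TensorProduct

/-- `D` is a central division algebra of degree `n` over `k`: a division ring which is a
`k`-algebra whose center is exactly `k` and whose dimension over `k` is `n ^ 2`. -/
def IsCentralDivisionAlgebraOfDegree (k : Type) [Field k] (n : ℕ) (D : Type)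
    [DivisionRing D] [Algebra k D] : Prop :=
  Subalgebra.center k D = ⊥ ∧ Module.finrank k D = n ^ 2

/-- Two `k`-algebras have the same maximal subfields (relative to the degree `n`):
a field extension `P/k` of degree `n` embeds into one if and only if it embeds
into the other. -/
def HaveSameMaximalSubfields (k : Type) [Field k] (n : ℕ)
    (D₁ : Type) [Ring D₁] [Algebra k D₁] (D₂ : Type) [Ring D₂] [Algebra k D₂] : Prop :=
  ∀ (P : Type) [Field P] [Algebra k P], Module.finrank k P = n →
    (Nonempty (P →ₐ[k] D₁) ↔ Nonempty (P →ₐ[k] D₂))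

section Density

variable {k D : Type*} [Field k] [DivisionRing D] [Algebra k D]

/-- Every `k`-linear endomorphism of a finite-dimensional central division algebra is a sum of
two-sided multiplications. -/
theorem mulLeftRight_surjective_of_center_eq_bot [FiniteDimensional k D]
    (hD : Subalgebra.center k D = ⊥) : Function.Surjective (AlgHom.mulLeftRight k D) := by
  let E : Subalgebra k (Module.End k D) := (AlgHom.mulLeftRight k D).range
  have hL (a : D) : LinearMap.mulLeft k a ∈ E := ⟨a ⊗ₜ 1, by ext; simp⟩
  have hR (a : D) : LinearMap.mulRight k a ∈ E := ⟨1 ⊗ₜ MulOpposite.op a, by ext; simp⟩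
  have : IsSimpleModule E D := by
    rw [isSimpleModule_iff_toSpanSingleton_surjective]
    refine ⟨inferInstance, fun v hv w => ⟨⟨_, hL (w * v⁻¹)⟩, ?_⟩⟩
    change w * v⁻¹ * v = w
    simp [hv]
  have hsmul (f : Module.End E D) (a v : D) : f (a * v) = a * f v := by
    have := f.map_smul (⟨_, hL a⟩ : E) v
    exact this
  have hsmul' (f : Module.End E D) (a v : D) : f (v * a) = f v * a := by
    have := f.map_smul (⟨_, hR a⟩ : E) v
    exact this
  have hcen (f : Module.End E D) : ∃ c : k, ∀ v, f v = c • v := by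
    have h1 : f 1 ∈ Subalgebra.center k D := by
      rw [Subalgebra.mem_center_iff]
      intro b
      rw [← hsmul, ← hsmul', mul_one, one_mul]
    rw [hD] at h1
    obtain ⟨c, hc⟩ := Algebra.mem_bot.1 h1
    refine ⟨c, fun v => ?_⟩
    have := hsmul f v 1
    rw [mul_one] at this
    rw [this, ← hc, Algebra.smul_def, Algebra.commutes]
  intro φ
  let φ' : Module.End (Module.End E D) D :=
    { toFun := φ
      map_add' := map_add φ
      map_smul' := fun f v => by
        obtain ⟨c, hc⟩ := hcen f
        simp [hc] }
  obtain ⟨s, hs⟩ := Module.Finite.fg_top (R := k) (M := D)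
  obtain ⟨⟨r, t, ht⟩, hr⟩ := jacobson_density (R := E) (M := D) φ' s
  refine ⟨t, ?_⟩
  replace ht : (AlgHom.mulLeftRight k D) t = r := ht
  rw [ht]
  refine LinearMap.ext_on hs fun m hm => ?_
  exact (hr m hm).symm

/-- If `B` is a field and `D` a central division algebra then `B ⊗ D` is a simple ring. -/
theorem isSimpleRing_tensorProduct (B : Type*) [Field B] [Algebra k B] [FiniteDimensional k D]
    (hD : Subalgebra.center k D = ⊥) : IsSimpleRing (B ⊗[k] D) := by
  refine ⟨⟨fun I => ?_⟩⟩
  by_cases hI : I = ⊥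
  · exact Or.inl hI
  right
  obtain ⟨x, hx, hx0⟩ : ∃ x ∈ I, x ≠ 0 := by
    by_contra! h
    exact hI (le_bot_iff.1 fun x hx => (TwoSidedIdeal.mem_bot _).2 (h x hx))
  have key (φ : Module.End k D) : (φ.baseChange B) x ∈ I := by
    obtain ⟨t, rfl⟩ := mulLeftRight_surjective_of_center_eq_bot hD φ
    induction t with
    | zero => simp [I.zero_mem]
    | add a b ha hb =>
      rw [map_add, LinearMap.baseChange_add]
      exact I.add_mem ha hb
    | tmul a b =>
      have : (AlgHom.mulLeftRight k D (a ⊗ₜ b)).baseChange B x =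
          (1 ⊗ₜ a) * x * (1 ⊗ₜ b.unop) := by
        have h : (AlgHom.mulLeftRight k D (a ⊗ₜ b)).baseChange B =
            LinearMap.mulRight B (1 ⊗ₜ[k] b.unop : B ⊗[k] D) ∘ₗ
              LinearMap.mulLeft B (1 ⊗ₜ[k] a : B ⊗[k] D) := by
          ext
          simp
        rw [h]
        rfl
      rw [this]
      exact I.mul_mem_right _ _ (I.mul_mem_left _ _ hx)
  let b := Module.finBasis k D
  let bB := b.baseChange B
  obtain ⟨i, hi⟩ : ∃ i, bB.repr x i ≠ 0 := by
    by_contra! h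
    exact hx0 (bB.repr.map_eq_zero_iff.1 (Finsupp.ext h))
  let φ : Module.End k D := LinearMap.smulRight (b.coord i) 1
  have hφ : φ.baseChange B x = (bB.repr x i) ⊗ₜ 1 := by
    clear hx hx0 key hi
    induction x with
    | zero => simp
    | add y z hy hz => simp [hy, hz, TensorProduct.add_tmul]
    | tmul y z => simp [φ, bB, TensorProduct.smul_tmul', TensorProduct.tmul_smul]
  have h1 := key φ
  rw [hφ] at h1
  have h2 := I.mul_mem_left ((bB.repr x i)⁻¹ ⊗ₜ 1) _ h1
  rw [Algebra.TensorProduct.tmul_mul_tmul, inv_mul_cancel₀ hi, one_mul,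
    ← Algebra.TensorProduct.one_def] at h2
  exact I.one_mem_iff.1 h2

end Density

section MaximalSubfields

variable {K S : Type*} [Field K] [DivisionRing S] [Algebra K S]

/-- The coefficients of a two-sided multiplication operator are unique. -/
theorem bijective_sum_mul_basis [FiniteDimensional K S] (hS : Subalgebra.center K S = ⊥)
    {ι : Type*} [Fintype ι] (e : Module.Basis ι K S) :
    Function.Bijective (fun (a : ι → S) =>
      (∑ i, LinearMap.mulLeft K (a i) ∘ₗ LinearMap.mulRight K (e i) : Module.End K S)) := by
  let F : (ι → S) →ₗ[K] Module.End K S :=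
    { toFun := fun a => ∑ i, LinearMap.mulLeft K (a i) ∘ₗ LinearMap.mulRight K (e i)
      map_add' := fun a b => by
        ext v
        simp [add_mul, Finset.sum_add_distrib]
      map_smul' := fun c a => by
        ext v
        simp [Finset.smul_sum] }
  have hsurj : Function.Surjective F := by
    intro φ
    obtain ⟨t, rfl⟩ := mulLeftRight_surjective_of_center_eq_bot hS φ
    induction t with
    | zero => exact ⟨0, by simp⟩
    | add x y hx hy =>
      obtain ⟨a, ha⟩ := hx
      obtain ⟨b, hb⟩ := hy
      exact ⟨a + b, by rw [map_add, ha, hb, map_add]⟩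
    | tmul x y =>
      refine ⟨fun i => e.repr y.unop i • x, ?_⟩
      ext v
      conv_rhs => rw [AlgHom.mulLeftRight_apply, ← e.sum_repr y.unop]
      simp [F, Finset.mul_sum, mul_assoc]
  have hinj : Function.Injective F := by
    refine (LinearMap.injective_iff_surjective_of_finrank_eq_finrank ?_).2 hsurj
    rw [Module.finrank_pi_fintype, Module.finrank_linearMap]
    simp [Module.finrank_eq_card_basis e]
  exact ⟨hinj, hsurj⟩

/-- A subfield of a central division algebra of dimension `n ^ 2` which is its own centralizer has
degree `n`. -/
theorem finrank_eq_of_self_centralizing {n : ℕ} (hn : 0 < n) (hS : Subalgebra.center K S = ⊥)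
    (hfin : Module.finrank K S = n ^ 2) {P : Type*} [Field P] [Algebra K P] (f : P →ₐ[K] S)
    (hf : ∀ s : S, (∀ x, f x * s = s * f x) → s ∈ f.range) : Module.finrank K P = n := by
  have : FiniteDimensional K S := Module.finite_of_finrank_pos (by rw [hfin]; positivity)
  have : FiniteDimensional K P := FiniteDimensional.of_injective f.toLinearMap f.injective
  let : Module P S := Module.compHom S f.toRingHom
  have hsm (x : P) (s : S) : x • s = f x * s := rfl
  have : IsScalarTower K P S := ⟨fun c x s => by simp [hsm]⟩
  have : SMulCommClass P K S := ⟨fun x c s => by simp [hsm]⟩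
  let e := Module.finBasis K S
  obtain ⟨hinj, hsurj⟩ := bijective_sum_mul_basis hS e
  have : FiniteDimensional P S := FiniteDimensional.right K P S
  let F : (Fin (Module.finrank K S) → P) →ₗ[K] (S →ₗ[P] S) :=
    { toFun := fun a =>
        { toFun := fun v => ∑ i, f (a i) * (v * e i)
          map_add' := fun v w => by simp [add_mul, mul_add, Finset.sum_add_distrib]
          map_smul' := fun x v => by
            simp only [hsm, Finset.mul_sum, RingHom.id_apply]
            refine Finset.sum_congr rfl fun i _ => ?_
            simp only [← mul_assoc, ← map_mul]
            rw [mul_comm] }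
      map_add' := fun a b => by
        ext v
        simp [add_mul, Finset.sum_add_distrib]
      map_smul' := fun c a => by
        ext v
        simp [Finset.smul_sum] }
  have hF : Function.Bijective F := by
    constructor
    · intro a b hab
      have : (fun i => f (a i)) = fun i => f (b i) := by
        apply hinj
        ext v
        have := LinearMap.congr_fun hab v
        simpa [F] using this
      exact funext fun i => f.injective (congrFun this i)
    · intro φ
      obtain ⟨a, ha⟩ := hsurj (φ.restrictScalars K)
      have ha' (v : S) : φ v = ∑ i, a i * (v * e i) := by
        have := LinearMap.congr_fun ha v
        simpa using this.symm
      have hc (i) : a i ∈ f.range := by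
        refine hf _ fun x => ?_
        have : (fun i => f x * a i) = fun i => a i * f x := by
          apply hinj
          ext v
          have h1 := φ.map_smul x v
          rw [hsm, hsm, ha', ha'] at h1
          simpa [Finset.mul_sum, mul_assoc] using h1.symm
        exact congrFun this i
      choose b hb using hc
      refine ⟨b, ?_⟩
      ext v
      rw [ha']
      simp only [F, LinearMap.coe_mk, AddHom.coe_mk]
      exact Finset.sum_congr rfl fun i _ => by rw [← hb i]; rfl
  have h1 := (LinearEquiv.ofBijective F hF).finrank_eq
  rw [Module.finrank_pi_fintype] at h1
  have h2 := Module.finrank_mul_finrank K P (S →ₗ[P] S)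
  rw [Module.finrank_linearMap] at h2
  have h3 := Module.finrank_mul_finrank K P S
  have hd : 0 < Module.finrank K P := Module.finrank_pos
  rw [← h2] at h1
  simp only [Finset.sum_const, Finset.card_univ, Fintype.card_fin, smul_eq_mul] at h1
  rw [hfin] at h1 h3
  generalize Module.finrank K P = d at *
  generalize Module.finrank P S = m at *
  have h4 : n = m := by
    have : n ^ 2 = m ^ 2 := by
      apply Nat.eq_of_mul_eq_mul_left hd
      linarith
    exact Nat.pow_left_injective two_ne_zero this
  subst h4
  apply Nat.eq_of_mul_eq_mul_right hn
  linarith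

/-- Every element of a central division algebra of degree `n` lies in a subfield of degree `n`. -/
theorem exists_subfield_of_degree {K S : Type} [Field K] [DivisionRing S] [Algebra K S]
    {n : ℕ} (hn : 0 < n) (hS : Subalgebra.center K S = ⊥)
    (hfin : Module.finrank K S = n ^ 2) (z : S) :
    ∃ (P : Type) (_ : Field P) (_ : Algebra K P) (f : P →ₐ[K] S) (w : P),
      Module.finrank K P = n ∧ f w = z := by
  have : FiniteDimensional K S := Module.finite_of_finrank_pos (by rw [hfin]; positivity)
  let T : Set (Submodule K S) := {M | ∃ P : Subalgebra K S, z ∈ P ∧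
    (∀ x ∈ P, ∀ y ∈ P, x * y = y * x) ∧ Subalgebra.toSubmodule P = M}
  have hadj (s : Set S) (hs : ∀ x ∈ s, ∀ y ∈ s, x * y = y * x) :
      ∀ x ∈ Algebra.adjoin K s, ∀ y ∈ Algebra.adjoin K s, x * y = y * x := by
    intro x hx y hy
    exact Algebra.commute_of_mem_adjoin_of_forall_mem_commute hy fun b hb =>
      (Algebra.commute_of_mem_adjoin_of_forall_mem_commute hx fun c hc => hs b hb c hc).symm
  have hT : T.Nonempty := ⟨_, Algebra.adjoin K {z}, Algebra.self_mem_adjoin_singleton K z,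
    hadj _ (by simp), rfl⟩
  obtain ⟨_, ⟨P, hz, hcomm, rfl⟩, hmax⟩ :=
    (wellFounded_gt : WellFounded (fun a b : Submodule K S => a > b)).has_min T hT
  have hcen (s : S) (hs : ∀ x ∈ P, x * s = s * x) : s ∈ P := by
    by_contra hsP
    refine hmax _ ⟨Algebra.adjoin K (insert s (P : Set S)),
      Algebra.subset_adjoin (Set.mem_insert_of_mem _ hz), hadj _ ?_, rfl⟩ ?_
    · rintro x (rfl | hx) y (rfl | hy)
      · rfl
      · exact (hs y hy).symm
      · exact hs x hx
      · exact hcomm x hx y hy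
    · refine lt_of_le_of_ne
        (fun x hx => Algebra.subset_adjoin (Set.mem_insert_of_mem _ hx)) fun h => hsP ?_
      have : s ∈ Subalgebra.toSubmodule (Algebra.adjoin K (insert s (P : Set S))) :=
        Algebra.subset_adjoin (Set.mem_insert _ _)
      rw [← h] at this
      exact this
  let : CommRing P := { P.toRing with mul_comm := fun x y => Subtype.ext (hcomm x x.2 y y.2) }
  have hfield : IsField P :=
    { exists_pair_ne := ⟨0, 1, zero_ne_one⟩
      mul_comm := mul_comm
      mul_inv_cancel := fun {a} ha => by
        have ha' : (a : S) ≠ 0 := fun h => ha (Subtype.ext h)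
        refine ⟨⟨(a : S)⁻¹, hcen _ fun x hx => ?_⟩, Subtype.ext (mul_inv_cancel₀ ha')⟩
        exact ((show Commute (a : S) x from hcomm a a.2 x hx).inv_left₀).symm }
  let : Field P := hfield.toField
  refine ⟨P, inferInstance, P.algebra, P.val, ⟨z, hz⟩, ?_, rfl⟩
  refine finrank_eq_of_self_centralizing hn hS hfin P.val fun s hs => ?_
  exact ⟨⟨s, hcen s fun x hx => hs ⟨x, hx⟩⟩, rfl⟩

end MaximalSubfields

section RightNormTrace

/-- The determinant of right multiplication by an element of an algebra. -/
noncomputable def rightNorm (K : Type*) {S : Type*} [CommRing K] [Ring S] [Algebra K S] (z : S) :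
    K := LinearMap.det (LinearMap.mulRight K z)

/-- The trace of right multiplication by an element of an algebra. -/
noncomputable def rightTrace (K : Type*) (S : Type*) [CommRing K] [Ring S] [Algebra K S] :
    S →ₗ[K] K := LinearMap.trace K S ∘ₗ (LinearMap.mul K S).flip

variable {K S S' : Type*} [Field K] [Ring S] [Algebra K S] [Ring S'] [Algebra K S']

theorem rightTrace_apply (z : S) :
    rightTrace K S z = LinearMap.trace K S (LinearMap.mulRight K z) := rfl

theorem rightNorm_mul (z w : S) : rightNorm K (z * w) = rightNorm K z * rightNorm K w := by
  rw [rightNorm, LinearMap.mulRight_mul, LinearMap.det_comp, mul_comm]; rfl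

theorem rightNorm_one : rightNorm K (1 : S) = 1 := by
  simp [rightNorm]

theorem rightNorm_algebraMap (c : K) :
    rightNorm K (algebraMap K S c) = c ^ Module.finrank K S := by
  have : LinearMap.mulRight K (algebraMap K S c) = c • LinearMap.id := by
    ext v
    simp [Algebra.smul_def, Algebra.commutes]
  rw [rightNorm, this, LinearMap.det_smul, LinearMap.det_id, mul_one]

theorem rightTrace_mul_comm (z w : S) : rightTrace K S (z * w) = rightTrace K S (w * z) := by
  rw [rightTrace_apply, rightTrace_apply, LinearMap.mulRight_mul, LinearMap.mulRight_mul]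
  exact LinearMap.trace_mul_comm K _ _

theorem rightTrace_one [FiniteDimensional K S] : rightTrace K S 1 = Module.finrank K S := by
  rw [rightTrace_apply, LinearMap.mulRight_one]
  exact LinearMap.trace_id K S

theorem rightNorm_ne_zero [FiniteDimensional K S] [NoZeroDivisors S] {z : S} (hz : z ≠ 0) :
    rightNorm K z ≠ 0 := by
  intro h
  obtain ⟨v, hv, hv0⟩ := (Submodule.ne_bot_iff _).1 (LinearMap.bot_lt_ker_of_det_eq_zero h).ne'
  exact hv0 ((mul_eq_zero.1 hv).resolve_right hz)

/-- Two algebras of the same dimension over a field containing `P` are isomorphic as right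
`P`-modules. -/
theorem exists_linearEquiv_of_algHom {P : Type*} [Field P] [Algebra K P] [FiniteDimensional K S]
    [FiniteDimensional K S'] (hfin : Module.finrank K S = Module.finrank K S')
    (f : P →ₐ[K] S) (f' : P →ₐ[K] S') :
    ∃ φ : S ≃ₗ[K] S', ∀ v w, φ (v * f w) = φ v * f' w := by
  by_cases hS : Nontrivial S
  swap
  · have h1 : Subsingleton S := not_nontrivial_iff_subsingleton.1 hS
    have h2 : Subsingleton S' := by
      rw [← Module.finrank_zero_iff (R := K), ← hfin, Module.finrank_zero_iff]
      exact h1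
    exact ⟨LinearEquiv.ofSubsingleton S S', fun v w => Subsingleton.elim _ _⟩
  let m : Module P S := Module.compHom S (f.toRingHom.toOpposite fun x y => by
    change f x * f y = f y * f x
    rw [← map_mul, mul_comm, map_mul])
  let m' : Module P S' := Module.compHom S' (f'.toRingHom.toOpposite fun x y => by
    change f' x * f' y = f' y * f' x
    rw [← map_mul, mul_comm, map_mul])
  have hm (x : P) (s : S) : x • s = s * f x := rfl
  have hm' (x : P) (s : S') : x • s = s * f' x := rfl
  have : IsScalarTower K P S := ⟨fun c x s => by simp [hm]⟩
  have : IsScalarTower K P S' := ⟨fun c x s => by simp [hm']⟩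
  have : FiniteDimensional P S := FiniteDimensional.right K P S
  have : FiniteDimensional P S' := FiniteDimensional.right K P S'
  have : FiniteDimensional K P := FiniteDimensional.of_injective f.toLinearMap f.injective
  have h : Module.finrank P S = Module.finrank P S' := by
    apply Nat.eq_of_mul_eq_mul_left (Module.finrank_pos (R := K) (M := P))
    rw [Module.finrank_mul_finrank, Module.finrank_mul_finrank, hfin]
  let e := LinearEquiv.ofFinrankEq S S' h
  exact ⟨e.restrictScalars K, fun v w => e.map_smul w v⟩

theorem rightNorm_eq_of_algHom {P : Type*} [Field P] [Algebra K P] [FiniteDimensional K S]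
    [FiniteDimensional K S'] (hfin : Module.finrank K S = Module.finrank K S')
    (f : P →ₐ[K] S) (f' : P →ₐ[K] S') (w : P) : rightNorm K (f w) = rightNorm K (f' w) := by
  obtain ⟨φ, hφ⟩ := exists_linearEquiv_of_algHom hfin f f'
  rw [rightNorm, rightNorm, ← LinearMap.det_conj _ φ]
  congr 1
  ext v
  simp [hφ]

end RightNormTrace

section Lattices

variable {O K V : Type*} [CommRing O] [IsDomain O] [IsPrincipalIdealRing O] [Field K] [Algebra O K]
  [IsFractionRing O K] [AddCommGroup V] [Module K V] [Module O V] [IsScalarTower O K V]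

/-- A full lattice over a principal ideal domain has a basis which is a basis of the ambient
space. -/
theorem exists_basis_of_lattice {N : Submodule O V} (hN : N.FG)
    (hspan : Submodule.span K (N : Set V) = ⊤) :
    ∃ (m : ℕ) (b : Module.Basis (Fin m) O N) (c : Module.Basis (Fin m) K V),
      ∀ i, c i = b i := by
  have : Module.Finite O N := Module.Finite.iff_fg.2 hN
  have : Module.IsTorsionFree O V := Module.IsTorsionFree.trans_faithfulSMul O K V
  let b := Module.finBasis O N
  have hli : LinearIndependent K fun i => (b i : V) := by
    rw [← LinearIndependent.iff_fractionRing (R := O)]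
    exact b.linearIndependent.map' N.subtype (Submodule.ker_subtype N)
  have hsp : ⊤ ≤ Submodule.span K (Set.range fun i => (b i : V)) := by
    rw [← hspan, Submodule.span_le]
    intro v hv
    have := b.sum_repr ⟨v, hv⟩
    have h2 := congrArg N.subtype this
    simp only [map_sum, map_smul, Submodule.subtype_apply] at h2
    rw [← h2]
    refine Submodule.sum_mem _ fun i _ => ?_
    rw [← algebraMap_smul K]
    exact Submodule.smul_mem _ _ (Submodule.subset_span ⟨i, rfl⟩)
  exact ⟨_, b, Module.Basis.mk hli hsp, fun i => by simp⟩

theorem toMatrix_eq_of_lattice {N : Submodule O V} {ι : Type*} [Fintype ι] [DecidableEq ι]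
    (b : Module.Basis ι O N) (c : Module.Basis ι K V) (hbc : ∀ i, c i = b i)
    (f : Module.End K V) (g : Module.End O N) (hfg : ∀ v : N, f v = g v) :
    LinearMap.toMatrix c c f = (LinearMap.toMatrix b b g).map (algebraMap O K) := by
  ext i j
  rw [Matrix.map_apply, LinearMap.toMatrix_apply, LinearMap.toMatrix_apply, hbc, hfg]
  have h2 := congrArg N.subtype (b.sum_repr (g (b j)))
  simp only [map_sum, map_smul, Submodule.subtype_apply] at h2
  rw [← h2]
  have h3 (r : O) (l : ι) : c.repr (r • c l) i = if l = i then algebraMap O K r else 0 := by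
    rw [← algebraMap_smul K r (c l), map_smul, Module.Basis.repr_self]
    simp [Finsupp.single_apply, Algebra.smul_def]
  simp only [← hbc]
  rw [map_sum, Finsupp.finsetSum_apply]
  simp [h3]

theorem det_eq_of_lattice {N : Submodule O V} (hN : N.FG)
    (hspan : Submodule.span K (N : Set V) = ⊤) (f : Module.End K V) (g : Module.End O N)
    (hfg : ∀ v : N, f v = g v) : LinearMap.det f = algebraMap O K (LinearMap.det g) := by
  obtain ⟨m, b, c, hbc⟩ := exists_basis_of_lattice (K := K) hN hspan
  rw [← LinearMap.det_toMatrix c, ← LinearMap.det_toMatrix b,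
    toMatrix_eq_of_lattice b c hbc f g hfg, RingHom.map_det]
  rfl

theorem trace_eq_of_lattice {N : Submodule O V} (hN : N.FG)
    (hspan : Submodule.span K (N : Set V) = ⊤) (f : Module.End K V) (g : Module.End O N)
    (hfg : ∀ v : N, f v = g v) :
    LinearMap.trace K V f = algebraMap O K (LinearMap.trace O N g) := by
  obtain ⟨m, b, c, hbc⟩ := exists_basis_of_lattice (K := K) hN hspan
  rw [LinearMap.trace_eq_matrix_trace K c, LinearMap.trace_eq_matrix_trace O b,
    toMatrix_eq_of_lattice b c hbc f g hfg]
  simp [Matrix.trace]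

end Lattices

section DetDvd

/-- If the reduction modulo `p` of an endomorphism of a free module of finite rank has a kernel of
dimension at least `c`, its determinant is divisible by `p ^ c`. -/
theorem pow_dvd_det_of_le_finrank_ker {O : Type*} [CommRing O] [IsLocalRing O] {p : O}
    (hp : IsLocalRing.maximalIdeal O = Ideal.span {p}) {ι : Type*} [Fintype ι] [DecidableEq ι]
    (A : Matrix ι ι O) {c : ℕ}
    (hc : c ≤ Module.finrank (IsLocalRing.ResidueField O)
      (LinearMap.ker (A.map (IsLocalRing.residue O)).mulVecLin)) : p ^ c ∣ A.det := by
  let κ := IsLocalRing.ResidueField O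
  let A' := A.map (IsLocalRing.residue O)
  let k := LinearMap.ker A'.mulVecLin
  obtain ⟨q, hq⟩ := k.exists_isCompl
  let bk := Module.finBasis κ k
  let bq := Module.finBasis κ q
  let b : Module.Basis (Fin (Module.finrank κ k) ⊕ Fin (Module.finrank κ q)) κ (ι → κ) :=
    (bk.prod bq).map (Submodule.prodEquivOfIsCompl k q hq)
  let e : Fin (Module.finrank κ k) ⊕ Fin (Module.finrank κ q) ≃ ι :=
    b.indexEquiv (Pi.basisFun κ ι)
  let b' := b.reindex e
  let Q' : Matrix ι ι κ := Matrix.of fun i j => b' j i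
  have hQ' : IsUnit Q'.det := by
    have : Q' = (Pi.basisFun κ ι).toMatrix b' := by
      ext i j
      simp [Q', Module.Basis.toMatrix_apply]
    rw [this]
    have := (Pi.basisFun κ ι).invertibleToMatrix b'
    exact Matrix.isUnit_det_of_invertible _
  choose Q hQ using fun i j => IsLocalRing.residue_surjective (R := O) (Q' i j)
  have hQQ : (Matrix.of Q).map (IsLocalRing.residue O) = Q' := by
    ext i j
    simp [hQ]
  have hQu : IsUnit (Matrix.of Q).det := by
    have : IsUnit (IsLocalRing.residue O (Matrix.of Q).det) := by
      rw [RingHom.map_det]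
      change IsUnit ((Matrix.of Q).map (IsLocalRing.residue O)).det
      rwa [hQQ]
    exact isUnit_of_map_unit (IsLocalRing.residue O) _ this
  let w : ι → O := fun j => if (e.symm j).isLeft then p else 1
  have hcol : ∀ i j, ∃ x, (A * Matrix.of Q) i j = w j * x := by
    intro i j
    rcases hj : e.symm j with j0 | j0
    · have h1 : IsLocalRing.residue O ((A * Matrix.of Q) i j) = 0 := by
        have h2 : (A * Matrix.of Q).map (IsLocalRing.residue O) = A' * Q' := by
          rw [Matrix.map_mul, hQQ]
        have h3 := congrFun (congrFun h2 i) j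
        rw [Matrix.map_apply] at h3
        rw [h3]
        have h4 : b' j = bk j0 := by
          simp [b', b, hj]
        have h5 : A'.mulVec (b' j) = 0 := by
          rw [h4]
          exact (bk j0).2
        exact congrFun h5 i
      rw [IsLocalRing.residue_eq_zero_iff, hp, Ideal.mem_span_singleton] at h1
      obtain ⟨x, hx⟩ := h1
      exact ⟨x, by simp [w, hj, hx]⟩
    · exact ⟨_, by simp [w, hj]; rfl⟩
  choose X hX using hcol
  have hdet : A.det * (Matrix.of Q).det = (∏ j, w j) * (Matrix.of X).det := by
    rw [← Matrix.det_mul, ← Matrix.det_mul_row]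
    congr 1
    ext i j
    simp [hX]
  have hw : ∏ j, w j = p ^ Module.finrank κ k := by
    rw [← Equiv.prod_comp e, Fintype.prod_sum_type]
    simp [w]
  rw [hw] at hdet
  have : p ^ c ∣ A.det * (Matrix.of Q).det := by
    rw [hdet]
    exact Dvd.dvd.mul_right (pow_dvd_pow p hc) _
  exact (hQu.dvd_mul_right).1 this

end DetDvd

section PrimeArtinian

/-- A prime left artinian ring is simple. -/
theorem isSimpleRing_of_isArtinianRing {S : Type*} [Ring S] [Nontrivial S] [IsArtinianRing S]
    (hS : ∀ I J : Ideal S, I.IsTwoSided → J.IsTwoSided → I * J = ⊥ → I = ⊥ ∨ J = ⊥) :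
    IsSimpleRing S := by
  have hnil : ∀ (m : ℕ) (I : Ideal S), I.IsTwoSided → I ^ m = ⊥ → I = ⊥ := by
    intro m
    induction m with
    | zero =>
      intro I hI h
      rw [Submodule.pow_zero, Ideal.one_eq_top] at h
      exact absurd h top_ne_bot
    | succ m ih =>
      intro I hI h
      rw [Submodule.pow_succ] at h
      rcases hS _ _ inferInstance inferInstance h with h | h
      · exact ih I hI h
      · exact h
  have hJ : Ring.jacobson S = ⊥ := by
    obtain ⟨m, hm⟩ := IsSemiprimaryRing.isNilpotent (R := S)
    exact hnil m _ inferInstance hm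
  have hss : IsSemisimpleRing S := IsArtinianRing.isSemisimpleRing_iff_jacobson.2 hJ
  refine ⟨⟨fun T => ?_⟩⟩
  by_cases hT : T = ⊥
  · exact Or.inl hT
  right
  let Y : Ideal S := T.asIdeal
  have hY : Y.IsTwoSided := inferInstance
  have hY0 : Y ≠ ⊥ := by
    intro h
    apply hT
    refine le_bot_iff.1 fun x hx => ?_
    have : x ∈ Y := TwoSidedIdeal.mem_asIdeal.2 hx
    rw [h] at this
    exact (TwoSidedIdeal.mem_bot _).2 this
  obtain ⟨C, hC⟩ := exists_isCompl Y
  let Z : Ideal S :=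
    { carrier := {z | ∀ y ∈ Y, y * z = 0}
      add_mem' := fun {a b} ha hb y hy => by rw [mul_add, ha y hy, hb y hy, add_zero]
      zero_mem' := fun y _ => mul_zero y
      smul_mem' := fun c z hz y hy => by
        rw [smul_eq_mul, ← mul_assoc]
        exact hz _ (hY.mul_mem_of_left c hy) }
  have hZ : Z.IsTwoSided := ⟨fun b hz y hy => by rw [← mul_assoc, hz y hy, zero_mul]⟩
  have hCZ : C ≤ Z := fun c hc y hy => by
    have h1 : y * c ∈ Y ⊓ C := ⟨hY.mul_mem_of_left c hy, C.mul_mem_left y hc⟩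
    rwa [hC.inf_eq_bot] at h1
  have hYZ : Y * Z = ⊥ := by
    rw [← le_bot_iff, Ideal.mul_le]
    intro y hy z hz
    exact hz y hy
  rcases hS Y Z hY hZ hYZ with h | h
  · exact absurd h hY0
  · rw [h, le_bot_iff] at hCZ
    have h1 := hC.sup_eq_top
    rw [hCZ, sup_bot_eq] at h1
    refine T.one_mem_iff.1 (TwoSidedIdeal.mem_asIdeal.1 ?_)
    change (1 : S) ∈ Y
    rw [h1]
    trivial

end PrimeArtinian

section InvertiblePrime

variable {Λ : Type*} [Ring Λ]

/-- The ideal `{w | p * w ∈ X}` for a central element `p`. -/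
def divCentral {p : Λ} (hpc : ∀ x, p * x = x * p) (X : Ideal Λ) : Ideal Λ where
  carrier := {w | p * w ∈ X}
  add_mem' := fun {a b} ha hb => by
    change p * (a + b) ∈ X
    rw [mul_add]
    exact X.add_mem ha hb
  zero_mem' := by
    change p * 0 ∈ X
    rw [mul_zero]
    exact X.zero_mem
  smul_mem' := fun c w hw => by
    change p * (c * w) ∈ X
    rw [← mul_assoc, hpc, mul_assoc]
    exact X.mul_mem_left c hw

theorem divCentral_isTwoSided {p : Λ} (hpc : ∀ x, p * x = x * p) (X : Ideal Λ)
    (hX : X.IsTwoSided) : (divCentral hpc X).IsTwoSided :=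
  ⟨fun {a} b ha => by
    change p * (a * b) ∈ X
    rw [← mul_assoc]
    exact hX.mul_mem_of_left b ha⟩

theorem mem_divCentral {p : Λ} (hpc : ∀ x, p * x = x * p) (X : Ideal Λ) (w : Λ) :
    w ∈ divCentral hpc X ↔ p * w ∈ X := Iff.rfl

/-- An order in which the one-sided multiplier orders of the two-sided ideals containing the
central element `p` are trivial has an invertible maximal two-sided ideal over `p`. -/
theorem exists_invertible_ideal [IsNoetherianRing Λ] {p : Λ} (hpc : ∀ x, p * x = x * p)
    (hpu : ¬ IsUnit p)
    (hart : IsArtinian Λ (Λ ⧸ Ideal.span {p}))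
    (Hr : ∀ X : Ideal Λ, X.IsTwoSided → p ∈ X → ∀ z,
      (∀ x ∈ X, ∃ x' ∈ X, x * z = p * x') → ∃ w, z = p * w)
    (Hl : ∀ X : Ideal Λ, X.IsTwoSided → p ∈ X → ∀ z,
      (∀ x ∈ X, ∃ x' ∈ X, z * x = p * x') → ∃ w, z = p * w) :
    ∃ (M M' : Ideal Λ) (_ : M.IsTwoSided) (_ : M'.IsTwoSided), p ∈ M ∧ M ≠ ⊤ ∧
      M * M' = Ideal.span {p} ∧ M' * M = Ideal.span {p} ∧ IsSimpleRing (Λ ⧸ M) := by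
  let 𝒳 : Set (Ideal Λ) := {X | X.IsTwoSided ∧ p ∈ X ∧
    ∃ z, (∀ x ∈ X, ∃ w, x * z = p * w) ∧ ¬ ∃ w, z = p * w}
  have hspan (x : Λ) : x ∈ Ideal.span {p} ↔ ∃ w, x = p * w := by
    rw [Ideal.mem_span_singleton']
    exact ⟨fun ⟨a, ha⟩ => ⟨a, by rw [← ha, hpc]⟩, fun ⟨a, ha⟩ => ⟨a, by rw [ha, hpc]⟩⟩
  have h𝒳 : 𝒳.Nonempty := by
    refine ⟨Ideal.span {p}, ⟨fun {a} b ha => ?_⟩, Ideal.mem_span_singleton_self p, 1, ?_, ?_⟩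
    · obtain ⟨w, rfl⟩ := (hspan a).1 ha
      exact (hspan _).2 ⟨w * b, by rw [mul_assoc]⟩
    · intro x hx
      rw [mul_one]
      exact (hspan x).1 hx
    · rintro ⟨w, hw⟩
      exact hpu ⟨⟨p, w, hw.symm, by rw [← hpc, ← hw]⟩, rfl⟩
  obtain ⟨M, ⟨hM, hpM, z₀, hz₀, hz₀'⟩, hmax⟩ :=
    (wellFounded_gt : WellFounded (fun a b : Ideal Λ => a > b)).has_min 𝒳 h𝒳
  have hmax' (Y : Ideal Λ) (hY : Y.IsTwoSided) (hMY : M < Y) (z : Λ)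
      (hz : ∀ x ∈ Y, ∃ w, x * z = p * w) : ∃ w, z = p * w := by
    by_contra hc
    exact hmax Y ⟨hY, hMY.le hpM, z, hz, hc⟩ hMY
  have hMtop : M ≠ ⊤ := by
    intro h
    obtain ⟨w, hw⟩ := hz₀ 1 (by rw [h]; trivial)
    exact hz₀' ⟨w, by rw [← hw, one_mul]⟩
  have hnt : Nontrivial (Λ ⧸ M) := Submodule.Quotient.nontrivial_iff.2 hMtop
  have hart' : IsArtinianRing (Λ ⧸ M) := by
    have h1 : Ideal.span {p} ≤ M := (Ideal.span_singleton_le_iff_mem _).2 hpM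
    have h2 : IsArtinian Λ (Λ ⧸ M) :=
      isArtinian_of_surjective _ (Submodule.factor h1) (Submodule.factor_surjective h1)
    exact isArtinian_of_tower Λ h2
  have hprime (A B : Ideal Λ) (hA : A.IsTwoSided) (hB : B.IsTwoSided) (hMA : M < A)
      (hMB : M < B) : ¬ A * B ≤ M := by
    intro hAB
    refine hz₀' (hmax' B hB hMB z₀ fun b hb => hmax' A hA hMA _ fun a ha => ?_)
    rw [← mul_assoc]
    exact hz₀ _ (hAB (Ideal.mul_mem_mul ha hb))
  have hsimple : IsSimpleRing (Λ ⧸ M) := by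
    refine isSimpleRing_of_isArtinianRing fun I J hI hJ hIJ => ?_
    by_contra! hc
    have key (I : Ideal (Λ ⧸ M)) (hI0 : I ≠ ⊥) : M < I.comap (Ideal.Quotient.mk M) := by
      refine lt_of_le_of_ne (fun x hx => ?_) fun h => hI0 (le_bot_iff.1 fun x hx => ?_)
      · rw [Ideal.mem_comap, Ideal.Quotient.eq_zero_iff_mem.2 hx]
        exact I.zero_mem
      · obtain ⟨y, rfl⟩ := Ideal.Quotient.mk_surjective x
        have : y ∈ M := by
          rw [h]
          exact hx
        exact Ideal.Quotient.eq_zero_iff_mem.2 this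
    refine hprime _ _ ⟨fun {a} b ha => ?_⟩ ⟨fun {a} b ha => ?_⟩ (key I hc.1) (key J hc.2) ?_
    · rw [Ideal.mem_comap, map_mul]
      exact hI.mul_mem_of_left _ ha
    · rw [Ideal.mem_comap, map_mul]
      exact hJ.mul_mem_of_left _ ha
    · rw [Ideal.mul_le]
      intro a ha b hb
      have : Ideal.Quotient.mk M a * Ideal.Quotient.mk M b ∈ I * J := Ideal.mul_mem_mul ha hb
      rw [hIJ, ← map_mul] at this
      exact Ideal.Quotient.eq_zero_iff_mem.1 this
  have hmaxid (Y : Ideal Λ) (hY : Y.IsTwoSided) (hMY : M ≤ Y) : Y = M ∨ Y = ⊤ := by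
    let q := Ideal.Quotient.mk M
    let T' : Ideal (Λ ⧸ M) := Y.map q
    have hT' : T'.IsTwoSided := by
      refine ⟨fun {a} b ha => ?_⟩
      obtain ⟨y, hy, rfl⟩ := (Ideal.mem_map_iff_of_surjective q
        Ideal.Quotient.mk_surjective).1 ha
      obtain ⟨c, rfl⟩ := Ideal.Quotient.mk_surjective b
      rw [← map_mul]
      exact Ideal.mem_map_of_mem q (hY.mul_mem_of_left c hy)
    rcases hsimple.simple.eq_bot_or_eq_top T'.toTwoSided with h | h
    · left
      refine le_antisymm (fun y hy => ?_) hMY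
      have h1 : q y ∈ T'.toTwoSided := by
        rw [Ideal.mem_toTwoSided]
        exact Ideal.mem_map_of_mem q hy
      rw [h, TwoSidedIdeal.mem_bot] at h1
      exact Ideal.Quotient.eq_zero_iff_mem.1 h1
    · right
      have h1 : q 1 ∈ T'.toTwoSided := by rw [h]; trivial
      rw [Ideal.mem_toTwoSided] at h1
      obtain ⟨y, hy, hy1⟩ := (Ideal.mem_map_iff_of_surjective q
        Ideal.Quotient.mk_surjective).1 h1
      rw [Ideal.eq_top_iff_one]
      have h2 : y - 1 ∈ M := (Ideal.Quotient.eq (I := M)).1 hy1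
      have h3 := Y.sub_mem hy (hMY h2)
      rwa [sub_sub_cancel] at h3
  let M' : Ideal Λ :=
    { carrier := {z | ∀ x ∈ M, ∃ w, x * z = p * w}
      add_mem' := fun {a b} ha hb x hx => by
        obtain ⟨u, hu⟩ := ha x hx
        obtain ⟨v, hv⟩ := hb x hx
        exact ⟨u + v, by rw [mul_add, mul_add, hu, hv]⟩
      zero_mem' := fun x _ => ⟨0, by simp⟩
      smul_mem' := fun c z hz x hx => by
        obtain ⟨u, hu⟩ := hz (x * c) (hM.mul_mem_of_left c hx)
        exact ⟨u, by rw [smul_eq_mul, ← mul_assoc, hu]⟩ }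
  have hM' : M'.IsTwoSided := ⟨fun {z} b hz x hx => by
    obtain ⟨u, hu⟩ := hz x hx
    exact ⟨u * b, by rw [← mul_assoc, hu, mul_assoc]⟩⟩
  have hz₀M : z₀ ∈ M' := hz₀
  have hpM' : p ∈ M' := fun x _ => ⟨x, (hpc x).symm⟩
  have h1 : M * M' = Ideal.span {p} := by
    apply le_antisymm
    · rw [Ideal.mul_le]
      intro x hx z hz
      exact (hspan _).2 (hz x hx)
    · rw [Ideal.span_singleton_le_iff_mem]
      rcases hmaxid (divCentral hpc (M * M')) (divCentral_isTwoSided hpc _ inferInstance)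
        (fun m hm => by
          rw [mem_divCentral, hpc]
          exact Ideal.mul_mem_mul hm hpM') with h | h
      · exfalso
        refine hz₀' (Hr M hM hpM z₀ fun x hx => ?_)
        obtain ⟨w, hw⟩ := hz₀ x hx
        refine ⟨w, ?_, hw⟩
        rw [← h, mem_divCentral, ← hw]
        exact Ideal.mul_mem_mul hx hz₀M
      · have : (1 : Λ) ∈ divCentral hpc (M * M') := by rw [h]; trivial
        rwa [mem_divCentral, mul_one] at this
  have h2 : M' * M = Ideal.span {p} := by
    apply le_antisymm
    · rw [Ideal.mul_le]
      intro z hz m hm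
      refine (hspan _).2 (Hr M hM hpM _ fun x hx => ?_)
      obtain ⟨w, hw⟩ := hz x hx
      exact ⟨w * m, M.mul_mem_left w hm, by rw [← mul_assoc, hw, mul_assoc]⟩
    · rw [Ideal.span_singleton_le_iff_mem]
      rcases hmaxid (divCentral hpc (M' * M)) (divCentral_isTwoSided hpc _ inferInstance)
        (fun m hm => by
          rw [mem_divCentral]
          exact Ideal.mul_mem_mul hpM' hm) with h | h
      · exfalso
        refine hz₀' (Hl M hM hpM z₀ fun x hx => ?_)
        have h3 : z₀ * x ∈ Ideal.span {p} := (hspan _).2 <| Hr M hM hpM _ fun y hy => by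
          obtain ⟨w, hw⟩ := hz₀ y hy
          exact ⟨w * x, M.mul_mem_left w hx, by rw [← mul_assoc, hw, mul_assoc]⟩
        obtain ⟨w, hw⟩ := (hspan _).1 h3
        refine ⟨w, ?_, hw⟩
        rw [← h, mem_divCentral, ← hw]
        exact Ideal.mul_mem_mul hz₀M hx
      · have : (1 : Λ) ∈ divCentral hpc (M' * M) := by rw [h]; trivial
        rwa [mem_divCentral, mul_one] at this
  exact ⟨M, M', hM, hM', hpM, hMtop, h1, h2, hsimple⟩

end InvertiblePrime

section SimpleArtinian

/-- Finitely generated modules over a simple artinian ring are powers of any given simple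
module. -/
theorem exists_linearEquiv_fun_of_isSimpleRing {A : Type*} [Ring A] [IsSimpleRing A]
    [IsArtinianRing A] (S : Type*) [AddCommGroup S] [Module A S] [IsSimpleModule A S]
    (X : Type*) [AddCommGroup X] [Module A X] [Module.Finite A X] :
    ∃ a : ℕ, Nonempty (X ≃ₗ[A] (Fin a → S)) := by
  have h : IsIsotypicOfType A X S := fun m _ => by
    obtain ⟨I, ⟨e⟩⟩ := IsSemisimpleRing.exists_linearEquiv_ideal_of_isSimpleModule A m
    obtain ⟨J, ⟨f⟩⟩ := IsSemisimpleRing.exists_linearEquiv_ideal_of_isSimpleModule A S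
    have := IsSimpleModule.congr e.symm
    have := IsSimpleModule.congr f.symm
    exact ⟨e.trans ((IsSimpleRing.isIsotypic A A J I).some.trans f.symm)⟩
  exact h.linearEquiv_fun

variable {Λ : Type*} [Ring Λ] (M : Ideal Λ) [M.IsTwoSided] [IsSimpleRing (Λ ⧸ M)]
  [IsArtinianRing (Λ ⧸ M)]

theorem exists_linearEquiv_fun_of_isTorsionBySet {S : Type*} [AddCommGroup S] [Module Λ S]
    [IsSimpleModule Λ S] (hS : Module.IsTorsionBySet Λ S M) {X : Type*} [AddCommGroup X]
    [Module Λ X] [Module.Finite Λ X] (hX : Module.IsTorsionBySet Λ X M) :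
    ∃ a : ℕ, Nonempty (X ≃ₗ[Λ] (Fin a → S)) := by
  let := hS.module
  let := hX.module
  have : IsSimpleModule (Λ ⧸ M) S :=
    (hS.semilinearMap.isSimpleModule_iff_of_bijective Function.bijective_id).1 inferInstance
  have : Module.Finite (Λ ⧸ M) X :=
    Module.Finite.of_surjective hX.semilinearMap Function.surjective_id
  obtain ⟨a, ⟨e⟩⟩ := exists_linearEquiv_fun_of_isSimpleRing (A := Λ ⧸ M) S X
  exact ⟨a, ⟨{ e with map_smul' := fun r x => e.map_smul (Ideal.Quotient.mk M r) x }⟩⟩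

theorem isTorsionBySet_quotient_of_isTwoSided :
    Module.IsTorsionBySet Λ (Λ ⧸ M) M :=
  (Module.isTorsionBySet_quotient_iff _ _).2 fun x _ hr => Ideal.IsTwoSided.mul_mem_of_left x hr

theorem exists_span_singleton_eq_top_of_length_le [IsNoetherianRing Λ] {X : Type*} [AddCommGroup X]
    [Module Λ X] [Module.Finite Λ X] (hX : Module.IsTorsionBySet Λ X M)
    (hlen : Module.length Λ X ≤ Module.length Λ (Λ ⧸ M)) :
    ∃ x : X, Submodule.span Λ {x} = ⊤ := by
  have hM : M ≠ ⊤ := by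
    rintro rfl
    exact not_subsingleton (Λ ⧸ (⊤ : Ideal Λ)) inferInstance
  obtain ⟨I, hI, hMI⟩ := Ideal.exists_le_maximal M hM
  have : IsSimpleModule Λ (Λ ⧸ I) := isSimpleModule_iff_isCoatom.2 hI.out
  have hS : Module.IsTorsionBySet Λ (Λ ⧸ I) M :=
    (Module.isTorsionBySet_quotient_iff _ _).2 fun x r hr =>
      hMI (Ideal.IsTwoSided.mul_mem_of_left x hr)
  obtain ⟨a, ⟨e⟩⟩ := exists_linearEquiv_fun_of_isTorsionBySet M hS hX
  obtain ⟨b, ⟨f⟩⟩ := exists_linearEquiv_fun_of_isTorsionBySet M hS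
    (isTorsionBySet_quotient_of_isTwoSided M)
  have hab : a ≤ b := by
    rw [e.length_eq, f.length_eq, Module.length_pi, Module.length_pi, Module.length_eq_one] at hlen
    simpa using hlen
  let g : (Λ ⧸ M) →ₗ[Λ] X := e.symm.toLinearMap ∘ₗ
    LinearMap.funLeft Λ (Λ ⧸ I) (Fin.castLE hab) ∘ₗ f.toLinearMap
  have hg : Function.Surjective g := e.symm.surjective.comp
    ((LinearMap.funLeft_surjective_of_injective Λ (Λ ⧸ I) _ (Fin.castLE_injective hab)).comp
      f.surjective)
  refine ⟨g (Ideal.Quotient.mk M 1), eq_top_iff.2 fun x _ => ?_⟩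
  obtain ⟨y, rfl⟩ := hg x
  obtain ⟨r, rfl⟩ := Ideal.Quotient.mk_surjective y
  rw [Submodule.mem_span_singleton]
  refine ⟨r, ?_⟩
  rw [← map_smul]
  congr 1
  change Ideal.Quotient.mk M (r * 1) = _
  rw [mul_one]

end SimpleArtinian

section InvertibleIdeal

variable {Λ : Type*} [Ring Λ] {p : Λ} {M M' : Ideal Λ}

/-- An invertible ideal over `p` is nilpotent modulo `p`, as soon as the two-sided ideals not
contained in `p` contain a fixed power of `p`. -/
theorem exists_pow_le_span_singleton [M.IsTwoSided] (hpc : ∀ x, p * x = x * p)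
    (hp0 : ∀ x, p * x = 0 → x = 0) (hM : M ≠ ⊤) (hMM' : M * M' = Ideal.span {p}) {N : ℕ}
    (hart : IsArtinian Λ (Λ ⧸ Ideal.span {p ^ N}))
    (hU : ∀ X : Ideal Λ, X.IsTwoSided → X ≤ Ideal.span {p} ∨ p ^ N ∈ X) :
    ∃ e, M ^ e ≤ Ideal.span {p} := by
  by_contra! hc
  have h1 (k : ℕ) : p ^ N ∈ M ^ k := (hU (M ^ k) inferInstance).resolve_left (hc k)
  have h2 (k : ℕ) : ¬ M ^ k ≤ M ^ k * M := by
    induction k with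
    | zero =>
      intro h
      rw [Submodule.pow_zero, Ideal.one_eq_top] at h
      exact hM (top_le_iff.1 (h.trans (Ideal.mul_le.2 fun r _ s hs => M.mul_mem_left r hs)))
    | succ k ih =>
      intro h
      apply ih
      rw [Submodule.pow_succ] at h
      have h3 := Ideal.mul_mono_left (K := M') h
      rw [Ideal.mul_assoc, Ideal.mul_assoc, Ideal.mul_assoc, hMM', ← Ideal.mul_assoc] at h3
      intro x hx
      have h4 := h3 (Ideal.mul_mem_mul hx (Ideal.mem_span_singleton_self p))
      rw [Ideal.mem_mul_span_singleton] at h4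
      obtain ⟨y, hy, hyx⟩ := h4
      have h5 : y - x = 0 := hp0 _ (by rw [hpc, sub_mul, hyx, sub_self])
      rwa [← sub_eq_zero.1 h5]
  let q := (Ideal.span {p ^ N} : Ideal Λ).mkQ
  let f : ℕ →o (Submodule Λ (Λ ⧸ Ideal.span {p ^ N}))ᵒᵈ :=
    ⟨fun k => OrderDual.toDual (Submodule.map q (M ^ k)), fun i j hij => by
      obtain ⟨l, rfl⟩ := Nat.exists_eq_add_of_le hij
      change Submodule.map q (M ^ (i + l)) ≤ Submodule.map q (M ^ i)
      rw [Ideal.IsTwoSided.pow_add]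
      exact Submodule.map_mono Ideal.mul_le_left⟩
  obtain ⟨k, hk⟩ := IsArtinian.monotone_stabilizes f
  have h3 : Submodule.map q (M ^ k) = Submodule.map q (M ^ (k + 1)) := hk (k + 1) (Nat.le_succ k)
  have h4 (j : ℕ) : Submodule.comap q (Submodule.map q (M ^ j)) = M ^ j := by
    rw [Submodule.comap_map_mkQ, sup_eq_right, Ideal.span_singleton_le_iff_mem]
    exact h1 j
  refine h2 k ?_
  rw [← Submodule.pow_succ, ← h4 k, h3, h4]

/-- Multiplication by a central element. -/
def mulCentral (hpc : ∀ x, p * x = x * p) : Λ →ₗ[Λ] Λ where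
  toFun x := p * x
  map_add' := mul_add p
  map_smul' r x := by
    simp only [smul_eq_mul, RingHom.id_apply]
    rw [← mul_assoc, hpc, mul_assoc]

/-- If `M` is invertible then `L / ML` is at most as long as `Λ / M` for every left ideal `L` of
finite colength. -/
theorem length_quotient_smul_le [M.IsTwoSided] [M'.IsTwoSided] (hpc : ∀ x, p * x = x * p)
    (hp0 : ∀ x, p * x = 0 → x = 0) (hMM' : M * M' = Ideal.span {p})
    (hM'M : M' * M = Ideal.span {p}) (L : Ideal Λ)
    (hL : Module.length Λ (Λ ⧸ L) ≠ ⊤) :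
    Module.length Λ (L ⧸ M • (⊤ : Submodule Λ L)) ≤ Module.length Λ (Λ ⧸ M) := by
  have hspan (x : Λ) : x ∈ Ideal.span {p} ↔ ∃ w, x = p * w := by
    rw [Ideal.mem_span_singleton']
    exact ⟨fun ⟨a, ha⟩ => ⟨a, by rw [← ha, hpc]⟩, fun ⟨a, ha⟩ => ⟨a, by rw [ha, hpc]⟩⟩
  have hspan2 : (Ideal.span {p} : Ideal Λ).IsTwoSided := by rw [← hMM']; infer_instance
  have hmulp (I : Ideal Λ) (x : Λ) (hx : x ∈ Ideal.span {p} * I) : ∃ w ∈ I, x = p * w := by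
    have h : Ideal.span {p} * I ≤ Submodule.map (mulCentral hpc) I :=
        Ideal.mul_le.2 fun r hr s hs => by
      obtain ⟨w, rfl⟩ := (hspan r).1 hr
      exact ⟨w * s, I.mul_mem_left _ hs, (mul_assoc _ _ _).symm⟩
    obtain ⟨w, hw, rfl⟩ := h hx
    exact ⟨w, hw, rfl⟩
  have hpmul (I : Ideal Λ) (x : Λ) (hx : x ∈ I) : p * x ∈ Ideal.span {p} * I :=
    Ideal.mul_mem_mul (Ideal.mem_span_singleton_self p) hx
  have hexact (A B : Ideal Λ) (hAB : A ≤ B) : Module.length Λ (Λ ⧸ A) =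
      Module.length Λ (B ⧸ A.submoduleOf B) + Module.length Λ (Λ ⧸ B) := by
    refine Module.length_eq_add_of_exact (Submodule.mapQ (A.submoduleOf B) A B.subtype le_rfl)
      (Submodule.factor hAB) ?_ (Submodule.factor_surjective hAB) ?_
    · rw [← LinearMap.ker_eq_bot, LinearMap.ker_eq_bot']
      intro x hx
      obtain ⟨x, rfl⟩ := Submodule.mkQ_surjective _ x
      change (Submodule.Quotient.mk (x : Λ) : Λ ⧸ A) = 0 at hx
      rw [Submodule.Quotient.mk_eq_zero] at hx
      rwa [Submodule.mkQ_apply, Submodule.Quotient.mk_eq_zero]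
    · intro x
      obtain ⟨x, rfl⟩ := Submodule.mkQ_surjective _ x
      change (Submodule.Quotient.mk x : Λ ⧸ B) = 0 ↔ _
      rw [Submodule.Quotient.mk_eq_zero]
      constructor
      · exact fun hx => ⟨Submodule.Quotient.mk ⟨x, hx⟩, rfl⟩
      · rintro ⟨y, hy⟩
        obtain ⟨y, rfl⟩ := Submodule.mkQ_surjective _ y
        change (Submodule.Quotient.mk (y : Λ) : Λ ⧸ A) = Submodule.Quotient.mk x at hy
        rw [Submodule.Quotient.eq] at hy
        have h := B.sub_mem y.2 (hAB hy)
        rwa [sub_sub_cancel] at h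
  have hML : M * L ≤ L := Ideal.mul_le.2 fun _ _ _ h => L.mul_mem_left _ h
  have hMM : M * L ≤ M := Ideal.mul_le_left
  have hpm (m w : Λ) : p * (m * w) = m * (p * w) := by rw [← mul_assoc, hpc, mul_assoc]
  have hL1 : Module.length Λ (L ⧸ M • (⊤ : Submodule Λ L)) =
      Module.length Λ (L ⧸ (M * L).submoduleOf L) := by
    suffices h : M • (⊤ : Submodule Λ L) = (M * L).submoduleOf L by rw [h]
    rw [Submodule.submoduleOf]
    refine Submodule.map_injective_of_injective L.subtype_injective ?_
    rw [Submodule.map_smul'', Submodule.map_subtype_top, Submodule.map_comap_subtype,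
      inf_eq_right.2 hML]
    rfl
  have hkey : Module.length Λ (M ⧸ (M * L).submoduleOf M) ≤ Module.length Λ (Λ ⧸ L) := by
    let Y (T : Submodule Λ (M ⧸ (M * L).submoduleOf M)) : Ideal Λ :=
      Submodule.map M.subtype (Submodule.comap (Submodule.mkQ _) T)
    have hYM (T) : Y T ≤ M := Submodule.map_subtype_le _ _
    have hYL (T) : M * L ≤ Y T := fun x hx => by
      refine ⟨⟨x, hMM hx⟩, ?_, rfl⟩
      have : Submodule.Quotient.mk (p := (M * L).submoduleOf M) ⟨x, hMM hx⟩ = 0 :=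
        (Submodule.Quotient.mk_eq_zero _).2 hx
      change Submodule.Quotient.mk _ ∈ T
      rw [this]
      exact T.zero_mem
    have hYinj : Function.Injective Y := fun T T' h =>
      Submodule.comap_injective_of_surjective (Submodule.mkQ_surjective _)
        (Submodule.map_injective_of_injective M.subtype_injective h)
    have hYmono : Monotone Y := fun T T' h => Submodule.map_mono (Submodule.comap_mono h)
    let W (T : Submodule Λ (M ⧸ (M * L).submoduleOf M)) : Ideal Λ := divCentral hpc (M' * Y T)
    have hWmono : Monotone W := fun T T' h x hx =>
      Ideal.mul_mono_right (hYmono h) hx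
    have hLW (T) : L ≤ W T := fun x hx => by
      change p * x ∈ M' * Y T
      refine Ideal.mul_mono_right (hYL T) ?_
      rw [← Ideal.mul_assoc, hM'M]
      exact hpmul L x hx
    have hMW (T) : M * W T = Y T := by
      refine le_antisymm (Ideal.mul_le.2 fun m hm w hw => ?_) fun y hy => ?_
      · have h1 : p * (m * w) ∈ Ideal.span {p} * Y T := by
          rw [← hMM', Ideal.mul_assoc, hpm]
          exact Ideal.mul_mem_mul hm hw
        obtain ⟨u, hu, h2⟩ := hmulp _ _ h1
        rwa [← sub_eq_zero.1 (hp0 (u - m * w) (by rw [mul_sub, h2, sub_self]))]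
      · have h1 : M' * Y T ≤ Ideal.span {p} * W T := fun x hx => by
          have h2 : x ∈ Ideal.span {p} := hM'M ▸ Ideal.mul_mono_right (hYM T) hx
          obtain ⟨w, rfl⟩ := (hspan x).1 h2
          exact hpmul _ _ hx
        have h2 := hpmul _ _ hy
        rw [← hMM', Ideal.mul_assoc] at h2
        have h3 : p * y ∈ Ideal.span {p} * (M * W T) := by
          refine (Ideal.mul_le.2 fun m hm v hv => ?_ :
            M * (M' * Y T) ≤ Ideal.span {p} * (M * W T)) h2
          obtain ⟨w, hw, rfl⟩ := hmulp _ _ (h1 hv)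
          rw [← hpm]
          exact hpmul _ _ (Ideal.mul_mem_mul hm hw)
        obtain ⟨u, hu, h4⟩ := hmulp _ _ h3
        rwa [← sub_eq_zero.1 (hp0 (u - y) (by rw [mul_sub, h4, sub_self]))]
    let φ (T : Submodule Λ (M ⧸ (M * L).submoduleOf M)) : Submodule Λ (Λ ⧸ L) :=
      Submodule.map L.mkQ (W T)
    have hφ : StrictMono φ := by
      refine Monotone.strictMono_of_injective (fun T T' h => Submodule.map_mono (hWmono h)) ?_
      intro T T' h
      have h1 := congrArg (Submodule.comap L.mkQ) h
      rw [Submodule.comap_map_mkQ, Submodule.comap_map_mkQ, sup_eq_right.2 (hLW T),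
        sup_eq_right.2 (hLW T')] at h1
      exact hYinj (by rw [← hMW T, ← hMW T', h1])
    have := Order.krullDim_le_of_strictMono φ hφ
    rw [← Module.coe_length, ← Module.coe_length] at this
    exact_mod_cast this
  have h1 := hexact _ _ hML
  rw [hexact _ _ hMM] at h1
  rw [hL1]
  have h2 : Module.length Λ (L ⧸ (M * L).submoduleOf L) + Module.length Λ (Λ ⧸ L) ≤
      Module.length Λ (Λ ⧸ M) + Module.length Λ (Λ ⧸ L) := by
    rw [← h1, add_comm]
    exact add_le_add_right hkey _
  exact (ENat.add_le_add_iff_right hL).1 h2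

end InvertibleIdeal

section Reduction

variable {O : Type*} [CommRing O] [IsLocalRing O] {p : O}
  {N : Type*} [AddCommGroup N] [Module O N]

/-- Reduction of coordinates modulo the maximal ideal. -/
noncomputable def reduceCoord {ι : Type*} [Fintype ι] (b : Module.Basis ι O N) :
    N →ₗ[O] (ι → IsLocalRing.ResidueField O) :=
  LinearMap.pi fun i => Algebra.linearMap O (IsLocalRing.ResidueField O) ∘ₗ b.coord i

theorem reduceCoord_apply {ι : Type*} [Fintype ι] (b : Module.Basis ι O N) (x : N) (i : ι) :
    reduceCoord b x i = IsLocalRing.residue O (b.repr x i) := rfl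

theorem reduceCoord_surjective {ι : Type*} [Fintype ι] (b : Module.Basis ι O N) :
    Function.Surjective (reduceCoord b) := fun v => by
  choose w hw using fun i => IsLocalRing.residue_surjective (v i)
  refine ⟨b.equivFun.symm w, funext fun i => ?_⟩
  rw [reduceCoord_apply, ← hw i, ← b.equivFun_apply, LinearEquiv.apply_symm_apply]

theorem reduceCoord_eq_zero_iff (hp : IsLocalRing.maximalIdeal O = Ideal.span {p}) {ι : Type*}
    [Fintype ι] (b : Module.Basis ι O N) (x : N) :
    reduceCoord b x = 0 ↔ ∃ y, x = p • y := by
  constructor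
  · intro h
    have h1 (i : ι) : ∃ c, b.repr x i = p * c := by
      have := congrFun h i
      rw [reduceCoord_apply, Pi.zero_apply, IsLocalRing.residue_eq_zero_iff, hp,
        Ideal.mem_span_singleton] at this
      exact this
    choose c hc using h1
    refine ⟨∑ i, c i • b i, ?_⟩
    rw [Finset.smul_sum]
    conv_lhs => rw [← b.sum_repr x]
    exact Finset.sum_congr rfl fun i _ => by rw [hc, mul_smul]
  · rintro ⟨y, rfl⟩
    refine funext fun i => ?_
    rw [reduceCoord_apply, Pi.zero_apply, IsLocalRing.residue_eq_zero_iff, hp,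
        Ideal.mem_span_singleton, map_smul]
    exact ⟨b.repr y i, rfl⟩

theorem length_residueField_eq_finrank (V : Type*) [AddCommGroup V]
    [Module (IsLocalRing.ResidueField O) V] [Module O V]
    [IsScalarTower O (IsLocalRing.ResidueField O) V]
    [FiniteDimensional (IsLocalRing.ResidueField O) V] :
    Module.length O V = Module.finrank (IsLocalRing.ResidueField O) V := by
  rw [← Module.length_eq_finrank,
    Module.length_eq_of_surjective (S := O) (R := IsLocalRing.ResidueField O)]
  exact IsLocalRing.residue_surjective

variable [Module.Finite O N] [Module.Free O N]

theorem length_quotient_range_smul (hp : IsLocalRing.maximalIdeal O = Ideal.span {p})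
    (Y : Submodule O N) (hY : ∀ x, x ∈ Y ↔ ∃ y, x = p • y) :
    Module.length O (N ⧸ Y) = Module.finrank O N := by
  let b := Module.Free.chooseBasis O N
  have hk : Y = LinearMap.ker (reduceCoord b) := by
    ext x
    rw [hY, LinearMap.mem_ker, reduceCoord_eq_zero_iff hp]
  rw [((Submodule.quotEquivOfEq _ _ hk).trans ((reduceCoord b).quotKerEquivOfSurjective
    (reduceCoord_surjective b))).length_eq, length_residueField_eq_finrank,
    Module.finrank_fintype_fun_eq_card, Module.finrank_eq_card_chooseBasisIndex]

theorem pow_dvd_det_of_le_length (hp : IsLocalRing.maximalIdeal O = Ideal.span {p})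
    (f : Module.End O N) {c : ℕ} (Y : Submodule O N)
    (hY : ∀ x, x ∈ Y ↔ ∃ y w, x = p • y + f w)
    (hc : (c : ℕ∞) ≤ Module.length O (N ⧸ Y)) : p ^ c ∣ LinearMap.det f := by
  classical
  let b := Module.Free.chooseBasis O N
  let A := LinearMap.toMatrix b b f
  let κ := IsLocalRing.ResidueField O
  let Ab : ((Module.Free.ChooseBasisIndex O N) → κ) →ₗ[κ] _ :=
    (A.map (IsLocalRing.residue O)).mulVecLin
  have hA (x : N) : reduceCoord b (f x) = Ab (reduceCoord b x) := by
    refine funext fun i => ?_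
    rw [reduceCoord_apply, ← LinearMap.toMatrix_mulVec_repr b b f x]
    simp only [Matrix.mulVec, dotProduct, map_sum, map_mul, Ab, Matrix.mulVecLin_apply,
      Matrix.map_apply, reduceCoord_apply, A]
  rw [← LinearMap.det_toMatrix b]
  refine pow_dvd_det_of_le_finrank_ker hp A ?_
  let g : N →ₗ[O] (_ ⧸ LinearMap.range Ab) :=
    ((LinearMap.range Ab).mkQ.restrictScalars O) ∘ₗ reduceCoord b
  have hg : Function.Surjective g := (Submodule.mkQ_surjective _).comp (reduceCoord_surjective b)
  have hk : Y = LinearMap.ker g := by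
    ext x
    rw [hY, LinearMap.mem_ker]
    change _ ↔ Submodule.Quotient.mk (reduceCoord b x) = 0
    rw [Submodule.Quotient.mk_eq_zero, LinearMap.mem_range]
    constructor
    · rintro ⟨y, w, rfl⟩
      refine ⟨reduceCoord b w, ?_⟩
      rw [map_add, (reduceCoord_eq_zero_iff hp b _).2 ⟨y, rfl⟩, zero_add, hA]
    · rintro ⟨v, hv⟩
      obtain ⟨w, rfl⟩ := reduceCoord_surjective b v
      have : reduceCoord b (x - f w) = 0 := by rw [map_sub, hA, hv, sub_self]
      obtain ⟨y, hy⟩ := (reduceCoord_eq_zero_iff hp b _).1 this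
      exact ⟨y, w, by rw [← hy, sub_add_cancel]⟩
  rw [((Submodule.quotEquivOfEq _ _ hk).trans (g.quotKerEquivOfSurjective hg)).length_eq,
    length_residueField_eq_finrank, Nat.cast_le] at hc
  have h1 := LinearMap.finrank_range_add_finrank_ker Ab
  have h2 := Submodule.finrank_quotient_add_finrank (LinearMap.range Ab)
  change c ≤ Module.finrank κ (LinearMap.ker Ab)
  refine hc.trans (le_of_eq (Nat.add_left_cancel (n := Module.finrank κ (LinearMap.range Ab)) ?_))
  rw [h1, add_comm, h2]

theorem not_surjective_iff_not_isUnit_det (f : Module.End O N) :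
    ¬ Function.Surjective f ↔ ¬ IsUnit (LinearMap.det f) := by
  rw [not_iff_not, ← LinearMap.isUnit_iff_isUnit_det, Module.End.isUnit_iff]
  exact ⟨fun h => OrzechProperty.bijective_of_surjective_endomorphism f h, fun h => h.2⟩

end Reduction

section LocalOrder

theorem isArtinian_of_smul_eq_zero {O X : Type*} [CommRing O] [IsDomain O]
    [IsDiscreteValuationRing O] [AddCommGroup X] [Module O X] [Module.Finite O X] {a : O}
    (ha : a ≠ 0) (h : ∀ x : X, a • x = 0) : IsArtinian O X := by
  obtain ⟨s, hs⟩ := Module.finite_def.1 ‹Module.Finite O X›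
  have h0 := (isFiniteLength_iff_isNoetherian_isArtinian.1
    (isFiniteLength_quotient_span_singleton O (mem_nonZeroDivisors_of_ne_zero ha))).2
  have h1 (i : s) : IsArtinian O (Submodule.span O {(i : X)}) := by
    rw [← LinearMap.range_toSpanSingleton]
    refine isArtinian_of_surjective (O ⧸ Ideal.span {a}) (Submodule.liftQ _
      (LinearMap.toSpanSingleton O X (i : X)).rangeRestrict ?_) ?_
    · refine (Ideal.span_singleton_le_iff_mem _).2 ?_
      rw [LinearMap.mem_ker]
      exact Subtype.ext (h i)
    · rw [← LinearMap.range_eq_top, Submodule.range_liftQ, LinearMap.range_rangeRestrict]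
  have h2 : (⨆ i : s, Submodule.span O {(i : X)}) = ⊤ := by
    rw [← hs, Submodule.span_eq_iSup_of_singleton_spans, iSup_subtype']
    rfl
  have h3 : IsArtinian O ↥(⨆ i : s, Submodule.span O {(i : X)}) := isArtinian_iSup
  rw [h2] at h3
  exact isArtinian_of_linearEquiv Submodule.topEquiv

theorem length_quotient_lt_of_lt {A N : Type*} [Ring A] [AddCommGroup N] [Module A N]
    {Y Z : Submodule A N} (h : Y < Z) [IsArtinian A (N ⧸ Y)] [IsNoetherian A (N ⧸ Y)] :
    Module.length A (N ⧸ Z) < Module.length A (N ⧸ Y) := by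
  rw [← (Submodule.quotientQuotientEquivQuotient Y Z h.le).length_eq]
  refine Submodule.length_quotient_lt _ fun hZ => h.not_ge ?_
  rwa [← le_bot_iff, Submodule.map_le_iff_le_comap, Submodule.comap_bot, Submodule.ker_mkQ] at hZ

/-- A module endomorphism with `r` eigenvalues whose differences are units forces the length to be
at least `r`. -/
theorem le_length_of_eigenvectors {O Λ X : Type*} [CommRing O] [Ring Λ] [Algebra O Λ]
    [AddCommGroup X] [Module O X] [Module Λ X] [IsScalarTower O Λ X] (g : Module.End Λ X) {r : ℕ}
    (a : ℕ → O) (ha : ∀ j < r, ∀ i < j, IsUnit (a j - a i)) (v : ℕ → X)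
    (hv0 : ∀ i < r, v i ≠ 0) (hv : ∀ i < r, g (v i) = a i • v i) :
    (r : ℕ∞) ≤ Module.length Λ X := by
  let e (i : ℕ) : Module.End Λ X := g - a i • LinearMap.id
  have he (i : ℕ) (x : X) : e i x = g x - a i • x := rfl
  have hsmul (u : O) (x : X) : g (u • x) = u • g x := LinearMap.map_smul_of_tower g u x
  let G (j : ℕ) : Module.End Λ X := Nat.rec 1 (fun i h => e i * h) j
  have hG0 : G 0 = 1 := rfl
  have hG (j : ℕ) : G (j + 1) = e j * G j := rfl
  have h1 (j : ℕ) (hj : j < r) (i : ℕ) (hi : i ≤ j) : ∃ u : O, IsUnit u ∧ G i (v j) = u • v j := by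
    induction i with
    | zero => exact ⟨1, isUnit_one, by rw [hG0, one_smul]; rfl⟩
    | succ i ih =>
      obtain ⟨u, hu, h⟩ := ih (by omega)
      refine ⟨u * (a j - a i), hu.mul (ha j hj i hi), ?_⟩
      rw [hG, Module.End.mul_apply, h, he, hsmul, hv j hj, ← mul_smul, ← mul_smul, ← sub_smul]
      congr 1
      ring
  let φ (j : Fin (r + 1)) : Submodule Λ X := LinearMap.ker (G j)
  have hφ : StrictMono φ := by
    refine Fin.strictMono_iff_lt_succ.2 fun j => ?_
    change LinearMap.ker (G j) < LinearMap.ker (G (j + 1))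
    refine lt_of_le_of_ne (fun x hx => ?_) fun h => ?_
    · rw [LinearMap.mem_ker] at hx ⊢
      rw [hG, Module.End.mul_apply, hx, map_zero]
    · obtain ⟨u, hu, h2⟩ := h1 j j.2 j le_rfl
      have h3 : v j ∈ LinearMap.ker (G (j + 1)) := by
        rw [LinearMap.mem_ker, hG, Module.End.mul_apply, h2, he, hsmul, hv j j.2, ← mul_smul,
          ← mul_smul, mul_comm, sub_self]
      rw [← h, LinearMap.mem_ker, h2] at h3
      exact hv0 j j.2 ((hu.smul_eq_zero).1 h3)
  have h2 := Order.krullDim_le_of_strictMono φ hφ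
  rw [← Module.coe_length] at h2
  have h3 : (r : WithBot ℕ∞) ≤ Order.krullDim (Fin (r + 1)) := by
    let s : LTSeries (Fin (r + 1)) := ⟨r, id, fun i => Fin.castSucc_lt_succ⟩
    exact Order.LTSeries.length_le_krullDim s
  exact_mod_cast h3.trans h2

variable {O : Type*} [CommRing O] [IsDomain O] [IsDiscreteValuationRing O] {p : O}
  {Λ : Type*} [Ring Λ] [Algebra O Λ]

theorem le_of_le_sup_smul (hp : Irreducible p) {M : Ideal Λ} [M.IsTwoSided] {e : ℕ}
    (hM : M ^ e ≤ Ideal.span {algebraMap O Λ p}) {X : Type*} [AddCommGroup X] [Module O X]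
    [Module Λ X] [IsScalarTower O Λ X] [Module.Finite O X] {N N' : Submodule Λ X}
    (h : N' ≤ N ⊔ M • N') : N' ≤ N := by
  have h1 (j : ℕ) : N' ≤ N ⊔ (M ^ j) • N' := by
    induction j with
    | zero =>
      rw [Submodule.pow_zero, Ideal.one_eq_top, Submodule.top_smul]
      exact le_sup_right
    | succ j ih =>
      refine h.trans (sup_le le_sup_left ?_)
      refine (smul_mono_right M ih).trans ?_
      rw [Submodule.smul_sup]
      refine sup_le (Submodule.smul_le_right.trans le_sup_left) ?_
      rw [← Submodule.smul_assoc, smul_eq_mul, ← Ideal.IsTwoSided.pow_succ]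
      exact le_sup_right
  have h2 : N'.restrictScalars O ≤
      N.restrictScalars O ⊔ (IsLocalRing.maximalIdeal O) • N'.restrictScalars O := by
    intro x hx
    obtain ⟨y, hy, z, hz, rfl⟩ := Submodule.mem_sup.1 (h1 e hx)
    refine Submodule.add_mem_sup hy ?_
    have h3 := Submodule.smul_mono_left (N := N') hM hz
    refine Submodule.smul_induction_on h3 (fun r hr n hn => ?_) fun x y => Submodule.add_mem _
    obtain ⟨b, rfl⟩ := Ideal.mem_span_singleton'.1 hr
    rw [← Algebra.commutes, ← smul_smul, algebraMap_smul]
    exact Submodule.smul_mem_smul ((Irreducible.maximalIdeal_eq hp) ▸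
      Ideal.mem_span_singleton_self p) (N'.smul_mem _ hn)
  exact Submodule.le_of_le_smul_of_le_jacobson_bot (IsNoetherian.noetherian _)
    (IsLocalRing.maximalIdeal_le_jacobson _) h2

/-- The reduced norm estimate: if a maximal left ideal over `p` is principal, then the norms of its
generators bound its colength. -/
theorem le_length_of_span_singleton [NoZeroDivisors Λ] [Nontrivial Λ] [Module.Finite O Λ]
    [Module.Free O Λ] (hp : Irreducible p) {c : ℕ} {z : Λ}
    (hz : p ^ c ∣ LinearMap.det (LinearMap.mulRight O z)) {I : Ideal Λ} (hI : I = Ideal.span {z})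
    (hpI : algebraMap O Λ p ∈ I) : (c : ℕ∞) ≤ Module.length O (Λ ⧸ I) := by
  have hmax := Irreducible.maximalIdeal_eq hp
  have hπ0 : algebraMap O Λ p ≠ 0 := by
    have : Module.IsTorsionFree O Λ := inferInstance
    rw [Algebra.algebraMap_eq_smul_one]
    exact smul_ne_zero hp.ne_zero one_ne_zero
  have hmem (x : Λ) : x ∈ I ↔ ∃ b, b * z = x := by rw [hI, Ideal.mem_span_singleton']
  obtain ⟨a, ha⟩ := (hmem _).1 hpI
  have hz0 : z ≠ 0 := by
    rintro rfl
    rw [mul_zero] at ha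
    exact hπ0 ha.symm
  have hza : z * a = algebraMap O Λ p := by
    have h : (z * a - algebraMap O Λ p) * z = 0 := by
      rw [sub_mul, mul_assoc, ha, Algebra.commutes, sub_self]
    exact sub_eq_zero.1 ((mul_eq_zero.1 h).resolve_right hz0)
  have hz1 (y : Λ) : p • y = y * z * a := by rw [mul_assoc, hza, Algebra.smul_def, Algebra.commutes]
  let q := Module.finrank O Λ
  let Y0 : Submodule O Λ := LinearMap.range (p • (LinearMap.id : Λ →ₗ[O] Λ))
  have hY0 (x : Λ) : x ∈ Y0 ↔ ∃ y, x = p • y := by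
    rw [LinearMap.mem_range]
    exact ⟨fun ⟨y, hy⟩ => ⟨y, hy.symm⟩, fun ⟨y, hy⟩ => ⟨y, hy.symm⟩⟩
  let Y : Submodule O Λ := LinearMap.range (LinearMap.mulRight O a)
  have hY (x : Λ) : x ∈ Y ↔ ∃ y, x = y * a := by
    rw [LinearMap.mem_range]
    exact ⟨fun ⟨y, hy⟩ => ⟨y, hy.symm⟩, fun ⟨y, hy⟩ => ⟨y, hy.symm⟩⟩
  have hYY : Y0 ≤ Y := fun x hx => by
    obtain ⟨y, rfl⟩ := (hY0 x).1 hx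
    exact (hY _).2 ⟨y * z, hz1 y⟩
  have hI0 : I.restrictScalars O ≤ Submodule.comap (LinearMap.mulRight O a) Y0 := fun x hx => by
    obtain ⟨b, rfl⟩ := (hmem x).1 hx
    exact (hY0 _).2 ⟨b, (hz1 b).symm⟩
  have hlen : Module.length O (Λ ⧸ Y0) =
      Module.length O (Λ ⧸ I.restrictScalars O) + Module.length O (Λ ⧸ Y) := by
    refine Module.length_eq_add_of_exact (Submodule.mapQ _ _ (LinearMap.mulRight O a) hI0)
      (Submodule.factor hYY) ?_ (Submodule.factor_surjective hYY) ?_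
    · rw [← LinearMap.ker_eq_bot, LinearMap.ker_eq_bot']
      intro x hx
      obtain ⟨x, rfl⟩ := Submodule.mkQ_surjective _ x
      change (Submodule.Quotient.mk (x * a) : Λ ⧸ Y0) = 0 at hx
      rw [Submodule.Quotient.mk_eq_zero, hY0] at hx
      rw [Submodule.mkQ_apply, Submodule.Quotient.mk_eq_zero, Submodule.restrictScalars_mem, hmem]
      obtain ⟨y, hy⟩ := hx
      have ha0 : a ≠ 0 := by
        rintro rfl
        rw [zero_mul] at ha
        exact hπ0 ha.symm
      rw [hz1] at hy
      exact ⟨y, (mul_right_cancel₀ ha0 hy).symm⟩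
    · intro x
      obtain ⟨x, rfl⟩ := Submodule.mkQ_surjective _ x
      change (Submodule.Quotient.mk x : Λ ⧸ Y) = 0 ↔ _
      rw [Submodule.Quotient.mk_eq_zero, hY]
      constructor
      · rintro ⟨y, rfl⟩
        exact ⟨Submodule.Quotient.mk y, rfl⟩
      · rintro ⟨y, hy⟩
        obtain ⟨y, rfl⟩ := Submodule.mkQ_surjective _ y
        change (Submodule.Quotient.mk (y * a) : Λ ⧸ Y0) = Submodule.Quotient.mk x at hy
        rw [Submodule.Quotient.eq, hY0] at hy
        obtain ⟨w, hw⟩ := hy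
        exact ⟨y - w * z, by rw [sub_mul, ← hz1, ← hw, sub_sub_cancel]⟩
  rw [length_quotient_range_smul hmax Y0 hY0] at hlen
  change (c : ℕ∞) ≤ Module.length O (Λ ⧸ I.restrictScalars O)
  have hfin (n : ℕ∞) (h : n ≤ (q : ℕ∞)) : ∃ m : ℕ, n = m :=
    ENat.ne_top_iff_exists.1 (ne_top_of_le_ne_top (ENat.natCast_ne_top q) h) |>.imp fun _ h => h.symm
  obtain ⟨d, hd⟩ := hfin _ (hlen ▸ le_self_add)
  obtain ⟨l, hl⟩ := hfin _ (hlen ▸ le_add_self)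
  rw [hd, Nat.cast_le]
  rw [hd, hl, ← Nat.cast_add, Nat.cast_inj] at hlen
  have h1 : p ^ l ∣ LinearMap.det (LinearMap.mulRight O a) := by
    refine pow_dvd_det_of_le_length hmax _ Y (fun x => ?_) hl.ge
    rw [hY]
    constructor
    · rintro ⟨y, rfl⟩
      exact ⟨0, y, by simp⟩
    · rintro ⟨y, w, rfl⟩
      exact ⟨y * z + w, by rw [add_mul, hz1]; rfl⟩
  have h2 : LinearMap.det (LinearMap.mulRight O z) * LinearMap.det (LinearMap.mulRight O a) =
      p ^ q := by
    rw [← LinearMap.det_comp]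
    have : LinearMap.mulRight O z ∘ₗ LinearMap.mulRight O a = p • LinearMap.id := by
      ext x
      change x * a * z = p • x
      rw [mul_assoc, ha, Algebra.smul_def, Algebra.commutes]
    rw [this, LinearMap.det_smul, LinearMap.det_id, mul_one]
  have h3 : p ^ (c + l) ∣ p ^ q := by
    rw [pow_add, ← h2]
    exact mul_dvd_mul hz h1
  have h4 := (pow_dvd_pow_iff hp.ne_zero hp.not_isUnit).1 h3
  change Module.finrank O Λ = d + l at hlen
  have h5 : q = d + l := hlen
  omega

set_option maxHeartbeats 400000 in
/-- A local order with sufficiently many residual eigenvalues and sufficiently divisible norms is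
unramified: `p` generates its maximal two-sided ideal. -/
theorem le_span_of_ne_top [NoZeroDivisors Λ] [Nontrivial Λ] [Module.Finite O Λ] [Module.Free O Λ]
    (hp : Irreducible p)
    (Hr : ∀ X : Ideal Λ, X.IsTwoSided → algebraMap O Λ p ∈ X → ∀ z,
      (∀ x ∈ X, ∃ x' ∈ X, x * z = algebraMap O Λ p * x') → ∃ w, z = algebraMap O Λ p * w)
    (Hl : ∀ X : Ideal Λ, X.IsTwoSided → algebraMap O Λ p ∈ X → ∀ z,
      (∀ x ∈ X, ∃ x' ∈ X, z * x = algebraMap O Λ p * x') → ∃ w, z = algebraMap O Λ p * w)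
    {n : ℕ} (hU : ∀ X : Ideal Λ, X.IsTwoSided → X ≤ Ideal.span {algebraMap O Λ p} ∨
      algebraMap O Λ p ^ n ∈ X)
    {r c : ℕ} (hrc : r * c = Module.finrank O Λ)
    (hc : ∀ z : Λ, ¬ IsUnit (LinearMap.det (LinearMap.mulRight O z)) →
      p ^ c ∣ LinearMap.det (LinearMap.mulRight O z))
    (L : Ideal Λ) {m : ℕ} (hL : algebraMap O Λ p ^ m ∈ L) (f : Module.End Λ L) (a : ℕ → O)
    (ha : ∀ j < r, ∀ i < j, IsUnit (a j - a i))
    (hf : ∀ i < r, ¬ Function.Surjective fun x => f x - a i • x)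
    (X : Ideal Λ) (hX : X.IsTwoSided) (hpX : algebraMap O Λ p ∈ X) (hX1 : X ≠ ⊤) :
    X ≤ Ideal.span {algebraMap O Λ p} := by
  have hπ0 : algebraMap O Λ p ≠ 0 := by
    rw [Algebra.algebraMap_eq_smul_one]
    exact smul_ne_zero hp.ne_zero one_ne_zero
  have hpc (x : Λ) : algebraMap O Λ p * x = x * algebraMap O Λ p := Algebra.commutes p x
  have hp0 (x : Λ) (h : algebraMap O Λ p * x = 0) : x = 0 := (mul_eq_zero.1 h).resolve_left hπ0
  have : IsNoetherian O Λ := inferInstance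
  have : IsNoetherianRing Λ := isNoetherian_of_tower O this
  have hartO (I : Ideal Λ) (j : ℕ) (h : algebraMap O Λ p ^ j ∈ I) : IsArtinian O (Λ ⧸ I) := by
    refine isArtinian_of_smul_eq_zero (pow_ne_zero j hp.ne_zero) fun x => ?_
    obtain ⟨x, rfl⟩ := Submodule.mkQ_surjective _ x
    rw [← LinearMap.map_smul_of_tower, Submodule.mkQ_apply, Submodule.Quotient.mk_eq_zero,
      Algebra.smul_def, Algebra.commutes, map_pow]
    exact I.mul_mem_left _ h
  have hart (I : Ideal Λ) (j : ℕ) (h : algebraMap O Λ p ^ j ∈ I) : IsArtinian Λ (Λ ⧸ I) :=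
    isArtinian_of_tower O (hartO I j h)
  have hpspan : algebraMap O Λ p ∈ Ideal.span {algebraMap O Λ p} :=
    Ideal.mem_span_singleton_self _
  have hpu : ¬ IsUnit (algebraMap O Λ p) := fun h => hX1 (Ideal.eq_top_of_isUnit_mem _ hpX h)
  obtain ⟨M, M', hM2, hM'2, hpM, hM1, hMM', hM'M, hsimple⟩ := exists_invertible_ideal hpc hpu
    (hart _ 1 (by rwa [pow_one])) Hr Hl
  have hartM : IsArtinian Λ (Λ ⧸ M) := hart M 1 (by rwa [pow_one])
  have : IsArtinianRing (Λ ⧸ M) := isArtinian_of_tower Λ hartM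
  obtain ⟨e, he⟩ := exists_pow_le_span_singleton hpc hp0 hM1 hMM'
    (hart _ n (Ideal.mem_span_singleton_self _)) hU
  have hlenM (L : Ideal Λ) (j : ℕ) (h : algebraMap O Λ p ^ j ∈ L) :
      Module.length Λ (L ⧸ M • (⊤ : Submodule Λ L)) ≤ Module.length Λ (Λ ⧸ M) := by
    have := hart L j h
    exact length_quotient_smul_le hpc hp0 hMM' hM'M L Module.length_ne_top
  obtain ⟨I, hI, hMI⟩ := Ideal.exists_le_maximal M hM1
  have : IsSimpleModule Λ (Λ ⧸ I) := isSimpleModule_iff_isCoatom.2 hI.out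
  have hS : Module.IsTorsionBySet Λ (Λ ⧸ I) M :=
    (Module.isTorsionBySet_quotient_iff _ _).2 fun x r hr =>
      hMI (Ideal.IsTwoSided.mul_mem_of_left x hr)
  -- the maximal left ideal is principal
  obtain ⟨z, hz⟩ : ∃ z, I = Ideal.span {z} := by
    obtain ⟨x, hx⟩ := exists_span_singleton_eq_top_of_length_le M
      (Module.isTorsionBySet_quotient_ideal_smul I M)
      (hlenM I 1 (by rw [pow_one]; exact hMI hpM))
    obtain ⟨z, rfl⟩ := Submodule.mkQ_surjective _ x
    have h1 : (⊤ : Submodule Λ I) ≤ Submodule.span Λ {z} := by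
      refine le_of_le_sup_smul hp he ?_
      rw [← Set.image_singleton, ← Submodule.map_span] at hx
      have := congrArg (Submodule.comap (M • (⊤ : Submodule Λ I)).mkQ) hx
      rw [Submodule.comap_map_mkQ, Submodule.comap_top, sup_comm] at this
      exact this.ge
    refine ⟨z, ?_⟩
    have := congrArg (Submodule.map I.subtype) (top_le_iff.1 h1)
    rw [Submodule.map_subtype_top, Submodule.map_span, Set.image_singleton] at this
    exact this.symm
  have hcd : (c : ℕ∞) ≤ Module.length O (Λ ⧸ I) := by
    refine le_length_of_span_singleton hp (hc z ?_) hz (hMI hpM)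
    rw [← not_surjective_iff_not_isUnit_det]
    intro h
    obtain ⟨y, hy⟩ := h 1
    refine hI.ne_top ((Ideal.eq_top_iff_one I).2 ?_)
    rw [hz, Ideal.mem_span_singleton']
    exact ⟨y, hy⟩
  have hrs : (r : ℕ∞) ≤ Module.length Λ (Λ ⧸ M) := by
    refine le_trans ?_ (hlenM L m hL)
    let Q := M • (⊤ : Submodule Λ L)
    have hQ : Q ≤ Submodule.comap f Q := fun x hx =>
      Submodule.smul_induction_on hx (fun b hb y _ => by
        rw [Submodule.mem_comap, map_smul]
        exact Submodule.smul_mem_smul hb trivial) fun x y => Submodule.add_mem _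
    have hart' : IsArtinian Λ (L ⧸ Q) := by
      refine isArtinian_of_tower O (isArtinian_of_smul_eq_zero hp.ne_zero fun x => ?_)
      obtain ⟨x, rfl⟩ := Submodule.mkQ_surjective _ x
      rw [← LinearMap.map_smul_of_tower, Submodule.mkQ_apply, Submodule.Quotient.mk_eq_zero,
        ← algebraMap_smul Λ p x]
      exact Submodule.smul_mem_smul hpM trivial
    have hsmul (i : ℕ) : ∃ h : Module.End Λ L, ∀ x, h x = f x - a i • x :=
      ⟨f - a i • LinearMap.id, fun _ => rfl⟩
    choose h hh using hsmul
    have hhQ (i : ℕ) : Q ≤ Submodule.comap (h i) Q := fun x hx => by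
      rw [Submodule.mem_comap, hh, ← algebraMap_smul Λ (a i) x]
      exact Q.sub_mem (hQ hx) (Q.smul_mem _ hx)
    have hv (i : ℕ) : ∃ v : L ⧸ Q, i < r → v ≠ 0 ∧ Submodule.mapQ Q Q f hQ v = a i • v := by
      by_cases hi : i < r
      · have h1 : ¬ Function.Injective (Submodule.mapQ Q Q (h i) (hhQ i)) := fun hinj => by
          have h2 := IsArtinian.surjective_of_injective_endomorphism _ hinj
          have h3 : (⊤ : Submodule Λ L) ≤ LinearMap.range (h i) := by
            refine le_of_le_sup_smul hp he fun x _ => ?_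
            obtain ⟨y, hy⟩ := h2 (Q.mkQ x)
            obtain ⟨y, rfl⟩ := Submodule.mkQ_surjective _ y
            change (Submodule.Quotient.mk (h i y) : L ⧸ Q) = Submodule.Quotient.mk x at hy
            rw [eq_comm, Submodule.Quotient.eq] at hy
            rw [← add_sub_cancel (h i y) x]
            exact Submodule.add_mem_sup (LinearMap.mem_range_self _ _) hy
          refine hf i hi fun x => ?_
          obtain ⟨y, hy⟩ := h3 (show x ∈ ⊤ from trivial)
          exact ⟨y, by rw [← hy, hh]⟩
        rw [← LinearMap.ker_eq_bot, ← ne_eq, Submodule.ne_bot_iff] at h1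
        obtain ⟨v, hv, hv0⟩ := h1
        refine ⟨v, fun _ => ⟨hv0, ?_⟩⟩
        obtain ⟨v, rfl⟩ := Submodule.mkQ_surjective _ v
        change (Submodule.Quotient.mk (h i v) : L ⧸ Q) = 0 at hv
        rw [hh, Submodule.Quotient.mk_sub, sub_eq_zero] at hv
        exact hv
      · exact ⟨0, fun h => absurd h hi⟩
    choose v hv using hv
    exact le_length_of_eigenvectors (Submodule.mapQ Q Q f hQ) a ha v (fun i hi => (hv i hi).1)
      fun i hi => (hv i hi).2
  obtain ⟨s, ⟨g⟩⟩ := exists_linearEquiv_fun_of_isTorsionBySet M hS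
    (isTorsionBySet_quotient_of_isTwoSided M)
  rw [g.length_eq, Module.length_pi, Module.length_eq_one] at hrs
  have hlenO : Module.length O (Λ ⧸ M) = s * Module.length O (Λ ⧸ I) := by
    rw [(g.restrictScalars O).length_eq, Module.length_pi]
    simp
  have hMp : M ≤ Ideal.span {algebraMap O Λ p} := by
    by_contra hne
    let Y : Submodule O Λ := (Ideal.span {algebraMap O Λ p}).restrictScalars O
    have hY (x : Λ) : x ∈ Y ↔ ∃ y, x = p • y := by
      rw [Submodule.restrictScalars_mem, Ideal.mem_span_singleton']
      refine exists_congr fun y => ?_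
      rw [Algebra.smul_def, Algebra.commutes, eq_comm]
    have hYM : Y ≤ M.restrictScalars O := fun x hx => by
      obtain ⟨y, rfl⟩ := (hY x).1 hx
      rw [Submodule.restrictScalars_mem, Algebra.smul_def, Algebra.commutes]
      exact M.mul_mem_left _ hpM
    have hartY : IsArtinian O (Λ ⧸ Y) := by
      refine isArtinian_of_smul_eq_zero hp.ne_zero fun x => ?_
      obtain ⟨x, rfl⟩ := Submodule.mkQ_surjective _ x
      rw [← map_smul, Submodule.mkQ_apply, Submodule.Quotient.mk_eq_zero, hY]
      exact ⟨x, rfl⟩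
    have hlt := length_quotient_lt_of_lt (lt_of_le_not_ge hYM hne)
    rw [length_quotient_range_smul (Irreducible.maximalIdeal_eq hp) Y hY, ← hrc, Nat.cast_mul] at hlt
    refine (not_le_of_gt hlt) ?_
    change _ ≤ Module.length O (Λ ⧸ M)
    rw [hlenO]
    refine mul_le_mul' ?_ hcd
    simpa using hrs
  refine le_trans ?_ hMp
  have hMX : M ≤ X := hMp.trans ((Ideal.span_singleton_le_iff_mem _).2 hpX)
  have : Nontrivial (Λ ⧸ X) := Ideal.Quotient.nontrivial_iff.2 hX1
  have hinj := RingHom.injective (Ideal.Quotient.factor hMX)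
  intro x hx
  rw [← Ideal.Quotient.eq_zero_iff_mem] at hx ⊢
  exact hinj (by rw [map_zero]; exact hx)

end LocalOrder

section LatticeBounds

variable {O K V : Type*} [CommRing O] [IsDomain O] [Field K] [Algebra O K]
  [IsFractionRing O K] [AddCommGroup V] [Module K V] [Module O V] [IsScalarTower O K V]

theorem exists_smul_mem_of_span_eq_top {N : Submodule O V}
    (hN : Submodule.span K (N : Set V) = ⊤) (v : V) : ∃ a : O, a ≠ 0 ∧ a • v ∈ N := by
  have hv : v ∈ Submodule.span K (N : Set V) := hN ▸ trivial
  induction hv using Submodule.span_induction with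
  | mem x hx => exact ⟨1, one_ne_zero, by rwa [one_smul]⟩
  | zero => exact ⟨1, one_ne_zero, by rw [smul_zero]; exact N.zero_mem⟩
  | add x y _ _ hx hy =>
    obtain ⟨a, ha, hax⟩ := hx
    obtain ⟨b, hb, hby⟩ := hy
    refine ⟨a * b, mul_ne_zero ha hb, ?_⟩
    rw [smul_add, mul_smul, mul_smul, smul_comm a b x]
    exact N.add_mem (N.smul_mem b hax) (N.smul_mem a hby)
  | smul c x _ hx =>
    obtain ⟨a, ha, hax⟩ := hx
    obtain ⟨d, hd⟩ := IsLocalization.exist_integer_multiples_of_finset (nonZeroDivisors O) {c}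
    obtain ⟨e, he⟩ := hd c (Finset.mem_singleton_self c)
    refine ⟨d * a, mul_ne_zero (nonZeroDivisors.coe_ne_zero d) ha, ?_⟩
    have : ((d : O) * a) • c • x = e • a • x := by
      rw [mul_comm, mul_smul, ← smul_assoc (d : O) c x]
      have h : (d : O) • c = algebraMap O K e := he.symm
      rw [h, algebraMap_smul, smul_comm]
    rw [this]
    exact N.smul_mem e hax

theorem exists_smul_le_of_fg {N B : Submodule O V}
    (hN : Submodule.span K (N : Set V) = ⊤) (hB : B.FG) :
    ∃ a : O, a ≠ 0 ∧ ∀ v ∈ B, a • v ∈ N := by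
  induction B, hB using Submodule.fg_induction with
  | singleton x =>
    obtain ⟨a, ha, hax⟩ := exists_smul_mem_of_span_eq_top (K := K) hN x
    refine ⟨a, ha, fun v hv => ?_⟩
    obtain ⟨c, rfl⟩ := Submodule.mem_span_singleton.1 hv
    rw [smul_comm]
    exact N.smul_mem c hax
  | sup B C _ _ hB hC =>
    obtain ⟨a, ha, haB⟩ := hB
    obtain ⟨b, hb, hbC⟩ := hC
    refine ⟨a * b, mul_ne_zero ha hb, fun v hv => ?_⟩
    obtain ⟨x, hx, y, hy, rfl⟩ := Submodule.mem_sup.1 hv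
    rw [smul_add, mul_smul a b y, mul_comm, mul_smul]
    exact N.add_mem (N.smul_mem b (haB x hx)) (N.smul_mem a (hbC y hy))

theorem fg_of_smul_mem [IsNoetherianRing O] [Module.IsTorsionFree O V]
    {A B : Submodule O V} (hA : A.FG) {a : O}
    (ha : a ≠ 0) (h : ∀ v ∈ B, a • v ∈ A) : B.FG := by
  have : Module.Finite O A := Module.Finite.iff_fg.2 hA
  let f : B →ₗ[O] A := (a • B.subtype).codRestrict A fun v => h v v.2
  have hf : Function.Injective f := by
    rw [← LinearMap.ker_eq_bot, LinearMap.ker_eq_bot']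
    intro v hv
    have h1 : a • (v : V) = 0 := congrArg Subtype.val hv
    exact Subtype.ext ((smul_eq_zero.1 h1).resolve_left ha)
  exact Module.Finite.iff_fg.1 (Module.Finite.of_injective f hf)

variable [IsDiscreteValuationRing O] {p : O}

theorem exists_pow_smul_le_of_fg (hp : Irreducible p) {N B : Submodule O V}
    (hN : Submodule.span K (N : Set V) = ⊤) (hB : B.FG) :
    ∃ m : ℕ, ∀ v ∈ B, p ^ m • v ∈ N := by
  obtain ⟨a, ha, h⟩ := exists_smul_le_of_fg (K := K) hN hB
  obtain ⟨m, u, rfl⟩ := IsDiscreteValuationRing.eq_unit_mul_pow_irreducible ha hp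
  refine ⟨m, fun v hv => ?_⟩
  have := N.smul_mem (u⁻¹ : Oˣ).1 (h v hv)
  rwa [← mul_smul, ← mul_assoc, Units.inv_mul, one_mul] at this

end LatticeBounds

section MaximalOrder

variable {O K S : Type*} [CommRing O] [IsDomain O] [IsDiscreteValuationRing O] [Field K]
  [Algebra O K] [IsFractionRing O K] [DivisionRing S] [Algebra K S] [Algebra O S]
  [IsScalarTower O K S] {p : O} {Λ : Subalgebra O S}

/-- The two-sided ideals of an order that are not contained in `p` contain a fixed power of `p`. -/
theorem exists_pow_mem_of_not_le [FiniteDimensional K S] (hS : Subalgebra.center K S = ⊥)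
    (hp : Irreducible p)
    (hfg : (Subalgebra.toSubmodule Λ).FG)
    (hspan : Submodule.span K (Subalgebra.toSubmodule Λ : Set S) = ⊤) :
    ∃ n : ℕ, ∀ X : Ideal Λ, X.IsTwoSided →
      X ≤ Ideal.span {algebraMap O Λ p} ∨ algebraMap O Λ p ^ n ∈ X := by
  obtain ⟨m, b, c, hbc⟩ := exists_basis_of_lattice (K := K) hfg hspan
  have hden (a : S) : ∃ N, p ^ N • a ∈ Λ := by
    obtain ⟨N, hN⟩ := exists_pow_smul_le_of_fg (K := K) hp hspan
      (Submodule.fg_span_singleton (R := O) a)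
    exact ⟨N, hN a (Submodule.mem_span_singleton_self a)⟩
  have h1 (t : S ⊗[K] Sᵐᵒᵖ) : ∃ N, ∀ X : Ideal Λ, X.IsTwoSided → ∀ x ∈ X, ∀ N' ≥ N,
      ∃ x' ∈ X, (x' : S) = p ^ N' • AlgHom.mulLeftRight K S t x := by
    induction t with
    | zero =>
      exact ⟨0, fun X _ x _ N' _ => ⟨0, X.zero_mem, by simp⟩⟩
    | add s t hs ht =>
      obtain ⟨N, hN⟩ := hs
      obtain ⟨N₂, hN₂⟩ := ht
      refine ⟨max N N₂, fun X hX x hx N' hN' => ?_⟩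
      obtain ⟨y, hy, hy'⟩ := hN X hX x hx N' (le_of_max_le_left hN')
      obtain ⟨z, hz, hz'⟩ := hN₂ X hX x hx N' (le_of_max_le_right hN')
      exact ⟨y + z, X.add_mem hy hz, by
        rw [map_add, LinearMap.add_apply, smul_add, ← hy', ← hz']; rfl⟩
    | tmul s t =>
      obtain ⟨N, hN⟩ := hden s
      obtain ⟨N₂, hN₂⟩ := hden t.unop
      refine ⟨N + N₂, fun X hX x hx N' hN' => ?_⟩
      obtain ⟨l, rfl⟩ := Nat.exists_eq_add_of_le hN'
      refine ⟨p ^ l • ((⟨_, hN⟩ : Λ) * x * (⟨_, hN₂⟩ : Λ)), ?_, ?_⟩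
      · rw [← algebraMap_smul Λ]
        exact X.smul_mem _ (hX.mul_mem_of_left _ (X.mul_mem_left _ hx))
      · rw [AlgHom.mulLeftRight_apply]
        change p ^ l • (p ^ N • s * (x : S) * p ^ N₂ • t.unop) = _
        rw [smul_mul_assoc, smul_mul_assoc, mul_smul_comm, ← mul_smul, ← mul_smul, ← pow_add,
          ← pow_add]
        congr 2
        ring
  have h2 (i : Fin m) : ∃ t, ∀ x, AlgHom.mulLeftRight K S t x = c.coord i x • 1 := by
    obtain ⟨t, ht⟩ := mulLeftRight_surjective_of_center_eq_bot hS
      ((c.coord i).smulRight (1 : S))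
    exact ⟨t, fun x => by rw [ht]; rfl⟩
  choose t ht using h2
  choose N hN using fun i => h1 (t i)
  refine ⟨Finset.univ.sup N, fun X hX => or_iff_not_imp_left.2 fun hle => ?_⟩
  obtain ⟨x, hx, hx'⟩ := SetLike.not_le_iff_exists.1 hle
  have h3 : ∃ i, ¬ p ∣ b.repr x i := by
    by_contra! h
    choose d hd using h
    refine hx' ?_
    rw [Ideal.mem_span_singleton']
    refine ⟨∑ i, d i • (b i : Λ), ?_⟩
    rw [← Algebra.commutes, ← Algebra.smul_def, Finset.smul_sum]
    conv_rhs => rw [← b.sum_repr x]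
    exact Finset.sum_congr rfl fun i _ => by rw [hd, mul_smul]
  obtain ⟨i, hi⟩ := h3
  have hu : IsUnit (b.repr x i) := by
    by_contra h
    rw [← mem_nonunits_iff, ← IsLocalRing.mem_maximalIdeal, hp.maximalIdeal_eq,
      Ideal.mem_span_singleton] at h
    exact hi h
  obtain ⟨x', hx', hx''⟩ := hN i X hX x hx _ (Finset.le_sup (Finset.mem_univ i))
  have h4 : c.coord i x = algebraMap O K (b.repr x i) := by
    have : (x : S) = ∑ j, algebraMap O K (b.repr x j) • c j := by
      have := congrArg (Subalgebra.toSubmodule Λ).subtype (b.sum_repr x)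
      simp only [map_sum, map_smul, Submodule.subtype_apply] at this
      rw [← show ((x : Λ) : S) = (x : S) from rfl]
      refine this.symm.trans (Finset.sum_congr rfl fun j _ => ?_)
      rw [hbc, algebraMap_smul]
    rw [Module.Basis.coord_apply, this, c.repr_sum_self]
  obtain ⟨u, hu⟩ := hu
  have h5 : (algebraMap O Λ p ^ Finset.univ.sup N) = (u⁻¹ : Oˣ).1 • x' := by
    refine Subtype.ext ?_
    change _ = (u⁻¹ : Oˣ).1 • (x' : S)
    rw [hx'', ht, h4, ← hu, algebraMap_smul, smul_comm, ← mul_smul (u⁻¹ : Oˣ).1, Units.inv_mul,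
      one_smul, Algebra.smul_def, mul_one, map_pow]
    rfl
  rw [h5, ← algebraMap_smul Λ]
  exact X.smul_mem _ hx'

end MaximalOrder

section LocalOrder

variable {O K S : Type*} [CommRing O] [IsDomain O] [IsDiscreteValuationRing O] [Field K]
  [Algebra O K] [IsFractionRing O K] [DivisionRing S] [Algebra K S] [Algebra O S]
  [IsScalarTower O K S] {p : O} {Λ : Subalgebra O S}

theorem exists_eq_mul_of_right_multiplier (K : Type*) [Field K] [Algebra O K]
    [IsFractionRing O K] [Algebra K S] [IsScalarTower O K S] (hp : p ≠ 0)
    (hfg : (Subalgebra.toSubmodule Λ).FG)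
    (hmax : ∀ Ω : Subalgebra O S, (Subalgebra.toSubmodule Ω).FG → Λ ≤ Ω → Ω ≤ Λ)
    (X : Ideal Λ) (hX : X.IsTwoSided) (hpX : algebraMap O Λ p ∈ X) (z : Λ)
    (hz : ∀ x ∈ X, ∃ x' ∈ X, x * z = algebraMap O Λ p * x') : ∃ w, z = algebraMap O Λ p * w := by
  have : Module.IsTorsionFree O S := Module.IsTorsionFree.trans_faithfulSMul O K S
  have hpK : algebraMap O K p ≠ 0 := by
    rwa [Ne, FaithfulSMul.algebraMap_eq_zero_iff]
  let Ω : Subalgebra O S :=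
    { carrier := {w | ∀ x ∈ X, ∃ x' ∈ X, (x : S) * w = (x' : Λ)}
      mul_mem' := fun {a b} ha hb x hx => by
        obtain ⟨y, hy, hxy⟩ := ha x hx
        obtain ⟨t, ht, hyt⟩ := hb y hy
        exact ⟨t, ht, by rw [← mul_assoc, hxy, hyt]⟩
      add_mem' := fun {a b} ha hb x hx => by
        obtain ⟨y, hy, hxy⟩ := ha x hx
        obtain ⟨t, ht, hyt⟩ := hb x hx
        exact ⟨y + t, X.add_mem hy ht, by rw [mul_add, hxy, hyt]; rfl⟩
      algebraMap_mem' := fun a x hx =>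
        ⟨x * algebraMap O Λ a, hX.mul_mem_of_left _ hx, rfl⟩ }
  have hle : Λ ≤ Ω := fun w hw x hx => ⟨x * ⟨w, hw⟩, hX.mul_mem_of_left _ hx, rfl⟩
  have hfgΩ : (Subalgebra.toSubmodule Ω).FG := by
    refine fg_of_smul_mem hfg hp fun v hv => ?_
    obtain ⟨x', hx', h⟩ := hv _ hpX
    have : p • v = (x' : S) := by rw [← h, Algebra.smul_def]; rfl
    rw [this]
    exact x'.2
  have hmem : (algebraMap O K p)⁻¹ • (z : S) ∈ Ω := by
    intro x hx
    obtain ⟨x', hx', h⟩ := hz x hx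
    refine ⟨x', hx', ?_⟩
    have h1 : (x : S) * z = algebraMap O K p • (x' : S) := by
      rw [algebraMap_smul, Algebra.smul_def]
      exact congrArg Subtype.val h
    rw [mul_smul_comm, h1, inv_smul_smul₀ hpK]
  refine ⟨⟨_, hmax Ω hfgΩ hle hmem⟩, Subtype.ext ?_⟩
  change (z : S) = algebraMap O S p * _
  rw [← Algebra.smul_def, ← algebraMap_smul K, smul_inv_smul₀ hpK]

theorem exists_eq_mul_of_left_multiplier (K : Type*) [Field K] [Algebra O K]
    [IsFractionRing O K] [Algebra K S] [IsScalarTower O K S] (hp : p ≠ 0)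
    (hfg : (Subalgebra.toSubmodule Λ).FG)
    (hmax : ∀ Ω : Subalgebra O S, (Subalgebra.toSubmodule Ω).FG → Λ ≤ Ω → Ω ≤ Λ)
    (X : Ideal Λ) (hX : X.IsTwoSided) (hpX : algebraMap O Λ p ∈ X) (z : Λ)
    (hz : ∀ x ∈ X, ∃ x' ∈ X, z * x = algebraMap O Λ p * x') : ∃ w, z = algebraMap O Λ p * w := by
  have : Module.IsTorsionFree O S := Module.IsTorsionFree.trans_faithfulSMul O K S
  have hpK : algebraMap O K p ≠ 0 := by
    rwa [Ne, FaithfulSMul.algebraMap_eq_zero_iff]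
  let Ω : Subalgebra O S :=
    { carrier := {w | ∀ x ∈ X, ∃ x' ∈ X, w * (x : S) = (x' : Λ)}
      mul_mem' := fun {a b} ha hb x hx => by
        obtain ⟨y, hy, hxy⟩ := hb x hx
        obtain ⟨t, ht, hyt⟩ := ha y hy
        exact ⟨t, ht, by rw [mul_assoc, hxy, hyt]⟩
      add_mem' := fun {a b} ha hb x hx => by
        obtain ⟨y, hy, hxy⟩ := ha x hx
        obtain ⟨t, ht, hyt⟩ := hb x hx
        exact ⟨y + t, X.add_mem hy ht, by rw [add_mul, hxy, hyt]; rfl⟩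
      algebraMap_mem' := fun a x hx =>
        ⟨algebraMap O Λ a * x, X.mul_mem_left _ hx, rfl⟩ }
  have hle : Λ ≤ Ω := fun w hw x hx => ⟨⟨w, hw⟩ * x, X.mul_mem_left _ hx, rfl⟩
  have hfgΩ : (Subalgebra.toSubmodule Ω).FG := by
    refine fg_of_smul_mem hfg hp fun v hv => ?_
    obtain ⟨x', hx', h⟩ := hv _ hpX
    have : p • v = (x' : S) := by rw [← h, Algebra.smul_def, Algebra.commutes]; rfl
    rw [this]
    exact x'.2
  have hmem : (algebraMap O K p)⁻¹ • (z : S) ∈ Ω := by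
    intro x hx
    obtain ⟨x', hx', h⟩ := hz x hx
    refine ⟨x', hx', ?_⟩
    have h1 : (z : S) * x = algebraMap O K p • (x' : S) := by
      rw [algebraMap_smul, Algebra.smul_def]
      exact congrArg Subtype.val h
    rw [smul_mul_assoc, h1, inv_smul_smul₀ hpK]
  refine ⟨⟨_, hmax Ω hfgΩ hle hmem⟩, Subtype.ext ?_⟩
  change (z : S) = algebraMap O S p * _
  rw [← Algebra.smul_def, ← algebraMap_smul K, smul_inv_smul₀ hpK]

theorem rightNorm_eq_det_of_lattice (hfg : (Subalgebra.toSubmodule Λ).FG)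
    (hspan : Submodule.span K (Subalgebra.toSubmodule Λ : Set S) = ⊤) (z : Λ) :
    rightNorm K (z : S) = algebraMap O K (LinearMap.det (LinearMap.mulRight O z)) :=
  det_eq_of_lattice hfg hspan _ (LinearMap.mulRight O z) fun _ => rfl

theorem rightTrace_mem_of_lattice (hfg : (Subalgebra.toSubmodule Λ).FG)
    (hspan : Submodule.span K (Subalgebra.toSubmodule Λ : Set S) = ⊤) {z : S} (hz : z ∈ Λ) :
    ∃ t, rightTrace K S z = algebraMap O K t :=
  ⟨_, trace_eq_of_lattice hfg hspan (LinearMap.mulRight K z)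
    (LinearMap.mulRight O (⟨z, hz⟩ : Λ)) fun _ => rfl⟩

/-- An integral element acts on a left ideal of an order by right multiplication. -/
theorem exists_ideal_of_isIntegral (hp : Irreducible p)
    (hfg : (Subalgebra.toSubmodule Λ).FG)
    (hspan : Submodule.span K (Subalgebra.toSubmodule Λ : Set S) = ⊤)
    (y : S) (hy : IsIntegral O y) :
    ∃ (m : ℕ) (L : Ideal Λ) (_ : algebraMap O Λ p ^ m ∈ L) (f : Module.End Λ L),
      ∀ (b N : O), rightNorm K (y - algebraMap O S b) = algebraMap O K (p * N) →
        ¬ Function.Surjective fun x => f x - b • x := by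
  have hptf : Module.IsTorsionFree O S := Module.IsTorsionFree.trans_faithfulSMul O K S
  let L : Ideal Λ :=
    { carrier := {x | ∀ u ∈ Algebra.adjoin O {y}, (x : S) * u ∈ Λ}
      add_mem' := fun {a b} ha hb u hu => by
        change ((a : S) + b) * u ∈ Λ
        rw [add_mul]; exact Λ.add_mem (ha u hu) (hb u hu)
      zero_mem' := fun u _ => by
        change (0 : S) * u ∈ Λ
        rw [zero_mul]; exact Λ.zero_mem
      smul_mem' := fun b x hx u hu => by
        change ((b : S) * x) * u ∈ Λ
        rw [mul_assoc]; exact Λ.mul_mem b.2 (hx u hu) }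
  obtain ⟨m, hm⟩ := exists_pow_smul_le_of_fg (K := K) hp hspan hy.fg_adjoin_singleton
  have hyadj : y ∈ Algebra.adjoin O {y} := Algebra.self_mem_adjoin_singleton O y
  have hL : algebraMap O Λ p ^ m ∈ L := by
    intro u hu
    have : ((algebraMap O Λ p ^ m : Λ) : S) * u = p ^ m • u := by
      rw [Algebra.smul_def, ← map_pow]; rfl
    rw [this]
    exact hm u hu
  have hLy : ∀ x ∈ L, (x : S) * y ∈ Λ := fun x hx => hx y hyadj
  have hLy' : ∀ (x : Λ) (hx : x ∈ L), (⟨(x : S) * y, hLy x hx⟩ : Λ) ∈ L := by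
    intro x hx u hu
    change (x : S) * y * u ∈ Λ
    rw [mul_assoc]
    exact hx _ (Subalgebra.mul_mem _ hyadj hu)
  let f : Module.End Λ L :=
    { toFun := fun x => ⟨⟨(x.1 : S) * y, hLy x.1 x.2⟩, hLy' x.1 x.2⟩
      map_add' := fun s t => Subtype.ext (Subtype.ext (add_mul (s.1 : S) t.1 y))
      map_smul' := fun s t => Subtype.ext (Subtype.ext (mul_assoc (s : S) t.1 y)) }
  let L' : Submodule O S := (L.restrictScalars O).map Λ.val.toLinearMap
  have hL'mem : ∀ v, v ∈ L' ↔ ∃ h : v ∈ Λ, (⟨v, h⟩ : Λ) ∈ L := by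
    intro v
    constructor
    · rintro ⟨x, hx, rfl⟩
      exact ⟨x.2, hx⟩
    · rintro ⟨h, hx⟩
      exact ⟨_, hx, rfl⟩
  have hL'fg : L'.FG := by
    refine fg_of_smul_mem hfg one_ne_zero fun v hv => ?_
    rw [one_smul]
    exact ((hL'mem v).1 hv).1
  have hL'span : Submodule.span K (L' : Set S) = ⊤ := by
    rw [eq_top_iff, ← hspan, Submodule.span_le]
    intro v hv
    have hv' : v ∈ Λ := hv
    have h1 : p ^ m • v ∈ L' := by
      refine (hL'mem _).2 ⟨Λ.smul_mem hv' _, ?_⟩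
      have : (⟨p ^ m • v, Λ.smul_mem hv' _⟩ : Λ) = ⟨v, hv'⟩ * algebraMap O Λ p ^ m := by
        refine Subtype.ext ?_
        change p ^ m • v = v * algebraMap O S p ^ m
        rw [← map_pow, ← Algebra.commutes, Algebra.smul_def]
      rw [this]
      exact L.mul_mem_left _ hL
    have hpK : algebraMap O K (p ^ m) ≠ 0 := by
      rw [Ne, FaithfulSMul.algebraMap_eq_zero_iff]
      exact pow_ne_zero _ hp.ne_zero
    have h2 : v = (algebraMap O K (p ^ m))⁻¹ • p ^ m • v := by
      rw [← algebraMap_smul K (p ^ m) v, inv_smul_smul₀ hpK]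
    rw [SetLike.mem_coe, h2]
    exact Submodule.smul_mem _ _ (Submodule.subset_span h1)
  refine ⟨m, L, hL, f, fun b N hN hsurj => ?_⟩
  have hg : ∀ v ∈ L', v * (y - algebraMap O S (b)) ∈ L' := by
    intro v hv
    obtain ⟨h, hv⟩ := (hL'mem v).1 hv
    have := (f ⟨_, hv⟩ - b • ⟨_, hv⟩).2
    refine (hL'mem _).2 ⟨?_, ?_⟩
    · rw [mul_sub, ← Algebra.commutes, ← Algebra.smul_def]
      exact Λ.sub_mem (hLy _ hv) (Λ.smul_mem h _)
    · convert this using 1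
      refine Subtype.ext ?_
      change v * (y - algebraMap O S (b)) = v * y - b • v
      rw [mul_sub, ← Algebra.commutes, ← Algebra.smul_def]
  let g : Module.End O L' := (LinearMap.mulRight O (y - algebraMap O S (b))).restrict hg
  have hdet := det_eq_of_lattice (K := K) hL'fg hL'span
    (LinearMap.mulRight K (y - algebraMap O S (b))) g fun _ => rfl
  have h1 : LinearMap.det g = p * N :=
    FaithfulSMul.algebraMap_injective O K (hdet.symm.trans hN)
  have hL'fin : Module.Finite O L' := Module.Finite.iff_fg.2 hL'fg
  refine (not_surjective_iff_not_isUnit_det g).2 ?_ ?_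
  · rw [h1]
    exact fun h => hp.not_isUnit (isUnit_of_mul_isUnit_left h)
  · rintro ⟨v, hv⟩
    obtain ⟨h, hv'⟩ := (hL'mem v).1 hv
    obtain ⟨x, hx⟩ := hsurj ⟨_, hv'⟩
    refine ⟨⟨x.1, (hL'mem _).2 ⟨x.1.2, x.2⟩⟩, Subtype.ext ?_⟩
    have h2 : (x.1 : S) * y - b • (x.1 : S) = v :=
      congrArg (fun t : L => ((t : Λ) : S)) hx
    change (x.1 : S) * (y - algebraMap O S (b)) = v
    rw [mul_sub, ← Algebra.commutes, ← Algebra.smul_def, h2]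

set_option maxHeartbeats 1000000 in
/-- A local order whose reductions have enough elements of large corank is unramified: its trace
form is unimodular. -/
theorem exists_smul_of_rightTrace_mul_mem [FiniteDimensional K S]
    (hS : Subalgebra.center K S = ⊥) (hp : Irreducible p)
    (hfg : (Subalgebra.toSubmodule Λ).FG)
    (hspan : Submodule.span K (Subalgebra.toSubmodule Λ : Set S) = ⊤)
    (hmax : ∀ Ω : Subalgebra O S, (Subalgebra.toSubmodule Ω).FG → Λ ≤ Ω → Ω ≤ Λ)
    {r c : ℕ} (hrc : r * c = Module.finrank K S) (hunit : IsUnit ((r * c : ℕ) : O))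
    (hP1 : ∀ z : S, IsIntegral O z → ∀ N : O, rightNorm K z = algebraMap O K N → p ∣ N →
      p ^ c ∣ N)
    (y : S) (hy : IsIntegral O y) (a : ℕ → O)
    (ha : ∀ j < r, ∀ i < j, IsUnit (a j - a i))
    (hP2 : ∀ i < r, ∃ N, rightNorm K (y - algebraMap O S (a i)) = algebraMap O K (p * N))
    (z : S) (hz : z ∈ Λ)
    (hT : ∀ w ∈ Λ, ∃ t, rightTrace K S (z * w) = algebraMap O K (p * t)) :
    ∃ w ∈ Λ, z = p • w := by
  have hptf : Module.IsTorsionFree O S := Module.IsTorsionFree.trans_faithfulSMul O K S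
  have hfin : Module.Finite O Λ := Module.Finite.iff_fg.2 hfg
  have htf : Module.IsTorsionFree O Λ :=
    inferInstanceAs (Module.IsTorsionFree O (Subalgebra.toSubmodule Λ))
  have hfree : Module.Free O Λ := inferInstance
  have hrank : Module.finrank O Λ = Module.finrank K S := by
    obtain ⟨m, b, c, -⟩ := exists_basis_of_lattice (K := K) hfg hspan
    rw [Module.finrank_eq_card_basis c]
    exact Module.finrank_eq_card_basis b
  obtain ⟨n, hn⟩ := exists_pow_mem_of_not_le (K := K) hS hp hfg hspan
  have hcorank : ∀ w : Λ, ¬ IsUnit (LinearMap.det (LinearMap.mulRight O w)) →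
      p ^ c ∣ LinearMap.det (LinearMap.mulRight O w) := by
    intro w hw
    refine hP1 w ?_ _ (rightNorm_eq_det_of_lattice hfg hspan w) ?_
    · exact (Algebra.IsIntegral.isIntegral (R := O) w).map Λ.val
    · rwa [← mem_nonunits_iff, ← IsLocalRing.mem_maximalIdeal, hp.maximalIdeal_eq,
        Ideal.mem_span_singleton] at hw
  obtain ⟨m, L, hL, f, hf⟩ := exists_ideal_of_isIntegral (K := K) hp hfg hspan y hy
  let X : Ideal Λ :=
    { carrier := {x | ∀ w ∈ Λ, ∃ t, rightTrace K S (x * w) = algebraMap O K (p * t)}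
      add_mem' := fun {s t} hs ht w hw => by
        obtain ⟨u, hu⟩ := hs w hw
        obtain ⟨v, hv⟩ := ht w hw
        refine ⟨u + v, ?_⟩
        change rightTrace K S (((s : S) + t) * w) = _
        rw [add_mul, map_add, hu, hv, mul_add, map_add]
      zero_mem' := fun w _ => ⟨0, by
        change rightTrace K S ((0 : S) * w) = _
        simp⟩
      smul_mem' := fun b x hx w hw => by
        change ∃ t, rightTrace K S ((b : S) * x * w) = _
        rw [mul_assoc, rightTrace_mul_comm, mul_assoc]
        exact hx _ (Λ.mul_mem hw b.2) }
  have hX : X.IsTwoSided := ⟨fun {x} b hx w hw => by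
    change ∃ t, rightTrace K S ((x : S) * b * w) = _
    rw [mul_assoc]
    exact hx _ (Λ.mul_mem b.2 hw)⟩
  have hpX : algebraMap O Λ p ∈ X := by
    intro w hw
    obtain ⟨t, ht⟩ := rightTrace_mem_of_lattice (K := K) hfg hspan hw
    refine ⟨t, ?_⟩
    change rightTrace K S (algebraMap O S p * w) = _
    rw [← Algebra.smul_def, ← algebraMap_smul K, map_smul, ht, map_mul, smul_eq_mul]
  have hX1 : X ≠ ⊤ := by
    intro h
    have h1 : (1 : Λ) ∈ X := h ▸ trivial
    obtain ⟨t, ht⟩ := h1 1 Λ.one_mem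
    have h2 : rightTrace K S (((1 : Λ) : S) * 1) = algebraMap O K ((r * c : ℕ) : O) := by
      rw [mul_one, OneMemClass.coe_one, rightTrace_one, ← hrc, map_natCast]
    have h3 := FaithfulSMul.algebraMap_injective O K (h2.symm.trans ht)
    rw [h3] at hunit
    exact hp.not_isUnit (isUnit_of_mul_isUnit_left hunit)
  have key := le_span_of_ne_top hp
    (exists_eq_mul_of_right_multiplier K hp.ne_zero hfg hmax)
    (exists_eq_mul_of_left_multiplier K hp.ne_zero hfg hmax)
    hn (hrc.trans hrank.symm) hcorank L hL f a ha
    (fun i hi => (hP2 i hi).elim fun N hN => hf _ N hN) X hX hpX hX1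
  have hzX : (⟨z, hz⟩ : Λ) ∈ X := hT
  obtain ⟨w, hw⟩ := Ideal.mem_span_singleton'.1 (key hzX)
  refine ⟨w, w.2, ?_⟩
  have := congrArg Subtype.val hw
  change (w : S) * algebraMap O S p = z at this
  rw [← this, ← Algebra.commutes, Algebra.smul_def]

end LocalOrder

section SimpleReduction

variable {O K S : Type*} [CommRing O] [IsDomain O] [IsDiscreteValuationRing O] [Field K]
  [Algebra O K] [IsFractionRing O K] [Ring S] [Algebra K S] [Algebra O S]
  [IsScalarTower O K S] {p : O} {A : Subalgebra O S}

theorem mem_span_algebraMap_iff {O A : Type*} [CommRing O] [Ring A] [Algebra O A] {p : O} (x : A) :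
    x ∈ Ideal.span {algebraMap O A p} ↔ ∃ y, x = p • y := by
  rw [Ideal.mem_span_singleton']
  refine exists_congr fun y => ?_
  rw [Algebra.smul_def, Algebra.commutes]
  exact eq_comm

/-- The relation between the reductions of an order with simple reduction and its simple modules. -/
theorem exists_isSimpleModule_of_isSimpleRing (hp : Irreducible p)
    {A : Type*} [Ring A] [Algebra O A] [Module.Finite O A] [Module.Free O A]
    [(Ideal.span {algebraMap O A p}).IsTwoSided]
    [IsSimpleRing (A ⧸ Ideal.span {algebraMap O A p})] :
    ∃ (r c : ℕ) (I : Ideal A), IsSimpleModule A (A ⧸ I) ∧ Ideal.span {algebraMap O A p} ≤ I ∧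
      Module.length O (A ⧸ I) = c ∧ r * c = Module.finrank O A ∧
      Nonempty ((A ⧸ Ideal.span {algebraMap O A p}) ≃ₗ[A] (Fin r → A ⧸ I)) ∧
      ∀ (X : Type _) [AddCommGroup X] [Module A X] [Module.Finite A X]
        (_ : ∀ x : X, algebraMap O A p • x = 0), ∃ a : ℕ, Nonempty (X ≃ₗ[A] (Fin a → A ⧸ I)) := by
  let M : Ideal A := Ideal.span {algebraMap O A p}
  have hlen : Module.length O (A ⧸ M) = Module.finrank O A := by
    rw [← length_quotient_range_smul hp.maximalIdeal_eq (M.restrictScalars O)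
      mem_span_algebraMap_iff]
    exact (Submodule.Quotient.restrictScalarsEquiv O M).symm.length_eq
  have hart : IsArtinianRing (A ⧸ M) := by
    have : IsArtinian O (A ⧸ M) := by
      refine isArtinian_of_smul_eq_zero hp.ne_zero fun x => ?_
      obtain ⟨y, rfl⟩ := Ideal.Quotient.mk_surjective x
      refine Ideal.Quotient.eq_zero_iff_mem.2 ?_
      exact (mem_span_algebraMap_iff _).2 ⟨y, rfl⟩
    exact isArtinian_of_tower O this
  have hM : M ≠ ⊤ := by
    intro h
    have : Nontrivial (A ⧸ M) := inferInstance
    rw [h] at this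
    exact not_subsingleton (A ⧸ (⊤ : Ideal A)) inferInstance
  obtain ⟨I, hI, hMI⟩ := Ideal.exists_le_maximal M hM
  have hsimp : IsSimpleModule A (A ⧸ I) := isSimpleModule_iff_isCoatom.2 hI.out
  have hS : Module.IsTorsionBySet A (A ⧸ I) M :=
    (Module.isTorsionBySet_quotient_iff _ _).2 fun x r hr =>
      hMI (Ideal.IsTwoSided.mul_mem_of_left x hr)
  obtain ⟨r, ⟨e⟩⟩ := exists_linearEquiv_fun_of_isTorsionBySet M hS
      (isTorsionBySet_quotient_of_isTwoSided M)
  have hle : Module.length O (A ⧸ I) ≠ ⊤ := by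
    have h1 : Module.length O (A ⧸ I) ≤ Module.length O (A ⧸ M) :=
      Module.length_le_of_surjective ((Submodule.factor hMI).restrictScalars O)
        (Submodule.factor_surjective hMI)
    rw [hlen] at h1
    exact ne_top_of_le_ne_top (ENat.natCast_ne_top _) h1
  obtain ⟨c, hc⟩ := ENat.ne_top_iff_exists.1 hle
  refine ⟨r, c, I, hsimp, hMI, hc.symm, ?_, ⟨e⟩, fun X _ _ _ hX => ?_⟩
  · have := (e.restrictScalars O).length_eq
    rw [hlen, Module.length_pi, ← hc] at this
    simp only [Fintype.card_fin, ENat.card_eq_coe_fintype_card] at this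
    exact_mod_cast this.symm
  · refine exists_linearEquiv_fun_of_isTorsionBySet M hS fun x m => ?_
    obtain ⟨y, hy⟩ := Ideal.mem_span_singleton'.1 m.2
    change (m : A) • x = 0
    rw [← hy, mul_smul, hX, smul_zero]

set_option maxHeartbeats 1000000 in
theorem exists_norm_data_of_isSimpleRing [FiniteDimensional K S] (hp : Irreducible p)
    (hfg : (Subalgebra.toSubmodule A).FG)
    (hspan : Submodule.span K (Subalgebra.toSubmodule A : Set S) = ⊤)
    [(Ideal.span {algebraMap O A p}).IsTwoSided]
    [IsSimpleRing (A ⧸ Ideal.span {algebraMap O A p})] :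
    ∃ r c : ℕ, r * c = Module.finrank K S ∧
      (∀ z : S, IsIntegral O z → ∀ N : O, rightNorm K z = algebraMap O K N → p ∣ N →
        p ^ c ∣ N) ∧
      ∀ a : ℕ → O, ∃ y : S, IsIntegral O y ∧
        ∀ i < r, ∃ N, rightNorm K (y - algebraMap O S (a i)) = algebraMap O K (p * N) := by
  have hptf : Module.IsTorsionFree O S := Module.IsTorsionFree.trans_faithfulSMul O K S
  have hfin : Module.Finite O A := Module.Finite.iff_fg.2 hfg
  have htf : Module.IsTorsionFree O A :=
    inferInstanceAs (Module.IsTorsionFree O (Subalgebra.toSubmodule A))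
  have hfree : Module.Free O A := inferInstance
  have hrank : Module.finrank O A = Module.finrank K S := by
    obtain ⟨m, b, c, -⟩ := exists_basis_of_lattice (K := K) hfg hspan
    rw [Module.finrank_eq_card_basis c]
    exact Module.finrank_eq_card_basis b
  obtain ⟨r, c, I, hI, hpI, hc, hrc, ⟨e⟩, hX⟩ := exists_isSimpleModule_of_isSimpleRing hp (A := A)
  have hnt : Nontrivial (A ⧸ I) := IsSimpleModule.nontrivial A _
  refine ⟨r, c, hrc.trans hrank, fun z hz N hN hpN => ?_, fun a => ?_⟩
  · let B := Algebra.adjoin O {z}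
    let N₀ : Submodule A S := Submodule.span A (B : Set S)
    have hzB : z ∈ B := Algebra.self_mem_adjoin_singleton O z
    have hmul : ∀ v ∈ N₀, v * z ∈ N₀ := by
      intro v hv
      induction hv using Submodule.span_induction with
      | mem x hx => exact Submodule.subset_span (B.mul_mem hx hzB)
      | zero => rw [zero_mul]; exact N₀.zero_mem
      | add x y _ _ hx hy => rw [add_mul]; exact N₀.add_mem hx hy
      | smul u x _ hx => rw [smul_mul_assoc]; exact N₀.smul_mem u hx
    have hfg₀ : (N₀.restrictScalars O).FG := by
      obtain ⟨s, hs⟩ := hz.fg_adjoin_singleton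
      have hN₀ : N₀ = Submodule.span A (s : Set S) := by
        refine le_antisymm (Submodule.span_le.2 fun v hv => ?_)
          (Submodule.span_mono fun v hv => ?_)
        · have : v ∈ Submodule.span O (s : Set S) := by rw [hs]; exact hv
          exact Submodule.span_le_restrictScalars O A _ this
        · have : v ∈ Submodule.span O (s : Set S) := Submodule.subset_span hv
          rwa [hs] at this
      have : Module.Finite A N₀ := Module.Finite.iff_fg.2 ⟨s, hN₀.symm⟩
      have : Module.Finite O N₀ := Module.Finite.trans A N₀
      exact Module.Finite.iff_fg.1 this
    have hspan₀ : Submodule.span K (N₀.restrictScalars O : Set S) = ⊤ := by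
      rw [eq_top_iff, ← hspan]
      refine Submodule.span_mono fun v hv => ?_
      have : v = (⟨v, hv⟩ : A) • (1 : S) := (mul_one v).symm
      rw [this]
      exact N₀.smul_mem _ (Submodule.subset_span B.one_mem)
    let g : Module.End A N₀ :=
      { toFun := fun v => ⟨v * z, hmul v v.2⟩
        map_add' := fun s t => Subtype.ext (add_mul _ _ _)
        map_smul' := fun s t => Subtype.ext (smul_mul_assoc _ _ _) }
    have hdet := det_eq_of_lattice (K := K) hfg₀ hspan₀ (LinearMap.mulRight K z)
      (g.restrictScalars O) fun _ => rfl
    have hN' : N = LinearMap.det (g.restrictScalars O) :=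
      FaithfulSMul.algebraMap_injective O K (hN.symm.trans hdet)
    have hfin₀ : Module.Finite O N₀ := Module.Finite.iff_fg.2 hfg₀
    have htf₀ : Module.IsTorsionFree O N₀ :=
      inferInstanceAs (Module.IsTorsionFree O (N₀.restrictScalars O))
    have hfree₀ : Module.Free O N₀ := inferInstance
    let h : N₀ →ₗ[A] N₀ :=
      { toFun := fun v => p • v
        map_add' := fun _ _ => smul_add _ _ _
        map_smul' := fun s t => smul_comm _ _ _ }
    let Y : Submodule A N₀ := LinearMap.range h ⊔ LinearMap.range g
    have hY : ∀ x, x ∈ Y.restrictScalars O ↔ ∃ y w, x = p • y + g.restrictScalars O w := by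
      intro x
      rw [Submodule.restrictScalars_mem, Submodule.mem_sup]
      constructor
      · rintro ⟨_, ⟨y, rfl⟩, _, ⟨w, rfl⟩, rfl⟩
        exact ⟨y, w, rfl⟩
      · rintro ⟨y, w, rfl⟩
        exact ⟨_, ⟨y, rfl⟩, _, ⟨w, rfl⟩, rfl⟩
    have hYtop : Y ≠ ⊤ := by
      intro hYtop
      have hsurj : LinearMap.range (g.restrictScalars O) = ⊤ := by
        refine eq_top_iff.2 (Submodule.le_of_le_smul_of_le_jacobson_bot
          (I := IsLocalRing.maximalIdeal O) Module.Finite.fg_top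
          (IsLocalRing.maximalIdeal_le_jacobson _) fun x _ => ?_)
        obtain ⟨y, w, rfl⟩ := (hY x).1 (by rw [hYtop]; trivial)
        rw [add_comm]
        refine Submodule.add_mem_sup ⟨w, rfl⟩ (Submodule.smul_mem_smul ?_ trivial)
        rw [hp.maximalIdeal_eq]
        exact Ideal.mem_span_singleton_self p
      refine (not_surjective_iff_not_isUnit_det (g.restrictScalars O)).2 ?_
        (LinearMap.range_eq_top.1 hsurj)
      rw [← hN']
      exact fun hu => hp.not_isUnit (isUnit_of_dvd_unit hpN hu)
    have hfinA : Module.Finite A N₀ := Module.Finite.of_restrictScalars_finite O A N₀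
    obtain ⟨m, ⟨e'⟩⟩ := hX (N₀ ⧸ Y) fun x => by
      obtain ⟨x, rfl⟩ := Submodule.mkQ_surjective _ x
      refine (Submodule.Quotient.mk_eq_zero Y).2 ?_
      refine Submodule.mem_sup_left ⟨x, ?_⟩
      exact (algebraMap_smul A p x).symm
    rw [hN']
    refine pow_dvd_det_of_le_length hp.maximalIdeal_eq _ _ hY ?_
    rw [(Submodule.Quotient.restrictScalarsEquiv O Y).length_eq,
      (e'.restrictScalars O).length_eq, Module.length_pi, hc]
    have hm : m ≠ 0 := by
      rintro rfl
      have : Subsingleton (N₀ ⧸ Y) := e'.toEquiv.subsingleton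
      exact hYtop (Submodule.Quotient.subsingleton_iff.1 this)
    simp only [ENat.card_eq_coe_fintype_card, Fintype.card_fin]
    exact_mod_cast Nat.le_mul_of_pos_left c (Nat.pos_of_ne_zero hm)
  · let d : (Fin r → A ⧸ I) →ₗ[A] (Fin r → A ⧸ I) :=
      { toFun := fun v i => a i • v i
        map_add' := fun s t => funext fun i => smul_add _ _ _
        map_smul' := fun s t => funext fun i => smul_comm (a i) s (t i) }
    obtain ⟨y, hy⟩ := Submodule.mkQ_surjective _ (e.symm (d (e (Submodule.Quotient.mk 1))))
    refine ⟨y, (Algebra.IsIntegral.isIntegral (R := O) y).map A.val, fun i hi => ?_⟩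
    have hdet := det_eq_of_lattice (K := K) hfg hspan
      (LinearMap.mulRight K ((y : S) - algebraMap O S (a i)))
      (LinearMap.mulRight O (y - algebraMap O A (a i))) fun _ => rfl
    have hns : ¬ Function.Surjective (LinearMap.mulRight O (y - algebraMap O A (a i))) := by
      intro hsurj
      obtain ⟨v, hv⟩ := exists_ne (0 : A ⧸ I)
      obtain ⟨x, hx⟩ := Submodule.mkQ_surjective _ (e.symm (Pi.single ⟨i, hi⟩ v))
      obtain ⟨w, hw⟩ := hsurj x
      apply hv
      have h1 : e (Submodule.mkQ _ (w * y)) = d (e (Submodule.mkQ _ w)) := by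
        have h2 : Submodule.mkQ (Ideal.span {algebraMap O A p}) (w * y) =
          w • Submodule.mkQ _ y := rfl
        have h3 : Submodule.mkQ (Ideal.span {algebraMap O A p}) w =
          w • Submodule.mkQ _ 1 := by rw [← map_smul, smul_eq_mul, mul_one]
        rw [h2, hy, h3, map_smul, LinearEquiv.apply_symm_apply, map_smul, map_smul]
        rfl
      have h4 : e (Submodule.mkQ _ x) ⟨i, hi⟩ = v := by
        rw [hx, LinearEquiv.apply_symm_apply]
        exact Pi.single_eq_same (M := fun _ => A ⧸ I) _ _
      have h5 : w * y - a i • w = x := by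
        rw [← hw, LinearMap.mulRight_apply, mul_sub, ← Algebra.commutes, ← Algebra.smul_def]
      have h6 : e (Submodule.mkQ _ (a i • w)) = algebraMap O A (a i) • e (Submodule.mkQ _ w) := by
        rw [← algebraMap_smul A, map_smul, map_smul]
      rw [← h4, ← h5, map_sub, map_sub, h1, h6, Pi.sub_apply, Pi.smul_apply, algebraMap_smul]
      exact sub_self _
    rw [not_surjective_iff_not_isUnit_det, ← mem_nonunits_iff, ← IsLocalRing.mem_maximalIdeal,
      hp.maximalIdeal_eq, Ideal.mem_span_singleton] at hns
    obtain ⟨N, hN⟩ := hns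
    exact ⟨N, by rw [← hN, ← hdet]; rfl⟩

end SimpleReduction

section ConstantOrder

variable {k O K D : Type*} [Field k] [CommRing O] [Algebra k O] [Field K] [Algebra O K]
  [Algebra k K] [IsScalarTower k O K] [DivisionRing D] [Algebra k D]

/-- Base change of scalars of a constant algebra. -/
def baseChangeMap (k O K D : Type*) [Field k] [CommRing O] [Algebra k O] [CommRing K] [Algebra O K]
    [Algebra k K] [IsScalarTower k O K] [Ring D] [Algebra k D] : O ⊗[k] D →ₐ[O] K ⊗[k] D :=
  Algebra.TensorProduct.map (Algebra.ofId O K) (AlgHom.id k D)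

theorem basis_repr_baseChangeMap {ι : Type*} (b : Module.Basis ι k D) (x : O ⊗[k] D) (i : ι) :
    (Algebra.TensorProduct.basis K b).repr (baseChangeMap k O K D x) i =
      algebraMap O K ((Algebra.TensorProduct.basis O b).repr x i) := by
  induction x with
  | zero => simp
  | add x y hx hy => simp [hx, hy]
  | tmul x y =>
    rw [baseChangeMap, Algebra.TensorProduct.map_tmul, Algebra.TensorProduct.basis_repr_tmul,
      Algebra.TensorProduct.basis_repr_tmul]
    simp [Algebra.ofId_apply, ← IsScalarTower.algebraMap_apply, Algebra.smul_def]

theorem baseChangeMap_injective (h : Function.Injective (algebraMap O K)) :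
    Function.Injective (baseChangeMap k O K D) := by
  refine (injective_iff_map_eq_zero _).2 fun x hx => ?_
  let b := Module.Free.chooseBasis k D
  refine (Algebra.TensorProduct.basis O b).repr.injective (Finsupp.ext fun i => ?_)
  apply h
  rw [← basis_repr_baseChangeMap, hx]
  simp

theorem baseChangeMap_surjective (h : Function.Surjective (algebraMap O K)) :
    Function.Surjective (baseChangeMap k O K D) := by
  intro x
  induction x with
  | zero => exact ⟨0, map_zero _⟩
  | add x y hx hy =>
    obtain ⟨x, rfl⟩ := hx
    obtain ⟨y, rfl⟩ := hy
    exact ⟨x + y, map_add _ _ _⟩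
  | tmul x y =>
    obtain ⟨x, rfl⟩ := h x
    exact ⟨x ⊗ₜ y, rfl⟩

theorem baseChangeMap_eq_zero_iff {p : O} (h : ∀ x, algebraMap O K x = 0 ↔ p ∣ x)
    (x : O ⊗[k] D) : baseChangeMap k O K D x = 0 ↔ ∃ y, x = p • y := by
  constructor
  · intro hx
    let b := Module.Free.chooseBasis k D
    have h1 (i) : p ∣ (Algebra.TensorProduct.basis O b).repr x i := by
      rw [← h, ← basis_repr_baseChangeMap, hx]
      simp
    choose d hd using h1
    refine ⟨∑ i ∈ ((Algebra.TensorProduct.basis O b).repr x).support,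
      d i • Algebra.TensorProduct.basis O b i, ?_⟩
    rw [Finset.smul_sum]
    conv_lhs => rw [← (Algebra.TensorProduct.basis O b).linearCombination_repr x]
    rw [Finsupp.linearCombination_apply, Finsupp.sum]
    exact Finset.sum_congr rfl fun i _ => by rw [smul_smul, ← hd]
  · rintro ⟨y, rfl⟩
    rw [map_smul, ← algebraMap_smul K p, (h p).2 dvd_rfl, zero_smul]

/-- The constant order in `K ⊗ D`. -/
def constantOrder (k O K D : Type*) [Field k] [CommRing O] [Algebra k O] [CommRing K] [Algebra O K]
    [Algebra k K] [IsScalarTower k O K] [Ring D] [Algebra k D] : Subalgebra O (K ⊗[k] D) :=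
  (baseChangeMap k O K D).range

theorem constantOrder_fg [FiniteDimensional k D] :
    (Subalgebra.toSubmodule (constantOrder k O K D)).FG := by
  have : (LinearMap.range (baseChangeMap k O K D).toLinearMap).FG := by
    rw [LinearMap.range_eq_map]
    exact Module.Finite.fg_top.map _
  exact this

theorem span_constantOrder :
    Submodule.span K (Subalgebra.toSubmodule (constantOrder k O K D) : Set (K ⊗[k] D)) = ⊤ := by
  refine eq_top_iff.2 fun x _ => ?_
  induction x with
  | zero => exact Submodule.zero_mem _
  | add x y hx hy => exact Submodule.add_mem _ (hx trivial) (hy trivial)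
  | tmul x y =>
    have : x ⊗ₜ[k] y = x • ((1 : K) ⊗ₜ[k] y) := by
      rw [TensorProduct.smul_tmul', smul_eq_mul, mul_one]
    rw [this]
    refine Submodule.smul_mem _ _ (Submodule.subset_span ⟨1 ⊗ₜ y, ?_⟩)
    simp [baseChangeMap]

theorem exists_norm_data_tensorProduct [FiniteDimensional k D] [IsDomain O]
    [IsDiscreteValuationRing O]
    [IsFractionRing O K] (hD : Subalgebra.center k D = ⊥) {p : O} (hp : Irreducible p) :
    ∃ r c : ℕ, r * c = Module.finrank k D ∧
      (∀ z : K ⊗[k] D, IsIntegral O z → ∀ N : O, rightNorm K z = algebraMap O K N → p ∣ N →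
        p ^ c ∣ N) ∧
      ∀ a : ℕ → O, ∃ y : K ⊗[k] D, IsIntegral O y ∧
        ∀ i < r, ∃ N, rightNorm K (y - algebraMap O _ (a i)) = algebraMap O K (p * N) := by
  let κ := IsLocalRing.ResidueField O
  have : IsScalarTower k O κ := IsScalarTower.of_algebraMap_eq fun _ => rfl
  have hκ (x : O) : algebraMap O κ x = 0 ↔ p ∣ x := by
    rw [← Ideal.mem_span_singleton, ← hp.maximalIdeal_eq]
    exact IsLocalRing.residue_eq_zero_iff x
  let A := constantOrder k O K D
  let e : O ⊗[k] D ≃ₐ[O] A := AlgEquiv.ofInjective _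
    (baseChangeMap_injective (FaithfulSMul.algebraMap_injective O K))
  let π : A →+* κ ⊗[k] D := (baseChangeMap k O κ D : O ⊗[k] D →+* κ ⊗[k] D).comp
    (e.symm : A →+* O ⊗[k] D)
  have hπ : Function.Surjective π :=
    (baseChangeMap_surjective IsLocalRing.residue_surjective).comp e.symm.surjective
  have hker : RingHom.ker π = Ideal.span {algebraMap O A p} := by
    ext x
    rw [mem_span_algebraMap_iff, RingHom.mem_ker]
    refine (baseChangeMap_eq_zero_iff hκ (e.symm x)).trans ⟨?_, ?_⟩
    · rintro ⟨y, hy⟩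
      exact ⟨e y, by rw [← map_smul, ← hy, e.apply_symm_apply]⟩
    · rintro ⟨y, rfl⟩
      exact ⟨e.symm y, map_smul _ _ _⟩
  have h2 : (Ideal.span {algebraMap O A p}).IsTwoSided := hker ▸ inferInstance
  have h3 : IsSimpleRing (A ⧸ Ideal.span {algebraMap O A p}) :=
    IsSimpleRing.of_ringEquiv ((RingHom.quotientKerEquivOfSurjective hπ).symm.trans
      (Ideal.quotEquivOfEq hker)) (isSimpleRing_tensorProduct κ hD)
  have := exists_norm_data_of_isSimpleRing (K := K) hp (A := A) constantOrder_fg span_constantOrder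
  rwa [Module.finrank_baseChange] at this

end ConstantOrder

section RationalPlace

variable {k K D Γ : Type*} [Field k] [Field K] [Algebra k K] [DivisionRing D] [Algebra k D]
  [LinearOrderedCommGroupWithZero Γ] {v : Valuation K Γ}

/-- The maximal ideal of the valuation ring. -/
def integerIdeal (v : Valuation K Γ) : Ideal v.integer where
  carrier := {x | v x < 1}
  add_mem' := fun {a b} ha hb => v.map_add_lt ha hb
  zero_mem' := by
    change v (0 : K) < 1
    rw [map_zero]
    exact zero_lt_one
  smul_mem' := fun a x hx => by
    change v ((a : K) * x) < 1
    rw [map_mul]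
    exact (mul_le_mul_left (show v (a : K) ≤ 1 from a.2) _).trans_lt (by rwa [one_mul])

theorem toMatrix_mulRight_tensorProduct {ι : Type*} [Fintype ι] [DecidableEq ι]
    (b : Module.Basis ι k D) (z : K ⊗[k] D) (i j : ι) :
    LinearMap.toMatrix (Algebra.TensorProduct.basis K b) (Algebra.TensorProduct.basis K b)
        (LinearMap.mulRight K z) i j =
      ∑ l, (Algebra.TensorProduct.basis K b).repr z l *
        algebraMap k K (LinearMap.toMatrix b b (LinearMap.mulRight k (b l)) i j) := by
  conv_lhs => rw [← (Algebra.TensorProduct.basis K b).sum_repr z]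
  rw [LinearMap.toMatrix_apply, LinearMap.mulRight_apply, Finset.mul_sum, map_sum,
    Finsupp.finsetSum_apply]
  refine Finset.sum_congr rfl fun l _ => ?_
  rw [mul_smul_comm, map_smul, Finsupp.smul_apply, smul_eq_mul, Algebra.TensorProduct.basis_apply,
    Algebra.TensorProduct.basis_apply, Algebra.TensorProduct.tmul_mul_tmul, one_mul,
    Algebra.TensorProduct.basis_repr_tmul, LinearMap.toMatrix_apply, LinearMap.mulRight_apply]
  simp

variable {ι : Type*} [Fintype ι] [DecidableEq ι] (b : Module.Basis ι k D)

theorem valuation_toMatrix_mulRight_le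
    (hv : ∀ c : k, v (algebraMap k K c) ≤ 1) {z : K ⊗[k] D} {γ : Γ}
    (hz : ∀ i, v ((Algebra.TensorProduct.basis K b).repr z i) ≤ γ) (i j : ι) :
    v (LinearMap.toMatrix (Algebra.TensorProduct.basis K b) (Algebra.TensorProduct.basis K b)
        (LinearMap.mulRight K z) i j) ≤ γ := by
  rw [toMatrix_mulRight_tensorProduct]
  refine v.map_sum_le fun l _ => ?_
  rw [map_mul]
  exact (mul_le_mul' (hz l) (hv _)).trans (mul_one _).le

theorem valuation_rightNorm_le
    (hv : ∀ c : k, v (algebraMap k K c) ≤ 1) {z : K ⊗[k] D}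
    (hz : ∀ i, v ((Algebra.TensorProduct.basis K b).repr z i) ≤ 1) :
    v (rightNorm K z) ≤ 1 := by
  rw [rightNorm, ← LinearMap.det_toMatrix (Algebra.TensorProduct.basis K b), Matrix.det_apply]
  refine v.map_sum_le fun σ _ => ?_
  rw [Units.smul_def, zsmul_eq_mul, map_mul, map_prod]
  refine mul_le_one' (show _ ∈ v.integer from intCast_mem _ _) (Finset.prod_le_one' fun l _ => ?_)
  exact valuation_toMatrix_mulRight_le b hv hz _ _

theorem valuation_rightNorm_eq_one
    (hv : ∀ c : k, v (algebraMap k K c) ≤ 1) {z : K ⊗[k] D}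
    (hres : ∀ f, v f ≤ 1 → ∃ c : k, v (f - algebraMap k K c) < 1)
    (hz : ∀ i, v ((Algebra.TensorProduct.basis K b).repr z i) ≤ 1)
    (i₀ : ι) (hi₀ : v ((Algebra.TensorProduct.basis K b).repr z i₀) = 1) :
    v (rightNorm K z) = 1 := by
  refine (valuation_rightNorm_le b hv hz).eq_of_not_lt fun hlt => ?_
  choose c hc using fun i => hres _ (hz i)
  let M : Matrix ι ι v.integer := fun i j => ⟨_, valuation_toMatrix_mulRight_le b hv hz i j⟩
  let q := Ideal.Quotient.mk (integerIdeal v)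
  have hnt : Nontrivial (v.integer ⧸ integerIdeal v) := by
    refine Ideal.Quotient.nontrivial_iff.2 fun h => ?_
    have : (1 : v.integer) ∈ integerIdeal v := h ▸ trivial
    have : v (1 : K) < 1 := this
    exact absurd this (by simp)
  let j : k →+* v.integer := (algebraMap k K).codRestrict _ hv
  let w : D := ∑ i, c i • b i
  have hw : w ≠ 0 := by
    intro h
    have h1 := Fintype.linearIndependent_iff.1 b.linearIndependent c h i₀
    have h2 := hc i₀
    rw [h1, map_zero, sub_zero, hi₀] at h2
    exact lt_irrefl _ h2
  have hdet : M.det ∈ integerIdeal v := by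
    change v (M.det : K) < 1
    convert hlt
    rw [rightNorm, ← LinearMap.det_toMatrix (Algebra.TensorProduct.basis K b)]
    exact RingHom.map_det v.integer.subtype M
  have hM : q.mapMatrix M =
      (q.comp j).mapMatrix (LinearMap.toMatrix b b (LinearMap.mulRight k w)) := by
    ext i l
    refine (Ideal.Quotient.eq (I := integerIdeal v)).2 ?_
    change v (LinearMap.toMatrix _ _ _ i l - algebraMap k K _) < 1
    have h3 : LinearMap.toMatrix b b (LinearMap.mulRight k w) i l =
        ∑ s, c s * LinearMap.toMatrix b b (LinearMap.mulRight k (b s)) i l := by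
      rw [LinearMap.toMatrix_apply, LinearMap.mulRight_apply, Finset.mul_sum, map_sum,
        Finsupp.finsetSum_apply]
      refine Finset.sum_congr rfl fun s _ => ?_
      rw [mul_smul_comm, map_smul, Finsupp.smul_apply, smul_eq_mul, LinearMap.toMatrix_apply]
      rfl
    rw [toMatrix_mulRight_tensorProduct, h3, map_sum, ← Finset.sum_sub_distrib]
    refine v.map_sum_lt one_ne_zero fun s _ => ?_
    rw [map_mul, ← sub_mul, map_mul]
    exact mul_lt_one_of_lt_of_le (hc s) (hv _)
  have h4 := Ideal.Quotient.eq_zero_iff_mem.2 hdet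
  change q M.det = 0 at h4
  rw [RingHom.map_det, hM, ← RingHom.map_det, map_eq_zero, LinearMap.det_toMatrix] at h4
  have : FiniteDimensional k D := Module.Finite.of_basis b
  exact rightNorm_ne_zero hw h4

theorem exists_valuation_rightNorm_eq
    (hv : ∀ c : k, v (algebraMap k K c) ≤ 1) {x : K} (hx : ∀ f, f ≠ 0 → ∃ m : ℤ, v f = v x ^ m)
    (hres : ∀ f, v f ≤ 1 → ∃ c : k, v (f - algebraMap k K c) < 1)
    {z : K ⊗[k] D} (hz : z ≠ 0) :
    ∃ m : ℤ, v (rightNorm K z) = v x ^ (m * Module.finrank k D) ∧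
      ∀ i, v ((Algebra.TensorProduct.basis K b).repr z i) ≤ v x ^ m := by
  let B := Algebra.TensorProduct.basis K b
  have : FiniteDimensional k D := Module.Finite.of_basis b
  have hne : Nonempty ι := by
    by_contra h
    have := not_nonempty_iff.1 h
    exact hz (B.repr.injective (Subsingleton.elim _ _))
  obtain ⟨i₀, hi₀⟩ := Finite.exists_max fun i => v (B.repr z i)
  have h0 : B.repr z i₀ ≠ 0 := by
    intro h
    refine hz (B.repr.injective (Finsupp.ext fun i => ?_))
    have := hi₀ i
    rw [h, map_zero] at this
    rw [map_zero, Finsupp.zero_apply]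
    exact v.zero_iff.1 (le_zero_iff.1 this)
  obtain ⟨m, hm⟩ := hx _ h0
  refine ⟨m, ?_, fun i => hm ▸ hi₀ i⟩
  let f := B.repr z i₀
  have hvf : v f ≠ 0 := v.ne_zero_iff.2 h0
  have h1 : z = algebraMap K _ f * (f⁻¹ • z) := by
    rw [← Algebra.smul_def, smul_inv_smul₀ h0]
  have h2 : v (rightNorm K (f⁻¹ • z)) = 1 := by
    refine valuation_rightNorm_eq_one b hv hres (fun i => ?_) i₀ ?_
    · rw [map_smul, Finsupp.smul_apply, smul_eq_mul, map_mul, map_inv₀]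
      exact (mul_le_mul_right (hi₀ i) _).trans (inv_mul_cancel₀ hvf).le
    · rw [map_smul, Finsupp.smul_apply, smul_eq_mul, map_mul, map_inv₀]
      exact inv_mul_cancel₀ hvf
  rw [h1, rightNorm_mul, rightNorm_algebraMap, map_mul, h2, mul_one, map_pow,
    Module.finrank_baseChange, zpow_mul, zpow_natCast]
  exact congrArg (· ^ _) hm

end RationalPlace

section InftyPlace

open scoped Classical in
/-- The valuation at infinity, with classical decidable equality. -/
noncomputable abbrev inftyVal (k : Type*) [Field k] :
    Valuation (RatFunc k) (WithZero (Multiplicative ℤ)) :=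
  RatFunc.inftyValuation k

open scoped Classical

variable {k : Type*} [Field k]

theorem inftyVal_polynomial {p : Polynomial k} (hp : p ≠ 0) :
    inftyVal k (algebraMap (Polynomial k) (RatFunc k) p) = WithZero.exp (p.natDegree : ℤ) :=
  RatFunc.inftyValuation.polynomial k hp

theorem inftyValuation_algebraMap_le_one (c : k) :
    inftyVal k (algebraMap k (RatFunc k) c) ≤ 1 := by
  by_cases hc : c = 0
  · simp [hc]
  · rw [RatFunc.algebraMap_eq_C]
    exact (RatFunc.inftyValuation.C k hc).le

theorem inftyValuation_algebraMap_eq_one {c : k} (hc : c ≠ 0) :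
    inftyVal k (algebraMap k (RatFunc k) c) = 1 := by
  rw [RatFunc.algebraMap_eq_C]
  exact RatFunc.inftyValuation.C k hc

theorem one_lt_inftyValuation_X : 1 < inftyVal k RatFunc.X := by
  rw [inftyVal, RatFunc.inftyValuation.X, ← WithZero.exp_zero, WithZero.exp_lt_exp]
  exact one_pos

theorem exists_inftyValuation_eq_zpow {f : RatFunc k} (hf : f ≠ 0) :
    ∃ m : ℤ, inftyVal k f = inftyVal k RatFunc.X ^ m := by
  refine ⟨f.intDegree, ?_⟩
  rw [inftyVal, RatFunc.inftyValuation.X, ← WithZero.exp_zsmul, RatFunc.inftyValuation_apply,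
    RatFunc.inftyValuation_of_nonzero k hf]
  simp

theorem exists_inftyValuation_sub_lt_one {f : RatFunc k} (hf : inftyVal k f ≤ 1) :
    ∃ c : k, inftyVal k (f - algebraMap k (RatFunc k) c) < 1 := by
  have key (q : RatFunc k) (hq : q ≠ 0) : inftyVal k q =
      WithZero.exp q.intDegree := by
    rw [RatFunc.inftyValuation_apply, RatFunc.inftyValuation_of_nonzero k hq]
  have hpoly (p : Polynomial k) (n : ℕ) (hp : p.degree < n) :
      inftyVal k (algebraMap (Polynomial k) (RatFunc k) p) <
        WithZero.exp (n : ℤ) := by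
    by_cases h : p = 0
    · simp [h]
    · rw [inftyVal_polynomial h, WithZero.exp_lt_exp]
      exact_mod_cast (Polynomial.natDegree_lt_iff_degree_lt h).2 hp
  by_cases h0 : f = 0
  · exact ⟨0, by simp [h0]⟩
  have hd : f.denom ≠ 0 := f.denom_ne_zero
  have hd' : algebraMap (Polynomial k) (RatFunc k) f.denom ≠ 0 := by
    simpa using hd
  have hvd := inftyVal_polynomial hd
  have hdeg : f.num.natDegree ≤ f.denom.natDegree := by
    rw [key f h0, ← WithZero.exp_zero, WithZero.exp_le_exp, RatFunc.intDegree] at hf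
    omega
  let c := f.num.coeff f.denom.natDegree
  refine ⟨c, ?_⟩
  have hlt : (f.num - Polynomial.C c * f.denom).degree < f.denom.natDegree := by
    rw [Polynomial.degree_lt_iff_coeff_zero]
    intro m hm
    rcases hm.eq_or_lt with rfl | hm
    · simp [c, (RatFunc.monic_denom f)]
    · rw [Polynomial.coeff_sub, Polynomial.coeff_C_mul,
        Polynomial.coeff_eq_zero_of_natDegree_lt (hdeg.trans_lt hm),
        Polynomial.coeff_eq_zero_of_natDegree_lt hm, mul_zero, sub_zero]
  have heq : f - algebraMap k (RatFunc k) c =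
      algebraMap (Polynomial k) (RatFunc k) (f.num - Polynomial.C c * f.denom) /
        algebraMap (Polynomial k) (RatFunc k) f.denom := by
    rw [map_sub, map_mul, sub_div, mul_div_cancel_right₀ _ hd', RatFunc.num_div_denom,
      RatFunc.algebraMap_C, RatFunc.algebraMap_eq_C]
  rw [heq, map_div₀, hvd]
  have := hpoly _ _ hlt
  rw [div_lt_one₀ (WithZero.exp_pos)]
  exact this

theorem exists_eq_C_of_inftyValuation_le_one {p : Polynomial k}
    (hp : inftyVal k (algebraMap (Polynomial k) (RatFunc k) p) ≤ 1) :
    ∃ c, p = Polynomial.C c := by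
  by_cases h : p = 0
  · exact ⟨0, by simp [h]⟩
  rw [inftyVal_polynomial h, ← WithZero.exp_zero, WithZero.exp_le_exp] at hp
  exact ⟨_, Polynomial.eq_C_of_natDegree_eq_zero (by omega)⟩

theorem one_le_inftyValuation_algebraMap {p : Polynomial k} (hp : p ≠ 0) :
    1 ≤ inftyVal k (algebraMap (Polynomial k) (RatFunc k) p) := by
  rw [inftyVal_polynomial hp, ← WithZero.exp_zero, WithZero.exp_le_exp]
  omega

end InftyPlace

section ConstantDivisionAlgebra

variable {k D : Type*} [Field k] [DivisionRing D] [Algebra k D] [FiniteDimensional k D]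

theorem exists_inftyValuation_rightNorm_eq {z : RatFunc k ⊗[k] D} (hz : z ≠ 0) :
    ∃ m : ℤ, inftyVal k (rightNorm (RatFunc k) z) =
        inftyVal k RatFunc.X ^ (m * Module.finrank k D) ∧
      ∀ i, inftyVal k
        ((Algebra.TensorProduct.basis (RatFunc k) (Module.finBasis k D)).repr z i) ≤
          inftyVal k RatFunc.X ^ m :=
  exists_valuation_rightNorm_eq _ inftyValuation_algebraMap_le_one
    (fun _ => exists_inftyValuation_eq_zpow) (fun _ => exists_inftyValuation_sub_lt_one) hz

theorem rightNorm_ratFunc_tensorProduct_ne_zero {z : RatFunc k ⊗[k] D} (hz : z ≠ 0) :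
    rightNorm (RatFunc k) z ≠ 0 := by
  obtain ⟨m, hm, -⟩ := exists_inftyValuation_rightNorm_eq hz
  intro h
  rw [h, map_zero] at hm
  exact zpow_ne_zero _ (zero_lt_one.trans one_lt_inftyValuation_X).ne' hm.symm

theorem isUnit_of_ne_zero_ratFunc_tensorProduct {z : RatFunc k ⊗[k] D} (hz : z ≠ 0) :
    IsUnit z := by
  have : FiniteDimensional (RatFunc k) (RatFunc k ⊗[k] D) := inferInstance
  have hz' := rightNorm_ratFunc_tensorProduct_ne_zero hz
  have : IsUnit (LinearMap.mulRight (RatFunc k) z) := by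
    rw [LinearMap.isUnit_iff_isUnit_det]
    exact isUnit_iff_ne_zero.2 hz'
  obtain ⟨w, hw⟩ := ((Module.End.isUnit_iff _).1 this).2 1
  have hw' : w * z = 1 := hw
  have : z * w = 1 := by
    have h1 : (z * w - 1) * z = 0 := by
      rw [sub_mul, mul_assoc, hw', mul_one, one_mul, sub_self]
    exact sub_eq_zero.1 (((Module.End.isUnit_iff _).1 this).1
      (show LinearMap.mulRight (RatFunc k) z _ = LinearMap.mulRight (RatFunc k) z 0 by
        simpa using h1))
  exact ⟨⟨z, w, this, hw'⟩, rfl⟩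

theorem inftyValuation_rightNorm_one_add_le {z : RatFunc k ⊗[k] D}
    (hz : inftyVal k (rightNorm (RatFunc k) z) ≤ 1) :
    inftyVal k (rightNorm (RatFunc k) (1 + z)) ≤ 1 := by
  by_cases h0 : z = 0
  · simp [h0, rightNorm_one]
  obtain ⟨m, hm, hle⟩ := exists_inftyValuation_rightNorm_eq h0
  obtain ⟨m', hm', hle'⟩ := exists_inftyValuation_rightNorm_eq (k := k) (D := D)
    (one_ne_zero : (1 : RatFunc k ⊗[k] D) ≠ 0)
  have hpos : (0 : ℤ) < Module.finrank k D := by exact_mod_cast Module.finrank_pos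
  have hneg {l : ℤ} (h : inftyVal k RatFunc.X ^ (l * Module.finrank k D) ≤ 1) :
      inftyVal k RatFunc.X ^ l ≤ 1 := by
    rw [zpow_le_one_iff_right₀ one_lt_inftyValuation_X] at h ⊢
    nlinarith
  refine valuation_rightNorm_le (Module.finBasis k D) inftyValuation_algebraMap_le_one fun i => ?_
  rw [map_add, Finsupp.add_apply]
  refine Valuation.map_add_le _ ((hle' i).trans (hneg ?_)) ((hle i).trans (hneg ?_))
  · rw [← hm', rightNorm_one, map_one]
  · rwa [← hm]

theorem center_tensorProduct_eq_bot {K : Type*} [Field K] [Algebra k K]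
    (hD : Subalgebra.center k D = ⊥) : Subalgebra.center K (K ⊗[k] D) = ⊥ := by
  refine eq_bot_iff.2 fun z hz => ?_
  have hz' : z ∈ Subalgebra.centralizer k
      ((Algebra.TensorProduct.includeRight : D →ₐ[k] K ⊗[k] D).range : Set (K ⊗[k] D)) :=
    (Subalgebra.mem_centralizer_iff k).2 fun g _ => Subalgebra.mem_center_iff.1 hz g
  rw [Subalgebra.centralizer_range_includeRight_eq_center_tensorProduct] at hz'
  obtain ⟨t, rfl⟩ := hz'
  clear hz
  induction t with
  | zero => rw [map_zero]; exact zero_mem _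
  | add x y hx hy =>
    rw [map_add]
    exact add_mem hx hy
  | tmul f d =>
    obtain ⟨c, hc⟩ := Algebra.mem_bot.1 (hD ▸ d.2 : (d : D) ∈ (⊥ : Subalgebra k D))
    refine Algebra.mem_bot.2 ⟨c • f, ?_⟩
    change algebraMap K (K ⊗[k] D) (c • f) = f ⊗ₜ[k] (d : D)
    rw [← hc, Algebra.algebraMap_eq_smul_one, Algebra.algebraMap_eq_smul_one,
      TensorProduct.tmul_smul, Algebra.TensorProduct.one_def, TensorProduct.smul_tmul', smul_eq_mul,
      mul_one, TensorProduct.smul_tmul']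

end ConstantDivisionAlgebra

section Twins

variable {K S S' : Type} [Field K] [Ring S] [Algebra K S] [Ring S'] [Algebra K S']

/-- Two elements of two algebras are twins if they are images of the same element of a common
field extension of the base. -/
def IsTwin (K : Type) {S S' : Type} [Field K] [Ring S] [Algebra K S] [Ring S'] [Algebra K S']
    (z : S) (z' : S') : Prop :=
  ∃ (P : Type) (_ : Field P) (_ : Algebra K P) (f : P →ₐ[K] S) (f' : P →ₐ[K] S') (w : P),
    f w = z ∧ f' w = z'

namespace IsTwin

variable {z : S} {z' : S'}

theorem rightNorm_eq [FiniteDimensional K S] [FiniteDimensional K S']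
    (hfin : Module.finrank K S = Module.finrank K S') (h : IsTwin K z z') :
    rightNorm K z = rightNorm K z' := by
  obtain ⟨P, _, _, f, f', w, rfl, rfl⟩ := h
  exact rightNorm_eq_of_algHom hfin f f' w

theorem sub_algebraMap (h : IsTwin K z z') (c : K) :
    IsTwin K (z - algebraMap K S c) (z' - algebraMap K S' c) := by
  obtain ⟨P, _, _, f, f', w, rfl, rfl⟩ := h
  exact ⟨P, _, _, f, f', w - algebraMap K P c, by simp, by simp⟩

theorem one_add (h : IsTwin K z z') : IsTwin K (1 + z) (1 + z') := by
  obtain ⟨P, _, _, f, f', w, rfl, rfl⟩ := h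
  exact ⟨P, _, _, f, f', 1 + w, by simp, by simp⟩

theorem isIntegral_iff [Nontrivial S] [Nontrivial S'] {O : Type*} [CommRing O] [Algebra O K]
    [Algebra O S] [IsScalarTower O K S] [Algebra O S'] [IsScalarTower O K S']
    (h : IsTwin K z z') : IsIntegral O z ↔ IsIntegral O z' := by
  obtain ⟨P, _, _, f, f', w, rfl, rfl⟩ := h
  let : Algebra O P := Algebra.compHom P (algebraMap O K)
  have : IsScalarTower O K P := IsScalarTower.of_algebraMap_eq fun _ => rfl
  rw [← AlgHom.restrictScalars_apply O f, ← AlgHom.restrictScalars_apply O f',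
    isIntegral_algHom_iff (f.restrictScalars O) f.toRingHom.injective,
    isIntegral_algHom_iff (f'.restrictScalars O) f'.toRingHom.injective]

theorem ne_zero_iff [Nontrivial S] [Nontrivial S'] (h : IsTwin K z z') : z ≠ 0 ↔ z' ≠ 0 := by
  obtain ⟨P, _, _, f, f', w, rfl, rfl⟩ := h
  rw [map_ne_zero f, map_ne_zero f']

theorem symm (h : IsTwin K z z') : IsTwin K z' z := by
  obtain ⟨P, _, _, f, f', w, h, h'⟩ := h
  exact ⟨P, _, _, f', f, w, h', h⟩

end IsTwin

theorem HaveSameMaximalSubfields.exists_isTwin {S : Type} [DivisionRing S] [Algebra K S] {n : ℕ}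
    (hn : 0 < n) (h : ∀ (P : Type) [Field P] [Algebra K P], Module.finrank K P = n →
      Nonempty (P →ₐ[K] S) → Nonempty (P →ₐ[K] S'))
    (hS : Subalgebra.center K S = ⊥) (hfin : Module.finrank K S = n ^ 2) (z : S) :
    ∃ z' : S', IsTwin K z z' := by
  obtain ⟨P, _, _, f, w, hP, rfl⟩ := exists_subfield_of_degree hn hS hfin z
  obtain ⟨f'⟩ := h P hP ⟨f⟩
  exact ⟨f' w, P, _, _, f, f', w, rfl, rfl⟩

end Twins

section TwinsRatFunc

variable {k : Type} [Field k] {n : ℕ} {D : Type} [DivisionRing D] [Algebra k D]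
  {Δ : Type} [DivisionRing Δ] [Algebra (RatFunc k) Δ]

theorem IsCentralDivisionAlgebraOfDegree.finiteDimensional (hn : 0 < n)
    (hD : IsCentralDivisionAlgebraOfDegree k n D) : FiniteDimensional k D :=
  Module.finite_of_finrank_pos (by rw [hD.2]; positivity)

theorem exists_isTwin_right (hn : 0 < n)
    (hΔ : IsCentralDivisionAlgebraOfDegree (RatFunc k) n Δ)
    (hsame : HaveSameMaximalSubfields (RatFunc k) n Δ (RatFunc k ⊗[k] D)) (z : Δ) :
    ∃ z' : RatFunc k ⊗[k] D, IsTwin (RatFunc k) z z' :=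
  HaveSameMaximalSubfields.exists_isTwin hn (fun P _ _ hP => (hsame P hP).1) hΔ.1 hΔ.2 z

/-- A constant central division algebra remains a division ring over the rational functions. -/
noncomputable abbrev ratFuncTensorDivisionRing [FiniteDimensional k D] :
    DivisionRing (RatFunc k ⊗[k] D) :=
  DivisionRing.ofIsUnitOrEqZero fun z => (em (z = 0)).elim Or.inr fun h =>
    Or.inl (isUnit_of_ne_zero_ratFunc_tensorProduct h)

theorem IsCentralDivisionAlgebraOfDegree.ratFunc [FiniteDimensional k D]
    (hD : IsCentralDivisionAlgebraOfDegree k n D) :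
    @IsCentralDivisionAlgebraOfDegree (RatFunc k) _ n (RatFunc k ⊗[k] D) ratFuncTensorDivisionRing
      Algebra.TensorProduct.leftAlgebra :=
  ⟨center_tensorProduct_eq_bot hD.1, (Module.finrank_baseChange ..).trans hD.2⟩

theorem exists_isTwin_left [FiniteDimensional k D] (hn : 0 < n)
    (hD : IsCentralDivisionAlgebraOfDegree k n D)
    (hsame : HaveSameMaximalSubfields (RatFunc k) n Δ (RatFunc k ⊗[k] D))
    (z : RatFunc k ⊗[k] D) : ∃ z' : Δ, IsTwin (RatFunc k) z' z := by
  obtain ⟨z', hz'⟩ := @HaveSameMaximalSubfields.exists_isTwin (RatFunc k) Δ _ _ _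
    (RatFunc k ⊗[k] D) ratFuncTensorDivisionRing Algebra.TensorProduct.leftAlgebra n hn
    (fun P _ _ hP => (hsame P hP).2) hD.ratFunc.1 hD.ratFunc.2 z
  exact ⟨z', IsTwin.symm hz'⟩

/-- The valuation at infinity of an algebra with the same maximal subfields as a constant one. -/
theorem exists_valuation_at_infinity (hn : 0 < n) (hD : IsCentralDivisionAlgebraOfDegree k n D)
    (hΔ : IsCentralDivisionAlgebraOfDegree (RatFunc k) n Δ)
    (hsame : HaveSameMaximalSubfields (RatFunc k) n Δ (RatFunc k ⊗[k] D)) :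
    ∃ w : Valuation Δ (WithZero (Multiplicative ℤ)),
      (∀ z, w z = inftyVal k (rightNorm (RatFunc k) z)) ∧
      (∀ z ≠ 0, ∃ m : ℤ, w z = inftyVal k RatFunc.X ^ (m * (n ^ 2 : ℕ))) := by
  have := hD.finiteDimensional hn
  have := hΔ.finiteDimensional hn
  have hfin : Module.finrank (RatFunc k) Δ = Module.finrank (RatFunc k) (RatFunc k ⊗[k] D) :=
    hΔ.2.trans (hD.2.symm.trans (Module.finrank_baseChange ..).symm)
  have hone (z : Δ) (hz : inftyVal k (rightNorm (RatFunc k) z) ≤ 1) :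
      inftyVal k (rightNorm (RatFunc k) (1 + z)) ≤ 1 := by
    obtain ⟨z', h⟩ := exists_isTwin_right hn hΔ hsame z
    rw [h.one_add.rightNorm_eq hfin]
    rw [h.rightNorm_eq hfin] at hz
    exact inftyValuation_rightNorm_one_add_le hz
  have hzero : rightNorm (RatFunc k) (0 : Δ) = 0 := by
    have := rightNorm_algebraMap (S := Δ) (0 : RatFunc k)
    rwa [map_zero, zero_pow Module.finrank_pos.ne'] at this
  have hpos (z : Δ) (hz : z ≠ 0) : 0 < inftyVal k (rightNorm (RatFunc k) z) :=
    zero_lt_iff.2 ((Valuation.ne_zero_iff _).2 (rightNorm_ne_zero hz))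
  have hadd (x y : Δ) (hxy : inftyVal k (rightNorm (RatFunc k) x) ≤
      inftyVal k (rightNorm (RatFunc k) y)) :
      inftyVal k (rightNorm (RatFunc k) (x + y)) ≤ inftyVal k (rightNorm (RatFunc k) y) := by
    by_cases hy : y = 0
    · subst hy
      by_cases hx : x = 0
      · simp [hx]
      · rw [hzero, map_zero] at hxy
        exact absurd hxy (hpos x hx).not_ge
    · have h1 : x + y = y * (1 + y⁻¹ * x) := by
        rw [mul_add, mul_one, mul_inv_cancel_left₀ hy, add_comm]
      have h2 : inftyVal k (rightNorm (RatFunc k) (y⁻¹ * x)) ≤ 1 := by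
        have h3 : x = y * (y⁻¹ * x) := by rw [mul_inv_cancel_left₀ hy]
        rw [h3, rightNorm_mul, map_mul] at hxy
        exact (mul_le_iff_le_one_right (hpos y hy)).1 hxy
      rw [h1, rightNorm_mul, map_mul]
      exact (mul_le_iff_le_one_right (hpos y hy)).2 (hone _ h2)
  refine ⟨{ toFun := fun z => inftyVal k (rightNorm (RatFunc k) z)
            map_zero' := by rw [hzero, map_zero]
            map_one' := by rw [rightNorm_one, map_one]
            map_mul' := fun x y => by rw [rightNorm_mul, map_mul]
            map_add_le_max' := fun x y => ?_ }, fun _ => rfl, fun z hz => ?_⟩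
  · rcases le_total (inftyVal k (rightNorm (RatFunc k) x))
      (inftyVal k (rightNorm (RatFunc k) y)) with h | h
    · exact (hadd x y h).trans (le_max_right _ _)
    · rw [add_comm]
      exact (hadd y x h).trans (le_max_left _ _)
  · obtain ⟨z', h⟩ := exists_isTwin_right hn hΔ hsame z
    have : Nontrivial (RatFunc k ⊗[k] D) := inferInstance
    obtain ⟨m, hm, -⟩ := exists_inftyValuation_rightNorm_eq (h.ne_zero_iff.1 hz)
    refine ⟨m, ?_⟩
    change inftyVal k (rightNorm (RatFunc k) z) = _
    rw [h.rightNorm_eq hfin, hm, hD.2]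

end TwinsRatFunc

section ReducedBasis

variable {k : Type*} [Field k] {Δ : Type*} [DivisionRing Δ] [Algebra (RatFunc k) Δ]
  {w : Valuation Δ (WithZero (Multiplicative ℤ))} {q : ℕ}

theorem valuation_le_one_of_reduced (hq : 0 < q)
    (hK : ∀ f : RatFunc k, w (algebraMap (RatFunc k) Δ f) = inftyVal k f ^ q)
    {ι : Type*} [Fintype ι] {x : ι → Δ} (hx : ∀ i, w (x i) ≤ 1)
    (hred : ∀ a : ι → k, a ≠ 0 → w (∑ i, algebraMap k (RatFunc k) (a i) • x i) = 1)
    {f : ι → RatFunc k} (hf : w (∑ i, f i • x i) ≤ 1) (j : ι) : inftyVal k (f j) ≤ 1 := by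
  have : Nonempty ι := ⟨j⟩
  obtain ⟨j₀, hj₀⟩ := Finite.exists_max fun i => inftyVal k (f i)
  refine (hj₀ j).trans (not_lt.1 fun hlt => ?_)
  have h0 : f j₀ ≠ 0 := by
    rintro h
    rw [h, map_zero] at hlt
    exact not_lt_zero hlt
  let g : ι → RatFunc k := fun i => (f j₀)⁻¹ * f i
  have hg (i : ι) : inftyVal k (g i) ≤ 1 := by
    rw [map_mul, map_inv₀]
    exact inv_mul_le_one_of_le₀ (hj₀ i) zero_le
  choose a ha using fun i => exists_inftyValuation_sub_lt_one (hg i)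
  have ha0 : a ≠ 0 := by
    rintro rfl
    have := ha j₀
    simp only [g, inv_mul_cancel₀ h0, Pi.zero_apply, map_zero, sub_zero, map_one] at this
    exact this.false
  have h1 := hred a ha0
  have h2 : ∑ i, algebraMap k (RatFunc k) (a i) • x i =
      algebraMap (RatFunc k) Δ (f j₀)⁻¹ * ∑ i, f i • x i -
        ∑ i, algebraMap (RatFunc k) Δ (g i - algebraMap k (RatFunc k) (a i)) * x i := by
    rw [Finset.mul_sum, ← Finset.sum_sub_distrib]
    refine Finset.sum_congr rfl fun i _ => ?_
    simp only [Algebra.smul_def, map_sub, g, map_mul]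
    noncomm_ring
  have h3 : w (algebraMap (RatFunc k) Δ (f j₀)⁻¹ * ∑ i, f i • x i) < 1 := by
    rw [map_mul, hK, map_inv₀]
    refine (mul_le_of_le_one_right zero_le hf).trans_lt (pow_lt_one₀ zero_le ?_ hq.ne')
    exact inv_lt_one_of_one_lt₀ hlt
  have h4 : w (∑ i, algebraMap (RatFunc k) Δ (g i - algebraMap k (RatFunc k) (a i)) * x i) < 1 := by
    refine Valuation.map_sum_lt _ one_ne_zero fun i _ => ?_
    rw [map_mul, hK]
    exact (mul_le_of_le_one_right zero_le (hx i)).trans_lt (pow_lt_one₀ zero_le (ha i) hq.ne')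
  have h5 := (Valuation.map_sub w _ _).trans_lt (max_lt h3 h4)
  rw [← h2, h1] at h5
  exact h5.false

variable [Algebra (Polynomial k) Δ] [IsScalarTower (Polynomial k) (RatFunc k) Δ]

theorem exists_reduced_basis [FiniteDimensional (RatFunc k) Δ] (hq : 0 < q)
    (hK : ∀ f : RatFunc k, w (algebraMap (RatFunc k) Δ f) = inftyVal k f ^ q)
    (hw : ∀ z ≠ 0, ∃ m : ℤ, w z = inftyVal k RatFunc.X ^ (m * q))
    {Λ : Submodule (Polynomial k) Δ} (hfg : Λ.FG)
    (hspan : Submodule.span (RatFunc k) (Λ : Set Δ) = ⊤)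
    (hΛ : ∀ z ∈ Λ, z ≠ 0 → 1 ≤ w z) :
    ∃ (c : Module.Basis (Fin (Module.finrank (RatFunc k) Δ)) (RatFunc k) Δ)
      (d : Fin (Module.finrank (RatFunc k) Δ) → ℕ),
      Submodule.span (Polynomial k) (Set.range c) = Λ ∧
      (∀ i, w (c i) = inftyVal k RatFunc.X ^ ((d i : ℤ) * q)) ∧
      ∀ a : Fin (Module.finrank (RatFunc k) Δ) → k, a ≠ 0 →
        w (∑ i, algebraMap k (RatFunc k) (a i) • (RatFunc.X ^ (-(d i : ℤ)) : RatFunc k) • c i)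
          = 1 := by
  let N := Module.finrank (RatFunc k) Δ
  have hX := one_lt_inftyValuation_X (k := k)
  have hX0 := (zero_lt_one.trans hX).ne'
  have hXne : (RatFunc.X : RatFunc k) ≠ 0 := RatFunc.X_ne_zero
  have hbasis (c : Fin N → Δ) (hc : Submodule.span (Polynomial k) (Set.range c) = Λ) :
      ⊤ ≤ Submodule.span (RatFunc k) (Set.range c) := by
    rw [← hspan, Submodule.span_le, ← hc]
    exact Submodule.span_subset_span _ _ _
  let Good (s : ℕ) : Prop := ∃ (c : Fin N → Δ) (d : Fin N → ℕ),
    Submodule.span (Polynomial k) (Set.range c) = Λ ∧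
    (∀ i, w (c i) = inftyVal k RatFunc.X ^ ((d i : ℤ) * q)) ∧ ∑ i, d i = s
  have hdeg (z : Δ) (hz : z ∈ Λ) (h0 : z ≠ 0) :
      ∃ m : ℕ, w z = inftyVal k RatFunc.X ^ ((m : ℤ) * q) := by
    obtain ⟨m, hm⟩ := hw z h0
    have h1 := hΛ z hz h0
    rw [hm, one_le_zpow_iff_right₀ hX] at h1
    have : 0 ≤ m := by
      have : (0 : ℤ) < q := by exact_mod_cast hq
      nlinarith
    lift m to ℕ using this
    exact ⟨m, hm⟩
  have hex : ∃ s, Good s := by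
    obtain ⟨m, b, c, hbc⟩ := exists_basis_of_lattice hfg hspan
    have hm : m = N := by
      rw [← Fintype.card_fin m, ← Module.finrank_eq_card_basis c]
    subst hm
    have hmem (i) : c i ∈ Λ := by rw [hbc]; exact (b i).2
    choose d hd using fun i => hdeg (c i) (hmem i) (c.ne_zero i)
    refine ⟨_, c, d, le_antisymm (Submodule.span_le.2 ?_) fun z hz => ?_, hd, rfl⟩
    · rintro _ ⟨i, rfl⟩
      exact hmem i
    · have := congrArg Subtype.val (b.sum_repr ⟨z, hz⟩)
      rw [← show _ = z from this, Submodule.coe_sum]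
      refine Submodule.sum_mem _ fun i _ => Submodule.smul_mem _ _ ?_
      rw [← hbc]
      exact Submodule.subset_span ⟨i, rfl⟩
  classical
  obtain ⟨c, d, hc, hd, hs⟩ := Nat.find_spec hex
  have htop := hbasis c hc
  have hli : LinearIndependent (RatFunc k) c :=
    linearIndependent_of_top_le_span_of_card_eq_finrank htop (Fintype.card_fin _)
  refine ⟨Module.Basis.mk hli htop, d, by rwa [Module.Basis.coe_mk], by
    simpa only [Module.Basis.coe_mk] using hd, fun a ha => ?_⟩
  simp only [Module.Basis.coe_mk]
  let x : Fin N → Δ := fun i => (RatFunc.X ^ (-(d i : ℤ)) : RatFunc k) • c i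
  have hwX (m : ℤ) (z : Δ) : w ((RatFunc.X ^ m : RatFunc k) • z) =
      inftyVal k RatFunc.X ^ (m * q) * w z := by
    rw [Algebra.smul_def, map_mul, hK, map_zpow₀, zpow_mul, zpow_natCast]
  have hx (i) : w (x i) = 1 := by
    rw [hwX, hd, ← zpow_add₀ hX0, neg_mul, neg_add_cancel, zpow_zero]
  have hle : w (∑ i, algebraMap k (RatFunc k) (a i) • x i) ≤ 1 := by
    refine Valuation.map_sum_le _ fun i _ => ?_
    rw [Algebra.smul_def, map_mul, hx, mul_one, hK]
    exact pow_le_one₀ zero_le (inftyValuation_algebraMap_le_one _)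
  refine hle.eq_of_not_lt fun hlt => ?_
  obtain ⟨i₁, hi₁⟩ := Function.ne_iff.1 ha
  obtain ⟨i₀, hi₀, hmax⟩ := Finset.exists_max_image (Finset.univ.filter fun i => a i ≠ 0) d
    ⟨i₁, by simpa using hi₁⟩
  have hi₀ : a i₀ ≠ 0 := by simpa using hi₀
  let e : Fin N → Polynomial k := fun i => Polynomial.C (a i) * Polynomial.X ^ (d i₀ - d i)
  let u : Δ := ∑ i, e i • c i
  have hu : u = (RatFunc.X ^ (d i₀ : ℤ) : RatFunc k) •
      ∑ i, algebraMap k (RatFunc k) (a i) • x i := by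
    rw [Finset.smul_sum]
    refine Finset.sum_congr rfl fun i _ => ?_
    rw [← algebraMap_smul (RatFunc k) (e i) (c i), smul_smul, smul_smul]
    congr 1
    by_cases hai : a i = 0
    · simp [e, hai]
    · have hdi := hmax i (by simpa using hai)
      simp only [e, map_mul, map_pow, RatFunc.algebraMap_X, RatFunc.algebraMap_C,
        RatFunc.algebraMap_eq_C]
      rw [mul_comm, mul_right_comm, ← zpow_add₀ hXne, ← zpow_natCast, Nat.cast_sub hdi]
      rfl
  have hcmem (i) : c i ∈ Λ := hc ▸ Submodule.subset_span ⟨i, rfl⟩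
  have huΛ : u ∈ Λ := Submodule.sum_mem _ fun i _ => Submodule.smul_mem _ _ (hcmem i)
  have hu0 : u ≠ 0 := by
    intro h0
    have h1 : ∑ i, algebraMap (Polynomial k) (RatFunc k) (e i) • c i = 0 := by
      simpa only [algebraMap_smul] using h0
    have h2 := Fintype.linearIndependent_iff.1 hli _ h1 i₀
    simp [e, hi₀] at h2
  obtain ⟨m, hm⟩ := hdeg u huΛ hu0
  have hmlt : m < d i₀ := by
    have h1 : w u < inftyVal k RatFunc.X ^ ((d i₀ : ℤ) * q) := by
      rw [hu, hwX]
      exact mul_lt_of_lt_one_right (zpow_pos (zero_lt_one.trans hX) _) hlt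
    rw [hm, zpow_lt_zpow_iff_right₀ hX] at h1
    exact_mod_cast lt_of_mul_lt_mul_right h1 (Nat.cast_nonneg q)
  refine Nat.find_min hex (m := ∑ i, Function.update d i₀ m i) ?_
    ⟨Function.update c i₀ u, Function.update d i₀ m, le_antisymm (Submodule.span_le.2 ?_) ?_,
      fun i => ?_, rfl⟩
  · rw [← hs]
    refine Finset.sum_lt_sum (fun i _ => ?_) ⟨i₀, Finset.mem_univ _, by simpa using hmlt⟩
    by_cases h : i = i₀
    · subst h; simpa using hmlt.le
    · rw [Function.update_of_ne h]
  · rintro _ ⟨i, rfl⟩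
    by_cases h : i = i₀
    · subst h; simpa using huΛ
    · rw [Function.update_of_ne h]; exact hcmem i
  · rw [← hc, Submodule.span_le]
    have hne (i) (h : i ≠ i₀) :
        c i ∈ Submodule.span (Polynomial k) (Set.range (Function.update c i₀ u)) :=
      Submodule.subset_span ⟨i, Function.update_of_ne h _ _⟩
    rintro _ ⟨i, rfl⟩
    by_cases h : i = i₀
    · subst h
      have h1 : c i = Polynomial.C (a i)⁻¹ • (u - ∑ j ∈ Finset.univ.erase i, e j • c j) := by
        have h2 : u - ∑ j ∈ Finset.univ.erase i, e j • c j = Polynomial.C (a i) • c i := by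
          have h3 : Polynomial.C (a i) • c i = e i • c i := by simp [e]
          rw [sub_eq_iff_eq_add', h3]
          exact (Finset.sum_erase_add _ _ (Finset.mem_univ i)).symm
        rw [h2, smul_smul, ← Polynomial.C_mul, inv_mul_cancel₀ hi₀, Polynomial.C_1, one_smul]
      rw [SetLike.mem_coe, h1]
      refine Submodule.smul_mem _ _ (Submodule.sub_mem _
        (Submodule.subset_span ⟨i, Function.update_self _ _ _⟩) (Submodule.sum_mem _ fun j hj => ?_))
      exact Submodule.smul_mem _ _ (hne j (Finset.ne_of_mem_erase hj))
    · exact hne i h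
  · by_cases h : i = i₀
    · subst h; simpa using hm
    · rw [Function.update_of_ne h, Function.update_of_ne h]; exact hd i

/-- A lattice which is self-dual for the trace form and has no elements of negative degree has a
basis of elements of degree zero. -/
theorem exists_basis_valuation_eq_one [FiniteDimensional (RatFunc k) Δ] (hq : 0 < q)
    (hqk : ((Module.finrank (RatFunc k) Δ : ℕ) : k) ≠ 0)
    (hK : ∀ f : RatFunc k, w (algebraMap (RatFunc k) Δ f) = inftyVal k f ^ q)
    (hw : ∀ z ≠ 0, ∃ m : ℤ, w z = inftyVal k RatFunc.X ^ (m * q))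
    {Λ : Submodule (Polynomial k) Δ} (hfg : Λ.FG)
    (hspan : Submodule.span (RatFunc k) (Λ : Set Δ) = ⊤)
    (hΛ : ∀ z ∈ Λ, z ≠ 0 → 1 ≤ w z)
    (hdual : ∀ z : Δ, (∀ u ∈ Λ, ∃ t : Polynomial k, rightTrace (RatFunc k) Δ (z * u) =
      algebraMap (Polynomial k) (RatFunc k) t) → z ∈ Λ) :
    ∃ (c : Module.Basis (Fin (Module.finrank (RatFunc k) Δ)) (RatFunc k) Δ),
      Submodule.span (Polynomial k) (Set.range c) = Λ ∧ (∀ i, w (c i) ≤ 1) ∧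
      ∀ f : Fin (Module.finrank (RatFunc k) Δ) → RatFunc k, w (∑ i, f i • c i) ≤ 1 →
        ∀ i, inftyVal k (f i) ≤ 1 := by
  classical
  obtain ⟨c, d, hc, hd, hred⟩ := exists_reduced_basis hq hK hw hfg hspan hΛ
  have hX := one_lt_inftyValuation_X (k := k)
  have hX0 := (zero_lt_one.trans hX).ne'
  have hXne : (RatFunc.X : RatFunc k) ≠ 0 := RatFunc.X_ne_zero
  have hwX (m : ℤ) (z : Δ) : w ((RatFunc.X ^ m : RatFunc k) • z) =
      inftyVal k RatFunc.X ^ (m * q) * w z := by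
    rw [Algebra.smul_def, map_mul, hK, map_zpow₀, zpow_mul, zpow_natCast]
  have hx (i) : w ((RatFunc.X ^ (-(d i : ℤ)) : RatFunc k) • c i) ≤ 1 := by
    rw [hwX, hd, ← zpow_add₀ hX0, neg_mul, neg_add_cancel, zpow_zero]
  have horth (f : Fin (Module.finrank (RatFunc k) Δ) → RatFunc k)
      (hf : w (∑ i, f i • (RatFunc.X ^ (-(d i : ℤ)) : RatFunc k) • c i) ≤ 1) (i) :
      inftyVal k (f i) ≤ 1 := valuation_le_one_of_reduced hq hK hx hred hf i
  have hvq : inftyVal k (rightTrace (RatFunc k) Δ 1) = 1 := by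
    rw [rightTrace_one, ← map_natCast (algebraMap k (RatFunc k))]
    exact inftyValuation_algebraMap_eq_one hqk
  have hT1 : rightTrace (RatFunc k) Δ 1 ≠ 0 := by
    intro h
    rw [h, map_zero] at hvq
    exact zero_ne_one hvq
  let F : Δ →ₗ[RatFunc k] (Fin (Module.finrank (RatFunc k) Δ) → RatFunc k) :=
    LinearMap.pi fun j => rightTrace (RatFunc k) Δ ∘ₗ LinearMap.mulRight (RatFunc k) (c j)
  have hFinj : Function.Injective F := by
    rw [← LinearMap.ker_eq_bot, LinearMap.ker_eq_bot']
    intro z hz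
    by_contra h0
    have h1 : rightTrace (RatFunc k) Δ ∘ₗ LinearMap.mulLeft (RatFunc k) z = 0 :=
      c.ext fun j => congrFun hz j
    refine hT1 ?_
    have h2 := LinearMap.congr_fun h1 z⁻¹
    simpa [h0] using h2
  have hFsurj : Function.Surjective F :=
    (LinearMap.injective_iff_surjective_of_finrank_eq_finrank (by simp)).1 hFinj
  have hd0 (i) : d i = 0 := by
    by_contra hdi
    obtain ⟨y, hy⟩ := hFsurj (Pi.single i 1)
    have hy' (j) : rightTrace (RatFunc k) Δ (y * c j) = (Pi.single i 1 : _ → RatFunc k) j :=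
      congrFun hy j
    have hy0 : y ≠ 0 := by
      rintro rfl
      have := hy' i
      simp at this
    have hyΛ : y ∈ Λ := by
      refine hdual y fun u hu => ?_
      rw [← hc] at hu
      induction hu using Submodule.span_induction with
      | mem u hu =>
        obtain ⟨j, rfl⟩ := hu
        refine ⟨(Pi.single i 1 : _ → Polynomial k) j, ?_⟩
        rw [hy']
        by_cases hij : j = i
        · subst hij; simp
        · simp [hij]
      | zero => exact ⟨0, by simp⟩
      | add u v _ _ hu hv =>
        obtain ⟨s, hs⟩ := hu
        obtain ⟨t, ht⟩ := hv
        exact ⟨s + t, by rw [mul_add, map_add, hs, ht, map_add]⟩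
      | smul a u _ hu =>
        obtain ⟨s, hs⟩ := hu
        refine ⟨a * s, ?_⟩
        rw [← algebraMap_smul (RatFunc k) a u, mul_smul_comm, map_smul, hs, smul_eq_mul, map_mul]
    obtain ⟨e, he⟩ := hw y hy0
    have he0 : 0 ≤ e := by
      have h1 := hΛ y hyΛ hy0
      rw [he, one_le_zpow_iff_right₀ hX] at h1
      have : (0 : ℤ) < q := by exact_mod_cast hq
      nlinarith
    let z : Δ := (RatFunc.X ^ (-e) : RatFunc k) • y
    have hz1 : w z = 1 := by
      rw [hwX, he, ← zpow_add₀ hX0, neg_mul, neg_add_cancel, zpow_zero]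
    have hz0 : z ≠ 0 := by
      intro h
      rw [h, map_zero] at hz1
      exact zero_ne_one hz1
    let f : Fin (Module.finrank (RatFunc k) Δ) → RatFunc k := fun j =>
      c.repr z⁻¹ j * RatFunc.X ^ (d j : ℤ)
    have hf : ∑ j, f j • (RatFunc.X ^ (-(d j : ℤ)) : RatFunc k) • c j = z⁻¹ := by
      rw [← c.sum_repr z⁻¹]
      refine Finset.sum_congr rfl fun j _ => ?_
      rw [smul_smul, mul_assoc, ← zpow_add₀ hXne, add_neg_cancel, zpow_zero, mul_one]
    have hfi := horth f (by rw [hf, map_inv₀, hz1, inv_one]) i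
    have hT : rightTrace (RatFunc k) Δ 1 = f i * RatFunc.X ^ (-(d i : ℤ) - e) := by
      have h1 : (1 : Δ) = z * z⁻¹ := (mul_inv_cancel₀ hz0).symm
      rw [h1, ← hf, Finset.mul_sum, map_sum, Finset.sum_eq_single i]
      · simp only [z, mul_smul_comm, smul_mul_assoc, map_smul, hy', Pi.single_eq_same, smul_eq_mul,
          mul_one]
        rw [sub_eq_add_neg, zpow_add₀ hXne]
      · intro j _ hj
        simp only [z, mul_smul_comm, smul_mul_assoc, map_smul, hy', Pi.single_eq_of_ne hj,
          smul_zero]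
      · simp
    rw [hT, map_mul, map_zpow₀] at hvq
    have h2 : inftyVal k RatFunc.X ^ (-(d i : ℤ) - e) < 1 := by
      rw [zpow_lt_one_iff_right₀ hX]
      omega
    exact (lt_of_le_of_lt (mul_le_of_le_one_left zero_le hfi) h2).ne hvq
  refine ⟨c, hc, fun i => ?_, fun f hf => horth f ?_⟩
  · simpa [hd0] using hx i
  · simpa [hd0] using hf

end ReducedBasis

section ConstantForm

variable {k : Type} [Field k] {Δ : Type} [DivisionRing Δ] [Algebra (RatFunc k) Δ]
  {w : Valuation Δ (WithZero (Multiplicative ℤ))} {q : ℕ}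
  [Algebra (Polynomial k) Δ] [IsScalarTower (Polynomial k) (RatFunc k) Δ]

/-- An order with a basis of elements of degree zero comes from a constant division algebra. -/
theorem exists_constant_form {n : ℕ}
    (hΔ : IsCentralDivisionAlgebraOfDegree (RatFunc k) n Δ)
    (hK : ∀ f : RatFunc k, w (algebraMap (RatFunc k) Δ f) = inftyVal k f ^ q)
    (Λ : Subalgebra (Polynomial k) Δ)
    {ι : Type} [Fintype ι] (c : Module.Basis ι (RatFunc k) Δ)
    (hc : Submodule.span (Polynomial k) (Set.range c) = Subalgebra.toSubmodule Λ)
    (hc1 : ∀ i, w (c i) ≤ 1)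
    (horth : ∀ f : ι → RatFunc k, w (∑ i, f i • c i) ≤ 1 → ∀ i, inftyVal k (f i) ≤ 1) :
    ∃ (D' : Type) (_ : DivisionRing D') (_ : Algebra k D'),
      IsCentralDivisionAlgebraOfDegree k n D' ∧
      Nonempty (Δ ≃ₐ[RatFunc k] (RatFunc k ⊗[k] D')) := by
  classical
  let : Algebra k Δ := Algebra.compHom Δ (algebraMap k (RatFunc k))
  have : IsScalarTower k (RatFunc k) Δ := IsScalarTower.of_algebraMap_eq fun _ => rfl
  let E : Subalgebra k Δ :=
    { carrier := {z | z ∈ Λ ∧ w z ≤ 1}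
      mul_mem' := fun {x y} hx hy => ⟨mul_mem hx.1 hy.1, by
        rw [map_mul]; exact mul_le_one' hx.2 hy.2⟩
      add_mem' := fun {x y} hx hy => ⟨add_mem hx.1 hy.1, w.map_add_le hx.2 hy.2⟩
      algebraMap_mem' := fun a => ⟨by
        have h : algebraMap k Δ a = algebraMap (Polynomial k) Δ (Polynomial.C a) := by
          rw [IsScalarTower.algebraMap_apply (Polynomial k) (RatFunc k) Δ, RatFunc.algebraMap_C,
            ← RatFunc.algebraMap_eq_C]
          rfl
        rw [h]
        exact Λ.algebraMap_mem _, by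
        rw [IsScalarTower.algebraMap_apply k (RatFunc k) Δ, hK]
        exact pow_le_one₀ zero_le (inftyValuation_algebraMap_le_one a)⟩ }
  have hmem (i) : c i ∈ E :=
    ⟨show c i ∈ Subalgebra.toSubmodule Λ from hc ▸ Submodule.subset_span ⟨i, rfl⟩, hc1 i⟩
  have hcoef (z : Δ) (hz : z ∈ E) : ∃ a : ι → k, ∑ i, a i • c i = z := by
    have h1 : z ∈ Submodule.span (Polynomial k) (Set.range c) := hc.symm ▸ hz.1
    obtain ⟨f, rfl⟩ := (Submodule.mem_span_range_iff_exists_fun _).1 h1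
    have h2 : w (∑ i, algebraMap (Polynomial k) (RatFunc k) (f i) • c i) ≤ 1 := by
      simpa only [algebraMap_smul] using hz.2
    choose a ha using fun i => exists_eq_C_of_inftyValuation_le_one (horth _ h2 i)
    refine ⟨a, Finset.sum_congr rfl fun i _ => ?_⟩
    rw [ha i, ← algebraMap_smul (RatFunc k) (Polynomial.C (a i)), ← algebraMap_smul (RatFunc k) (a i),
      RatFunc.algebraMap_C, ← RatFunc.algebraMap_eq_C]
  let cE : ι → E := fun i => ⟨c i, hmem i⟩
  have hlik : LinearIndependent k c := c.linearIndependent.restrict_scalars' k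
  have hli : LinearIndependent k cE := LinearIndependent.of_comp E.val.toLinearMap hlik
  have hsp : ⊤ ≤ Submodule.span k (Set.range cE) := by
    rintro ⟨z, hz⟩ -
    obtain ⟨a, ha⟩ := hcoef z hz
    refine (Submodule.mem_span_range_iff_exists_fun _).2 ⟨a, Subtype.ext ?_⟩
    simpa [cE] using ha
  let B := Module.Basis.mk hli hsp
  have hB (i) : B i = cE i := Module.Basis.mk_apply hli hsp i
  have : FiniteDimensional k E := Module.Finite.of_basis B
  have hfin : Module.finrank k E = n ^ 2 := by
    rw [Module.finrank_eq_card_basis B, ← Module.finrank_eq_card_basis c, hΔ.2]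
  let φ : RatFunc k ⊗[k] E →ₐ[RatFunc k] Δ :=
    Algebra.TensorProduct.lift (Algebra.ofId (RatFunc k) Δ) E.val fun f z => Algebra.commutes f _
  have hφ : Function.Bijective φ := by
    have h1 : φ.toLinearMap =
        ((Algebra.TensorProduct.basis (RatFunc k) B).equiv c (Equiv.refl ι)).toLinearMap := by
      refine (Algebra.TensorProduct.basis (RatFunc k) B).ext fun i => ?_
      change φ _ = (Algebra.TensorProduct.basis (RatFunc k) B).equiv c (Equiv.refl ι) _
      rw [Module.Basis.equiv_apply, Algebra.TensorProduct.basis_apply, hB]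
      exact (Algebra.TensorProduct.lift_tmul _ _ _ _ _).trans (by rw [map_one, one_mul]; rfl)
    have h2 : ⇑φ = (Algebra.TensorProduct.basis (RatFunc k) B).equiv c (Equiv.refl ι) :=
      congrArg DFunLike.coe h1
    rw [h2]
    exact LinearEquiv.bijective _
  have hcenter : Subalgebra.center k E = ⊥ := by
    refine eq_bot_iff.2 fun z hz => ?_
    have h1 : (z : Δ) ∈ Subalgebra.center (RatFunc k) Δ := by
      refine Subalgebra.mem_center_iff.2 fun y => ?_
      rw [← c.sum_repr y, Finset.sum_mul, Finset.mul_sum]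
      refine Finset.sum_congr rfl fun i _ => ?_
      rw [smul_mul_assoc, mul_smul_comm]
      exact congrArg _ (congrArg Subtype.val (Subalgebra.mem_center_iff.1 hz (cE i)))
    rw [hΔ.1] at h1
    obtain ⟨f, hf⟩ := Algebra.mem_bot.1 h1
    obtain ⟨a, ha⟩ := hcoef 1 E.one_mem
    obtain ⟨b, hb⟩ := hcoef z z.2
    have h2 (i) : f * algebraMap k (RatFunc k) (a i) = algebraMap k (RatFunc k) (b i) := by
      have h3 : ∑ i, (f * algebraMap k (RatFunc k) (a i)) • c i =
          ∑ i, algebraMap k (RatFunc k) (b i) • c i := by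
        simp only [algebraMap_smul, mul_smul]
        rw [← Finset.smul_sum, ha, hb, ← hf, Algebra.algebraMap_eq_smul_one]
      exact congrFun ((c.repr_sum_self _).symm.trans
        ((congrArg (fun y => ⇑(c.repr y)) h3).trans (c.repr_sum_self _))) i
    obtain ⟨i, hi⟩ : ∃ i, a i ≠ 0 := by
      by_contra! h
      simp [h] at ha
    refine Algebra.mem_bot.2 ⟨b i / a i, Subtype.ext ?_⟩
    have h6 : f = algebraMap k (RatFunc k) (b i / a i) := by
      rw [map_div₀, ← h2 i, mul_div_cancel_right₀]
      simpa using hi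
    rw [← hf, h6]
    rfl
  exact ⟨E, divisionRingOfFiniteDimensional k E, E.algebra, ⟨hcenter, hfin⟩,
    ⟨(AlgEquiv.ofBijective φ hφ).symm⟩⟩

end ConstantForm

section Specialization

open Polynomial

variable {k : Type} [Field k]

/-- The rational functions without a pole at `a`. -/
noncomputable def regularAt (a : k) : Subalgebra k (RatFunc k) where
  carrier := {f | f.denom.eval a ≠ 0}
  mul_mem' {f g} hf hg h := by
    have := eval_eq_zero_of_dvd_of_eval_eq_zero (RatFunc.denom_mul_dvd f g) h
    rw [eval_mul] at this
    exact (mul_ne_zero hf hg) this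
  add_mem' {f g} hf hg h := by
    have := eval_eq_zero_of_dvd_of_eval_eq_zero (RatFunc.denom_add_dvd f g) h
    rw [eval_mul] at this
    exact (mul_ne_zero hf hg) this
  algebraMap_mem' c := by
    simp [RatFunc.algebraMap_eq_C]

/-- Evaluation of rational functions at a point where they have no pole. -/
noncomputable def evalAt (a : k) : regularAt a →ₐ[k] k where
  toFun f := (f : RatFunc k).eval (RingHom.id k) a
  map_one' := RatFunc.eval_one _ _
  map_zero' := RatFunc.eval_zero _ _
  map_mul' f g := RatFunc.eval_mul (RingHom.id k) a f.2 g.2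
  map_add' f g := RatFunc.eval_add (RingHom.id k) a f.2 g.2
  commutes' c := by
    simp [RatFunc.algebraMap_eq_C]

theorem exists_mem_regularAt [Infinite k] {ι : Type*} [Finite ι] (f : ι → RatFunc k) :
    ∃ a, ∀ i, f i ∈ regularAt a := by
  have := Fintype.ofFinite ι
  have h : ∏ i, (f i).denom ≠ 0 := Finset.prod_ne_zero_iff.2 fun i _ => (f i).denom_ne_zero
  obtain ⟨a, ha⟩ : ∃ a, (∏ i, (f i).denom).eval a ≠ 0 := by
    by_contra! h1
    exact h (Polynomial.funext fun a => by simpa using h1 a)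
  refine ⟨a, fun i => ?_⟩
  rw [eval_prod] at ha
  exact Finset.prod_ne_zero_iff.1 ha i (Finset.mem_univ i)

/-- An embedding into a constant algebra over `k(x)` specializes to an embedding over `k`. -/
theorem exists_algHom_of_algHom_ratFunc_tensorProduct [Infinite k] {P D : Type} [Ring P]
    [Algebra k P] [FiniteDimensional k P] [DivisionRing D] [Algebra k D] [FiniteDimensional k D]
    (g : P →ₐ[k] RatFunc k ⊗[k] D) : Nonempty (P →ₐ[k] D) := by
  let p := Module.finBasis k P
  let b := Module.finBasis k D
  let B := Algebra.TensorProduct.basis (RatFunc k) b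
  obtain ⟨a, ha⟩ := exists_mem_regularAt
    fun i : Fin (Module.finrank k P) × Fin (Module.finrank k D) => B.repr (g (p i.1)) i.2
  let φ := (baseChangeMap k (regularAt a) (RatFunc k) D).restrictScalars k
  have hφ : Function.Injective φ := baseChangeMap_injective Subtype.val_injective
  have hmem (z) : g z ∈ φ.range := by
    have hp (i) : g (p i) ∈ φ.range := by
      rw [← B.sum_repr (g (p i))]
      refine sum_mem fun j _ => ⟨(⟨_, ha (i, j)⟩ : regularAt a) ⊗ₜ[k] b j, ?_⟩
      change baseChangeMap k (regularAt a) (RatFunc k) D _ = _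
      rw [baseChangeMap, Algebra.TensorProduct.map_tmul, Algebra.TensorProduct.basis_apply,
        TensorProduct.smul_tmul', smul_eq_mul, mul_one]
      rfl
    rw [← p.sum_repr z, map_sum]
    refine sum_mem fun i _ => ?_
    rw [map_smul]
    exact φ.range.smul_mem (hp i) _
  let e := AlgEquiv.ofInjective φ hφ
  let ev : regularAt a ⊗[k] D →ₐ[k] D :=
    Algebra.TensorProduct.lift ((Algebra.ofId k D).comp (evalAt a)) (AlgHom.id k D)
      fun f z => Algebra.commutes _ _
  exact ⟨ev.comp (e.symm.toAlgHom.comp (g.codRestrict φ.range hmem))⟩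

theorem exists_algHom_of_haveSameMaximalSubfields [Infinite k] {n : ℕ} {D₁ D₂ : Type}
    [DivisionRing D₁] [Algebra k D₁] [FiniteDimensional k D₁] [DivisionRing D₂] [Algebra k D₂]
    [FiniteDimensional k D₂] (h₁ : ∀ z : RatFunc k ⊗[k] D₁, z ≠ 0 → IsUnit z)
    (h : HaveSameMaximalSubfields (RatFunc k) n (RatFunc k ⊗[k] D₁) (RatFunc k ⊗[k] D₂))
    {P : Type} [Field P] [Algebra k P] (hP : Module.finrank k P = n) (hn : 0 < n)
    (g : P →ₐ[k] D₁) : Nonempty (P →ₐ[k] D₂) := by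
  have : FiniteDimensional k P := FiniteDimensional.of_finrank_pos (hP ▸ hn)
  let G : RatFunc k ⊗[k] P →ₐ[RatFunc k] RatFunc k ⊗[k] D₁ :=
    Algebra.TensorProduct.map (AlgHom.id _ _) g
  have hG : Function.Injective G :=
    Module.Flat.lTensor_preserves_injective_linearMap (M := RatFunc k) g.toLinearMap
      g.toRingHom.injective
  have : NoZeroDivisors (RatFunc k ⊗[k] D₁) := ⟨fun {x y} hxy => by
    by_contra! h2
    exact h2.2 ((h₁ x h2.1).mul_right_eq_zero.1 hxy)⟩
  have : NoZeroDivisors (RatFunc k ⊗[k] P) := hG.noZeroDivisors G (map_zero G) (map_mul G)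
  have : IsDomain (RatFunc k ⊗[k] P) := NoZeroDivisors.to_isDomain _
  let : Field (RatFunc k ⊗[k] P) := fieldOfFiniteDimensional (RatFunc k) _
  obtain ⟨g'⟩ := (h (RatFunc k ⊗[k] P) (by rw [Module.finrank_baseChange, hP])).1 ⟨G⟩
  exact exists_algHom_of_algHom_ratFunc_tensorProduct
    ((g'.restrictScalars k).comp Algebra.TensorProduct.includeRight)

end Specialization

section GlobalOrder

variable {R K S : Type*} [CommRing R] [IsDomain R] [IsPrincipalIdealRing R] [Field K]
  [Algebra R K] [IsFractionRing R K] [DivisionRing S] [Algebra K S] [Algebra R S]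
  [IsScalarTower R K S]

theorem rightTrace_mem_of_order {Λ : Subalgebra R S} (hfg : (Subalgebra.toSubmodule Λ).FG)
    (hspan : Submodule.span K (Subalgebra.toSubmodule Λ : Set S) = ⊤) {z : S} (hz : z ∈ Λ) :
    ∃ t, rightTrace K S z = algebraMap R K t :=
  ⟨_, trace_eq_of_lattice hfg hspan (LinearMap.mulRight K z) (LinearMap.mulRight R (⟨z, hz⟩ : Λ))
    fun _ => rfl⟩

theorem rightNorm_mem_of_order {Λ : Subalgebra R S} (hfg : (Subalgebra.toSubmodule Λ).FG)
    (hspan : Submodule.span K (Subalgebra.toSubmodule Λ : Set S) = ⊤) {z : S} (hz : z ∈ Λ) :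
    ∃ t, rightNorm K z = algebraMap R K t :=
  ⟨_, det_eq_of_lattice hfg hspan (LinearMap.mulRight K z) (LinearMap.mulRight R (⟨z, hz⟩ : Λ))
    fun _ => rfl⟩

variable (R K S)

theorem exists_order [FiniteDimensional K S] :
    ∃ Λ : Subalgebra R S, (Subalgebra.toSubmodule Λ).FG ∧
      Submodule.span K (Subalgebra.toSubmodule Λ : Set S) = ⊤ := by
  have : Module.IsTorsionFree R S := Module.IsTorsionFree.trans_faithfulSMul R K S
  let b := Module.finBasis K S
  let N : Submodule R S := Submodule.span R (Set.range b)
  have hN : N.FG := Submodule.fg_span (Set.finite_range b)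
  have hNK : Submodule.span K (N : Set S) = ⊤ := by
    refine eq_top_iff.2 (b.span_eq.ge.trans (Submodule.span_mono ?_))
    exact Submodule.subset_span
  let Λ : Subalgebra R S :=
    { carrier := {z | ∀ v ∈ N, z * v ∈ N}
      mul_mem' := fun {a b} ha hb v hv => by
        rw [mul_assoc]
        exact ha _ (hb v hv)
      add_mem' := fun {a b} ha hb v hv => by
        rw [add_mul]
        exact N.add_mem (ha v hv) (hb v hv)
      algebraMap_mem' := fun r v hv => by
        rw [← Algebra.smul_def]
        exact N.smul_mem r hv }
  refine ⟨Λ, ?_, ?_⟩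
  · obtain ⟨a, ha, h⟩ := exists_smul_mem_of_span_eq_top (K := K) hNK 1
    refine fg_of_smul_mem hN ha fun z hz => ?_
    have h1 := hz _ h
    rwa [mul_smul_comm, mul_one] at h1
  · refine eq_top_iff.2 fun v _ => ?_
    obtain ⟨a, ha, h⟩ := exists_smul_le_of_fg (K := K) hNK (hN.map (LinearMap.mulLeft R v))
    have h1 : a • v ∈ Λ := fun u hu => by
      rw [smul_mul_assoc]
      exact h _ ⟨u, hu, rfl⟩
    have ha' : algebraMap R K a ≠ 0 := by rwa [Ne, FaithfulSMul.algebraMap_eq_zero_iff]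
    rw [← inv_smul_smul₀ ha' v, algebraMap_smul]
    exact Submodule.smul_mem _ _ (Submodule.subset_span h1)

theorem exists_maximal_order [FiniteDimensional K S] (hS : (Module.finrank K S : K) ≠ 0) :
    ∃ Λ : Subalgebra R S, (Subalgebra.toSubmodule Λ).FG ∧
      Submodule.span K (Subalgebra.toSubmodule Λ : Set S) = ⊤ ∧
      ∀ Ω : Subalgebra R S, (Subalgebra.toSubmodule Ω).FG → Λ ≤ Ω → Ω ≤ Λ := by
  obtain ⟨Λ₀, hfg, hspan⟩ := exists_order R K S
  obtain ⟨m, b, c, hbc⟩ := exists_basis_of_lattice (K := K) hfg hspan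
  let g : S →ₗ[K] Fin m → K :=
    LinearMap.pi fun i => (rightTrace K S).comp (LinearMap.mulRight K (c i))
  have hg : Function.Injective (g.restrictScalars R) := by
    refine (injective_iff_map_eq_zero (g.restrictScalars R)).2 fun z hz => ?_
    by_contra hz0
    have h1 : (rightTrace K S).comp (LinearMap.mulLeft K z) = 0 :=
      c.ext fun i => congrFun hz i
    have h2 : rightTrace K S (z * z⁻¹) = 0 := LinearMap.congr_fun h1 z⁻¹
    rw [mul_inv_cancel₀ hz0, rightTrace_one] at h2
    exact hS h2
  let A : Submodule R (Fin m → K) := LinearMap.range ((Algebra.linearMap R K).compLeft (Fin m))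
  let B : Submodule R S := A.comap (g.restrictScalars R)
  have : IsNoetherian R A := isNoetherian_of_isNoetherianRing_of_finite R A
  have hB : B.FG := Submodule.fg_of_fg_map_injective _ hg
    (isNoetherian_submodule.1 ‹_› _ (Submodule.map_comap_le _ _))
  have hle {Ω : Subalgebra R S} (hΩ : (Subalgebra.toSubmodule Ω).FG) (h : Λ₀ ≤ Ω) :
      Subalgebra.toSubmodule Ω ≤ B := by
    intro z hz
    have hΩs : Submodule.span K (Subalgebra.toSubmodule Ω : Set S) = ⊤ :=
      eq_top_iff.2 (hspan.ge.trans (Submodule.span_mono h))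
    have h1 (i) : c i ∈ Ω := h (hbc i ▸ (b i).2)
    choose t ht using fun i => rightTrace_mem_of_order (K := K) hΩ hΩs (Ω.mul_mem hz (h1 i))
    exact ⟨t, funext fun i => (ht i).symm⟩
  have : IsNoetherian R B := by
    have := Module.Finite.iff_fg.2 hB
    exact isNoetherian_of_isNoetherianRing_of_finite R B
  obtain ⟨Q, ⟨Λ, ⟨hΛ, hΛ₀⟩, rfl⟩, hmax⟩ := set_has_maximal_iff_noetherian.2 this
    ((fun Ω : Subalgebra R S => (Subalgebra.toSubmodule Ω).comap B.subtype) ''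
      {Ω | (Subalgebra.toSubmodule Ω).FG ∧ Λ₀ ≤ Ω}) ⟨_, Λ₀, ⟨hfg, le_rfl⟩, rfl⟩
  refine ⟨Λ, hΛ, eq_top_iff.2 (hspan.ge.trans (Submodule.span_mono hΛ₀)), fun Ω hΩ h => ?_⟩
  by_contra hn
  obtain ⟨z, hz, hz'⟩ := SetLike.not_le_iff_exists.1 hn
  refine hmax _ ⟨Ω, ⟨hΩ, hΛ₀.trans h⟩, rfl⟩ (lt_of_le_not_ge (fun v hv => h hv) fun h2 => hz' ?_)
  exact h2 (show (⟨z, hle hΩ (hΛ₀.trans h) hz⟩ : B) ∈ _ from hz)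

variable {R K S}

theorem mem_of_rightTrace_mul_mem {Λ : Subalgebra R S}
    (hspan : Submodule.span K (Subalgebra.toSubmodule Λ : Set S) = ⊤)
    (hloc : ∀ p : R, Irreducible p → ∀ z ∈ Λ,
      (∀ u ∈ Λ, ∃ t, rightTrace K S (z * u) = algebraMap R K (p * t)) →
      ∃ f : R, ¬ p ∣ f ∧ ∃ w ∈ Λ, f • z = p • w)
    (z : S) (hz : ∀ u ∈ Λ, ∃ t, rightTrace K S (z * u) = algebraMap R K t) : z ∈ Λ := by
  have : Module.IsTorsionFree R S := Module.IsTorsionFree.trans_faithfulSMul R K S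
  have key (a : R) (ha : a ≠ 0) (h : a • z ∈ Λ) : z ∈ Λ := by
    induction a using WfDvdMonoid.induction_on_irreducible with
    | zero => exact absurd rfl ha
    | unit u hu =>
      obtain ⟨u, rfl⟩ := hu
      have := Λ.smul_mem h (↑u⁻¹ : R)
      rwa [smul_smul, Units.inv_mul, one_smul] at this
    | mul a p ha' hp ih =>
      obtain ⟨f, hf, w, hw, hfw⟩ := hloc p hp _ h fun u hu => by
        obtain ⟨t, ht⟩ := hz u hu
        refine ⟨a * t, ?_⟩
        rw [smul_mul_assoc, ← algebraMap_smul K, map_smul, ht, smul_eq_mul, ← map_mul, mul_assoc]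
      obtain ⟨x, y, hxy⟩ := (hp.coprime_iff_not_dvd.2 hf)
      refine ih ha' ?_
      have h1 : a • z = x • ((p * a) • z) + y • w := by
        refine smul_right_injective S hp.ne_zero ?_
        change p • (a • z) = p • (_ + _)
        rw [smul_add, smul_comm p y, ← hfw, smul_comm p x, smul_smul p a]
        rw [smul_smul x p, smul_smul y f, ← add_smul, hxy, one_smul]
      rw [h1]
      exact Λ.add_mem (Λ.smul_mem h x) (Λ.smul_mem hw y)
  obtain ⟨a, ha, h⟩ := exists_smul_mem_of_span_eq_top (K := K) hspan z
  exact key a ha h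

end GlobalOrder

section LocalizedOrder

variable {R S : Type*} [CommRing R] [Ring S] [Algebra R S]

/-- The localization of an order at a multiplicative set of scalars. -/
def localizedOrder (M : Submonoid R) (O : Type*) [CommRing O] [Algebra R O] [IsLocalization M O]
    [Algebra O S] [IsScalarTower R O S] (Λ : Subalgebra R S) : Subalgebra O S where
  carrier := {z | ∃ f ∈ M, f • z ∈ Λ}
  mul_mem' {a b} := by
    rintro ⟨f, hf, hfa⟩ ⟨g, hg, hgb⟩
    refine ⟨f * g, M.mul_mem hf hg, ?_⟩
    rw [← smul_mul_smul_comm]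
    exact Λ.mul_mem hfa hgb
  add_mem' {a b} := by
    rintro ⟨f, hf, hfa⟩ ⟨g, hg, hgb⟩
    refine ⟨f * g, M.mul_mem hf hg, ?_⟩
    rw [smul_add, mul_comm, mul_smul, mul_comm, mul_smul]
    exact Λ.add_mem (Λ.smul_mem hfa g) (Λ.smul_mem hgb f)
  algebraMap_mem' x := by
    obtain ⟨⟨r, s⟩, h⟩ := IsLocalization.surj M x
    refine ⟨s, s.2, ?_⟩
    rw [Algebra.smul_def, IsScalarTower.algebraMap_apply R O S, ← map_mul, mul_comm, h,
      ← IsScalarTower.algebraMap_apply]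
    exact Λ.algebraMap_mem r

variable (M : Submonoid R) (O : Type*) [CommRing O] [Algebra R O] [IsLocalization M O]
  [Algebra O S] [IsScalarTower R O S] {Λ : Subalgebra R S}

theorem le_localizedOrder : (Λ : Set S) ⊆ localizedOrder M O Λ := fun z hz =>
  ⟨1, M.one_mem, by rwa [one_smul]⟩

theorem localizedOrder_fg (hfg : (Subalgebra.toSubmodule Λ).FG) :
    (Subalgebra.toSubmodule (localizedOrder M O Λ)).FG := by
  obtain ⟨s, hs⟩ := hfg
  refine ⟨s, le_antisymm (Submodule.span_le.2 fun z hz => le_localizedOrder M O ?_) ?_⟩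
  · have : z ∈ Subalgebra.toSubmodule Λ := hs ▸ Submodule.subset_span hz
    exact this
  · rintro z ⟨f, hf, hz⟩
    have h1 : f • z ∈ Submodule.span R (s : Set S) := by
      rw [hs]
      exact hz
    have h2 : f • z ∈ Submodule.span O (s : Set S) := Submodule.span_subset_span R O _ h1
    have h3 : z = IsLocalization.mk' O 1 (⟨f, hf⟩ : M) • f • z := by
      rw [← algebraMap_smul O f z, smul_smul, IsLocalization.mk'_spec O 1 (⟨f, hf⟩ : M), map_one,
        one_smul]
    rw [h3]
    exact Submodule.smul_mem _ _ h2

end LocalizedOrder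

section MaximalLocalizedOrder

theorem irreducible_algebraMap_atPrime {R O : Type*} [CommRing R] {p : R}
    [(Ideal.span {p}).IsPrime] [CommRing O] [IsDomain O] [IsDiscreteValuationRing O] [Algebra R O]
    [IsLocalization.AtPrime O (Ideal.span {p})] : Irreducible (algebraMap R O p) := by
  rw [IsDiscreteValuationRing.irreducible_iff_uniformizer,
    ← IsLocalization.AtPrime.map_eq_maximalIdeal (Ideal.span {p}) O, Ideal.map_span,
    Set.image_singleton]

variable {R K S O : Type*} [CommRing R] [IsDomain R] [IsPrincipalIdealRing R] [Field K]
  [Algebra R K] [IsFractionRing R K] [DivisionRing S] [Algebra K S] [Algebra R S]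
  [IsScalarTower R K S] {p : R} [(Ideal.span {p}).IsPrime] [CommRing O] [IsDomain O]
  [IsDiscreteValuationRing O] [Algebra R O] [IsLocalization.AtPrime O (Ideal.span {p})]
  [Algebra O K] [IsFractionRing O K] [Algebra O S] [IsScalarTower R O S] [IsScalarTower O K S] {Λ : Subalgebra R S}

theorem localizedOrder_le_of_le (hp : Irreducible p)
    (hspan : Submodule.span K (Subalgebra.toSubmodule Λ : Set S) = ⊤)
    (hfg : (Subalgebra.toSubmodule Λ).FG)
    (hmax : ∀ Ω : Subalgebra R S, (Subalgebra.toSubmodule Ω).FG → Λ ≤ Ω → Ω ≤ Λ)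
    (Ω : Subalgebra O S) (hΩ : (Subalgebra.toSubmodule Ω).FG)
    (h : localizedOrder (Ideal.span {p}).primeCompl O Λ ≤ Ω) :
    Ω ≤ localizedOrder (Ideal.span {p}).primeCompl O Λ := by
  have : Module.IsTorsionFree R S := Module.IsTorsionFree.trans_faithfulSMul R K S
  have hp' : Irreducible (algebraMap R O p) := irreducible_algebraMap_atPrime
  obtain ⟨m, hm⟩ := exists_pow_smul_le_of_fg (K := K) hp'
    (N := Subalgebra.toSubmodule (localizedOrder (Ideal.span {p}).primeCompl O Λ))
    (eq_top_iff.2 (hspan.ge.trans (Submodule.span_mono (le_localizedOrder _ O)))) hΩ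
  have hm' (v) (hv : v ∈ Ω) : ∃ f ∈ (Ideal.span {p}).primeCompl, f • p ^ m • v ∈ Λ := by
    have := hm v hv
    rwa [← map_pow, algebraMap_smul] at this
  let Λ' : Subalgebra R S :=
    { carrier := {z | z ∈ Ω ∧ ∃ N, p ^ N • z ∈ Λ}
      mul_mem' := by
        rintro a b ⟨ha, N, hN⟩ ⟨hb, L, hL⟩
        refine ⟨Ω.mul_mem ha hb, N + L, ?_⟩
        rw [pow_add, ← smul_mul_smul_comm]
        exact Λ.mul_mem hN hL
      add_mem' := by
        rintro a b ⟨ha, N, hN⟩ ⟨hb, L, hL⟩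
        refine ⟨Ω.add_mem ha hb, N + L, ?_⟩
        rw [smul_add, pow_add, mul_smul, mul_smul, smul_comm (p ^ N) (p ^ L) a]
        exact Λ.add_mem (Λ.smul_mem hN _) (Λ.smul_mem hL _)
      algebraMap_mem' := fun r => by
        refine ⟨?_, 0, ?_⟩
        · rw [IsScalarTower.algebraMap_apply R O S]
          exact Ω.algebraMap_mem _
        · rw [pow_zero, one_smul]
          exact Λ.algebraMap_mem r }
  have hΛ' : Λ' ≤ Λ := by
    refine hmax Λ' (fg_of_smul_mem hfg (pow_ne_zero m hp.ne_zero) ?_)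
      fun z hz => ⟨h (le_localizedOrder _ O hz), 0, by rwa [pow_zero, one_smul]⟩
    rintro z ⟨hz, N, hN⟩
    obtain ⟨f, hf, hfz⟩ := hm' z hz
    have hf' : ¬ p ∣ f := fun hd => hf (Ideal.mem_span_singleton.2 hd)
    obtain ⟨x, y, hxy⟩ := (hp.coprime_iff_not_dvd.2 hf').pow_left (m := N)
    have h1 : p ^ m • z = (x * p ^ m) • (p ^ N • z) + y • f • p ^ m • z := by
      rw [smul_smul, smul_smul, smul_smul, ← add_smul, mul_right_comm, ← add_mul,
        hxy, one_mul]
    rw [h1]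
    exact Λ.add_mem (Λ.smul_mem hN _) (Λ.smul_mem hfz y)
  intro z hz
  obtain ⟨f, hf, hfz⟩ := hm' z hz
  refine ⟨f, hf, hΛ' ⟨?_, m, ?_⟩⟩
  · rw [← algebraMap_smul O f z]
    exact Ω.smul_mem hz _
  · rwa [smul_comm]

end MaximalLocalizedOrder

section TwinOrder

open Polynomial

variable {k : Type} [Field k] {n : ℕ} {D Δ : Type} [DivisionRing D] [Algebra k D]
  [DivisionRing Δ] [Algebra (RatFunc k) Δ] [Algebra k[X] Δ] [IsScalarTower k[X] (RatFunc k) Δ]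

theorem exists_smul_of_rightTrace_mul_mem_of_isLocalization [Infinite k] (hn : 0 < n)
    (hnk : (n : k) ≠ 0) (hD : IsCentralDivisionAlgebraOfDegree k n D)
    (hΔ : IsCentralDivisionAlgebraOfDegree (RatFunc k) n Δ)
    (hsame : HaveSameMaximalSubfields (RatFunc k) n Δ (RatFunc k ⊗[k] D))
    {p : k[X]} [(Ideal.span {p}).IsPrime] (hp : Irreducible p) {O : Type} [CommRing O] [IsDomain O]
    [IsDiscreteValuationRing O] [Algebra k[X] O] [IsLocalization.AtPrime O (Ideal.span {p})]
    [Algebra O (RatFunc k)] [IsScalarTower k[X] O (RatFunc k)] [IsFractionRing O (RatFunc k)]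
    [Algebra O Δ] [IsScalarTower k[X] O Δ] [IsScalarTower O (RatFunc k) Δ]
    [Algebra k O] [IsScalarTower k O (RatFunc k)]
    {Λ : Subalgebra k[X] Δ} (hfg : (Subalgebra.toSubmodule Λ).FG)
    (hspan : Submodule.span (RatFunc k) (Subalgebra.toSubmodule Λ : Set Δ) = ⊤)
    (hmax : ∀ Ω : Subalgebra k[X] Δ, (Subalgebra.toSubmodule Ω).FG → Λ ≤ Ω → Ω ≤ Λ)
    {z : Δ} (hz : z ∈ Λ)
    (hT : ∀ u ∈ Λ, ∃ t, rightTrace (RatFunc k) Δ (z * u) = algebraMap k[X] (RatFunc k) (p * t)) :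
    ∃ f : k[X], ¬ p ∣ f ∧ ∃ w ∈ Λ, f • z = p • w := by
  have : FiniteDimensional k D := hD.finiteDimensional hn
  have : FiniteDimensional (RatFunc k) Δ := hΔ.finiteDimensional hn
  let : DivisionRing (RatFunc k ⊗[k] D) := ratFuncTensorDivisionRing
  have hfin : Module.finrank (RatFunc k) Δ = Module.finrank (RatFunc k) (RatFunc k ⊗[k] D) := by
    rw [Module.finrank_baseChange, hΔ.2, hD.2]
  set π := algebraMap k[X] O p with hπ
  have hπi : Irreducible π := irreducible_algebraMap_atPrime
  obtain ⟨r, c, hrc, hP1, hP2⟩ :=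
    exists_norm_data_tensorProduct (O := O) (K := RatFunc k) hD.1 hπi
  let a : ℕ → k := Infinite.natEmbedding k
  obtain ⟨y', hy', hyN⟩ := hP2 fun i => algebraMap k O (a i)
  obtain ⟨y, hy⟩ := exists_isTwin_left hn hD hsame y'
  have hmul : r * c = n ^ 2 := hrc.trans hD.2
  obtain ⟨w, ⟨f, hf, hfw⟩, hw⟩ := exists_smul_of_rightTrace_mul_mem (K := RatFunc k)
    (Λ := localizedOrder (Ideal.span {p}).primeCompl O Λ) hΔ.1 hπi (localizedOrder_fg _ O hfg)
    (eq_top_iff.2 (hspan.ge.trans (Submodule.span_mono (le_localizedOrder _ O))))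
    (localizedOrder_le_of_le hp hspan hfg hmax) (hmul.trans hΔ.2.symm)
    (by
      rw [hmul, ← map_natCast (algebraMap k O)]
      refine (Ne.isUnit ?_).map _
      rw [Nat.cast_pow]
      exact pow_ne_zero 2 hnk)
    (fun z hz N hN hd => by
      obtain ⟨z', hz'⟩ := exists_isTwin_right hn hΔ hsame z
      exact hP1 z' (hz'.isIntegral_iff.1 hz) N ((hz'.rightNorm_eq hfin).symm.trans hN) hd)
    y (hy.isIntegral_iff.2 hy') (fun i => algebraMap k O (a i))
    (fun j _ i hij => by
      rw [← map_sub]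
      exact (sub_ne_zero.2 ((Infinite.natEmbedding k).injective.ne hij.ne')).isUnit.map _)
    (fun i hi => by
      obtain ⟨N, hN⟩ := hyN i hi
      refine ⟨N, Eq.trans ?_ hN⟩
      rw [IsScalarTower.algebraMap_apply O (RatFunc k) Δ,
        IsScalarTower.algebraMap_apply O (RatFunc k) (RatFunc k ⊗[k] D)]
      exact (hy.sub_algebraMap _).rightNorm_eq hfin)
    z (le_localizedOrder _ O hz)
    (by
      rintro w ⟨f, hf, hfw⟩
      obtain ⟨t, ht⟩ := hT _ hfw
      let s : (Ideal.span {p}).primeCompl := ⟨f, hf⟩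
      refine ⟨IsLocalization.mk' O t s, ?_⟩
      have hf0 : algebraMap k[X] (RatFunc k) f ≠ 0 := by
        rw [Ne, FaithfulSMul.algebraMap_eq_zero_iff]
        rintro rfl
        exact hf (Ideal.zero_mem _)
      refine mul_left_cancel₀ hf0 ?_
      rw [mul_smul_comm, ← algebraMap_smul (RatFunc k) f, map_smul, smul_eq_mul] at ht
      rw [ht, IsScalarTower.algebraMap_apply k[X] O (RatFunc k),
        IsScalarTower.algebraMap_apply k[X] O (RatFunc k) f, ← map_mul, map_mul,
        mul_left_comm, mul_comm _ (IsLocalization.mk' O t s),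
        IsLocalization.mk'_spec O t s])
  refine ⟨f, fun hd => hf (Ideal.mem_span_singleton.2 hd), f • w, hfw, ?_⟩
  rw [hw, hπ, algebraMap_smul, smul_comm]

theorem exists_smul_of_rightTrace_mul_mem_polynomial [Infinite k] (hn : 0 < n)
    (hnk : (n : k) ≠ 0) (hD : IsCentralDivisionAlgebraOfDegree k n D)
    (hΔ : IsCentralDivisionAlgebraOfDegree (RatFunc k) n Δ)
    (hsame : HaveSameMaximalSubfields (RatFunc k) n Δ (RatFunc k ⊗[k] D))
    {p : k[X]} (hp : Irreducible p)
    {Λ : Subalgebra k[X] Δ} (hfg : (Subalgebra.toSubmodule Λ).FG)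
    (hspan : Submodule.span (RatFunc k) (Subalgebra.toSubmodule Λ : Set Δ) = ⊤)
    (hmax : ∀ Ω : Subalgebra k[X] Δ, (Subalgebra.toSubmodule Ω).FG → Λ ≤ Ω → Ω ≤ Λ)
    {z : Δ} (hz : z ∈ Λ)
    (hT : ∀ u ∈ Λ, ∃ t, rightTrace (RatFunc k) Δ (z * u) = algebraMap k[X] (RatFunc k) (p * t)) :
    ∃ f : k[X], ¬ p ∣ f ∧ ∃ w ∈ Λ, f • z = p • w := by
  have : (Ideal.span {p}).IsPrime := (Ideal.span_singleton_prime hp.ne_zero).2 hp.prime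
  obtain ⟨O, _, _, _, _, _⟩ : ∃ (O : Type) (_ : CommRing O) (_ : IsDomain O) (_ : Algebra k[X] O),
      ∃ _ : IsLocalization.AtPrime O (Ideal.span {p}), IsDiscreteValuationRing O :=
    ⟨Localization.AtPrime (Ideal.span {p}), inferInstance, inferInstance, inferInstance,
      inferInstance, IsLocalization.AtPrime.isDiscreteValuationRing_of_dedekind_domain k[X]
        (P := Ideal.span {p}) (by simpa using hp.ne_zero) _⟩
  have hle := (Ideal.span {p}).primeCompl_le_nonZeroDivisors
  let : Algebra O (RatFunc k) := IsLocalization.localizationAlgebraOfSubmonoidLe O (RatFunc k)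
    (Ideal.span {p}).primeCompl (nonZeroDivisors k[X]) hle
  have : IsScalarTower k[X] O (RatFunc k) :=
    IsLocalization.localization_isScalarTower_of_submonoid_le O (RatFunc k)
      (Ideal.span {p}).primeCompl (nonZeroDivisors k[X]) hle
  have : IsFractionRing O (RatFunc k) :=
    IsFractionRing.isFractionRing_of_isLocalization (Ideal.span {p}).primeCompl O (RatFunc k) hle
  let : Algebra k O := Algebra.compHom O (algebraMap k k[X])
  have : IsScalarTower k k[X] O := IsScalarTower.of_algebraMap_eq fun _ => rfl
  let : Algebra O Δ := Algebra.compHom Δ (algebraMap O (RatFunc k))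
  have : IsScalarTower O (RatFunc k) Δ := IsScalarTower.of_algebraMap_eq fun _ => rfl
  have : IsScalarTower k[X] O Δ := IsScalarTower.of_algebraMap_eq fun f => by
    rw [IsScalarTower.algebraMap_apply k[X] (RatFunc k) Δ,
      IsScalarTower.algebraMap_apply k[X] O (RatFunc k)]
    rfl
  have : IsScalarTower k O (RatFunc k) := IsScalarTower.of_algebraMap_eq fun a => by
    rw [IsScalarTower.algebraMap_apply k k[X] O, ← IsScalarTower.algebraMap_apply k[X] O (RatFunc k),
      ← IsScalarTower.algebraMap_apply k k[X] (RatFunc k)]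
  exact exists_smul_of_rightTrace_mul_mem_of_isLocalization hn hnk hD hΔ hsame hp (O := O) hfg hspan
    hmax hz hT

end TwinOrder

section DegreeOne

theorem bijective_algebraMap_of_finrank_eq_one {k A : Type*} [Field k] [DivisionRing A]
    [Algebra k A] (h : Module.finrank k A = 1) : Function.Bijective (algebraMap k A) := by
  refine ⟨(algebraMap k A).injective, fun z => ?_⟩
  have h1 := Subalgebra.bot_eq_top_iff_finrank_eq_one.2 h
  exact Algebra.mem_bot.1 (h1 ▸ Algebra.mem_top)

theorem exists_constant_form_of_degree_one {k : Type} [Field k] {D Δ : Type} [DivisionRing D]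
    [Algebra k D] [DivisionRing Δ] [Algebra (RatFunc k) Δ]
    (hΔ : IsCentralDivisionAlgebraOfDegree (RatFunc k) 1 Δ) :
    ∃ (D' : Type) (_ : DivisionRing D') (_ : Algebra k D'),
      IsCentralDivisionAlgebraOfDegree k 1 D' ∧ HaveSameMaximalSubfields k 1 D D' ∧
      Nonempty (Δ ≃ₐ[RatFunc k] (RatFunc k ⊗[k] D')) := by
  refine ⟨k, inferInstance, inferInstance, ⟨?_, ?_⟩, fun P _ _ hP => ?_, ⟨?_⟩⟩
  · exact eq_bot_iff.2 fun z _ => Algebra.mem_bot.2 ⟨z, rfl⟩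
  · rw [Module.finrank_self, one_pow]
  · let e := AlgEquiv.ofBijective (Algebra.ofId k P) (bijective_algebraMap_of_finrank_eq_one hP)
    exact ⟨fun _ => ⟨e.symm⟩, fun _ => ⟨(Algebra.ofId k D).comp e.symm⟩⟩
  · exact (AlgEquiv.ofBijective (Algebra.ofId (RatFunc k) Δ)
      (bijective_algebraMap_of_finrank_eq_one (hΔ.2.trans (one_pow 2)))).symm.trans
      (Algebra.TensorProduct.rid k (RatFunc k) (RatFunc k)).symm

theorem IsCentralDivisionAlgebraOfDegree.eq_one_of_finite {k : Type} [Field k] [Finite k] {n : ℕ}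
    (hn : 0 < n) {D : Type} [DivisionRing D] [Algebra k D]
    (hD : IsCentralDivisionAlgebraOfDegree k n D) : n = 1 := by
  have : FiniteDimensional k D := hD.finiteDimensional hn
  have : Finite D := Module.finite_of_finite k
  have h1 : Subalgebra.center k D = ⊤ := eq_top_iff.2 fun z _ =>
    Subalgebra.mem_center_iff.2 fun y => (littleWedderburn D).mul_comm y z
  have h2 := Subalgebra.bot_eq_top_iff_finrank_eq_one.1 (hD.1.symm.trans h1)
  exact (Nat.pow_eq_one.1 (hD.2.symm.trans h2)).resolve_right two_ne_zero

end DegreeOne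

section Descent

open Polynomial

variable {k : Type} [Field k] {n : ℕ} {D Δ : Type} [DivisionRing D] [Algebra k D]
  [DivisionRing Δ] [Algebra (RatFunc k) Δ]

theorem HaveSameMaximalSubfields.of_ratFunc_tensorProduct [Infinite k] (hn : 0 < n)
    (hD : IsCentralDivisionAlgebraOfDegree k n D)
    (hsame : HaveSameMaximalSubfields (RatFunc k) n Δ (RatFunc k ⊗[k] D))
    {D' : Type} [DivisionRing D'] [Algebra k D'] (hD' : IsCentralDivisionAlgebraOfDegree k n D')
    (e : Δ ≃ₐ[RatFunc k] (RatFunc k ⊗[k] D')) : HaveSameMaximalSubfields k n D D' := by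
  have : FiniteDimensional k D := hD.finiteDimensional hn
  have : FiniteDimensional k D' := hD'.finiteDimensional hn
  have h1 : HaveSameMaximalSubfields (RatFunc k) n (RatFunc k ⊗[k] D) (RatFunc k ⊗[k] D') :=
    fun P _ _ hP => (hsame P hP).symm.trans
      ⟨fun ⟨g⟩ => ⟨e.toAlgHom.comp g⟩, fun ⟨g⟩ => ⟨e.symm.toAlgHom.comp g⟩⟩
  exact fun P _ _ hP => ⟨fun ⟨g⟩ => exists_algHom_of_haveSameMaximalSubfields
      (fun _ => isUnit_of_ne_zero_ratFunc_tensorProduct) h1 hP hn g,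
    fun ⟨g⟩ => exists_algHom_of_haveSameMaximalSubfields
      (fun _ => isUnit_of_ne_zero_ratFunc_tensorProduct) (fun Q _ _ hQ => (h1 Q hQ).symm) hP hn g⟩

theorem exists_constant_form_of_infinite [Infinite k] (hn : 0 < n) (hnk : (n : k) ≠ 0)
    (hD : IsCentralDivisionAlgebraOfDegree k n D)
    (hΔ : IsCentralDivisionAlgebraOfDegree (RatFunc k) n Δ)
    (hsame : HaveSameMaximalSubfields (RatFunc k) n Δ (RatFunc k ⊗[k] D)) :
    ∃ (D' : Type) (_ : DivisionRing D') (_ : Algebra k D'),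
      IsCentralDivisionAlgebraOfDegree k n D' ∧
      Nonempty (Δ ≃ₐ[RatFunc k] (RatFunc k ⊗[k] D')) := by
  have : FiniteDimensional (RatFunc k) Δ := hΔ.finiteDimensional hn
  let : Algebra k[X] Δ := Algebra.compHom Δ (algebraMap k[X] (RatFunc k))
  have : IsScalarTower k[X] (RatFunc k) Δ := IsScalarTower.of_algebraMap_eq fun _ => rfl
  have hfk : ((Module.finrank (RatFunc k) Δ : ℕ) : k) ≠ 0 := by
    rw [hΔ.2, Nat.cast_pow]
    exact pow_ne_zero 2 hnk
  obtain ⟨w, hw, hwX⟩ := exists_valuation_at_infinity hn hD hΔ hsame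
  have hK (f : RatFunc k) : w (algebraMap (RatFunc k) Δ f) = inftyVal k f ^ (n ^ 2) := by
    rw [hw, rightNorm_algebraMap, hΔ.2, map_pow]
  obtain ⟨Λ, hfg, hspan, hmax⟩ := exists_maximal_order k[X] (RatFunc k) Δ (by
    rw [← map_natCast (algebraMap k (RatFunc k))]
    exact (_root_.map_ne_zero _).2 hfk)
  obtain ⟨c, hc, hc1, horth⟩ := exists_basis_valuation_eq_one (pow_pos hn 2) hfk hK hwX hfg hspan
    (fun z hz hz0 => by
      obtain ⟨t, ht⟩ := rightNorm_mem_of_order hfg hspan hz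
      rw [hw, ht]
      refine one_le_inftyValuation_algebraMap fun h => rightNorm_ne_zero (K := RatFunc k) hz0 ?_
      rw [ht, h, map_zero])
    (mem_of_rightTrace_mul_mem hspan fun p hp z hz hT =>
      exists_smul_of_rightTrace_mul_mem_polynomial hn hnk hD hΔ hsame hp hfg hspan hmax hz hT)
  exact exists_constant_form hΔ hK Λ c hc hc1 horth

end Descent

/-- If `D` is a central division algebra of degree `n` (prime to `char k`) over `k`, and `Δ` is a
central division algebra of degree `n` over `K = k(x)` with the same maximal subfields as
`D ⊗_k K`, then `Δ ≃ D' ⊗_k K` for some central division algebra `D'` of degree `n` over `k`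
having the same maximal subfields as `D`. -/
theorem genus_descends_along_rational_function_field
    (k : Type) [Field k] (n : ℕ) (hn : 0 < n) (hchar : ¬ (ringChar k ∣ n))
    (D : Type) [DivisionRing D] [Algebra k D]
    (hD : IsCentralDivisionAlgebraOfDegree k n D)
    (Δ : Type) [DivisionRing Δ] [Algebra (RatFunc k) Δ]
    (hΔ : IsCentralDivisionAlgebraOfDegree (RatFunc k) n Δ)
    (hsame : HaveSameMaximalSubfields (RatFunc k) n Δ (RatFunc k ⊗[k] D)) :
    ∃ (D' : Type) (_ : DivisionRing D') (_ : Algebra k D'),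
      IsCentralDivisionAlgebraOfDegree k n D' ∧
      HaveSameMaximalSubfields k n D D' ∧
      Nonempty (Δ ≃ₐ[RatFunc k] (RatFunc k ⊗[k] D')) := by
  rcases finite_or_infinite k with hk | hk
  · obtain rfl := hD.eq_one_of_finite hn
    exact exists_constant_form_of_degree_one hΔ
  · obtain ⟨D', _, _, hD', ⟨e⟩⟩ := exists_constant_form_of_infinite hn
      (fun h => hchar ((ringChar.spec k n).1 h)) hD hΔ hsame
    exact ⟨D', _, _, hD', .of_ratFunc_tensorProduct hn hD hsame hD' e, ⟨e⟩⟩
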